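/- Ionescu–Wainger type multiplier theorem with logarithmic loss: let Θ : ℝ^d → ℂ be a bounded measurable multiplier such that for every p ∈ (1, ∞) there is A_p > 0 with ‖ℱ^{−1}(Θ · ℱf)‖_{L^p(ℝ^d)} ≤ A_p ‖f‖_{L^p(ℝ^d)} for all f ∈ L²(ℝ^d) ∩ L^p(ℝ^d). Then for every ρ > 0 and every p ∈ (1, ∞) there is a constant C_{ρ,p} > 0 such that for every N ∈ ℕ, every diagonal matrix E_N as in the context, and every finitely supported f : ℤ^d → ℂ, ‖ ℱ^{−1}(Δ_N f̂) ‖_{ℓ^p(ℤ^d)} ≤ C_{ρ,p} · A_p · log(N+2) · ‖f‖_{ℓ^p(ℤ^d)}. -/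

import Mathlib

open scoped ENNReal
open MeasureTheory

noncomputable section

/-- `D = ⌊2/ρ⌋ + 1`. -/
def DIW (ρ : ℝ) : ℕ := ⌊2 / ρ⌋₊ + 1

/-- `N₀ = ⌊N^{ρ/2}⌋ + 1`. -/
def NzeroIW (ρ : ℝ) (N : ℕ) : ℕ := ⌊(N : ℝ) ^ (ρ / 2)⌋₊ + 1

/-- `Q₀ = (N₀!)^D`. -/
def QzeroIW (ρ : ℝ) (N : ℕ) : ℕ := (Nat.factorial (NzeroIW ρ N)) ^ (DIW ρ)

/-- `ℙ_N`, the primes `p` with `N₀ < p ≤ N`. -/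
def primesIW (ρ : ℝ) (N : ℕ) : Set ℕ := {p | p.Prime ∧ NzeroIW ρ N < p ∧ p ≤ N}

/-- `Π(V)`: all products of at most `D` distinct prime factors from `V`, at powers between
`1` and `D`. -/
def PiProdIW (D : ℕ) (V : Set ℕ) : Set ℕ :=
  {w | ∃ k : ℕ, 1 ≤ k ∧ k ≤ D ∧
    ∃ p γ : Fin k → ℕ, (∀ l, p l ∈ V) ∧ Function.Injective p ∧
      (∀ l, 1 ≤ γ l ∧ γ l ≤ D) ∧ w = ∏ l, p l ^ γ l}

/-- `P_N = {Q·w : Q ∣ Q₀, w ∈ Π(ℙ_N) ∪ {1}}`. -/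
def PNIW (ρ : ℝ) (N : ℕ) : Set ℕ :=
  {q | ∃ Q w : ℕ, Q ∣ QzeroIW ρ N ∧
    (w ∈ PiProdIW (DIW ρ) (primesIW ρ N) ∨ w = 1) ∧ q = Q * w}

/-- `A_q = {a ∈ {1,…,q}^d : gcd(q, gcd(a₁,…,a_d)) = 1}`. -/
def AqIW (d q : ℕ) : Set (Fin d → ℕ) :=
  {a | (∀ i, 1 ≤ a i ∧ a i ≤ q) ∧ Nat.gcd q (Finset.univ.gcd a) = 1}

/-- `𝒰_N` realized as the set of points `a/q ∈ [0,1)^d ⊆ ℝ^d` with `q ∈ P_N`, `a ∈ A_q`. -/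
def UNIW (ρ : ℝ) (d N : ℕ) : Set (EuclideanSpace ℝ (Fin d)) :=
  {v | ∃ q ∈ PNIW ρ N, ∃ a ∈ AqIW d q, v = fun i => (a i : ℝ) / (q : ℝ)}

/-- The Ionescu–Wainger multiplier
`Δ_N(ξ) = Σ_{a/q ∈ 𝒰_N} Θ(ξ − a/q) η(E_N^{−1}(ξ − a/q))`, periodized over `ℤ^d`. -/
def deltaIW (ρ : ℝ) (d N : ℕ) (Θ : EuclideanSpace ℝ (Fin d) → ℂ)
    (η : EuclideanSpace ℝ (Fin d) → ℝ) (eN : Fin d → ℝ)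
    (ξ : EuclideanSpace ℝ (Fin d)) : ℂ :=
  ∑' (v : UNIW ρ d N) (mv : Fin d → ℤ),
    Θ (WithLp.toLp 2 fun i => ξ i - (v : EuclideanSpace ℝ (Fin d)) i - (mv i : ℝ)) *
      ((η (WithLp.toLp 2 fun i => (ξ i - (v : EuclideanSpace ℝ (Fin d)) i - (mv i : ℝ)) / eN i) : ℝ) : ℂ)

/-- The discrete operator `ℱ^{−1}(Δ_N f̂)` on `ℤ^d`. -/
def discOpIW (ρ : ℝ) (d N : ℕ) (Θ : EuclideanSpace ℝ (Fin d) → ℂ)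
    (η : EuclideanSpace ℝ (Fin d) → ℝ) (eN : Fin d → ℝ)
    (f : (Fin d → ℤ) → ℂ) (x : Fin d → ℤ) : ℂ :=
  ∫ ξ in {ξ : EuclideanSpace ℝ (Fin d) | ∀ i, ξ i ∈ Set.Ico (0 : ℝ) 1},
    deltaIW ρ d N Θ η eN ξ *
      (∑' y : Fin d → ℤ, f y *
        Complex.exp (2 * Real.pi * Complex.I * (∑ i, ξ i * (y i : ℝ)))) *
      Complex.exp (-(2 * Real.pi * Complex.I) * (∑ i, ξ i * (x i : ℝ)))

open scoped BigOperators
set_option linter.unusedSectionVars false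
set_option linter.unusedVariables false
namespace IW

section prod
variable {ι : Type*} [Fintype ι] [DecidableEq ι] {Z : ι → Type*} [∀ i, Fintype (Z i)]
  [∀ i, Nonempty (Z i)]

/-- `u` depends only on the coordinates in `S`. -/
def Dep {α : Type*} (u : (∀ i, Z i) → α) (S : Finset ι) : Prop :=
  ∀ x y, (∀ i ∈ S, x i = y i) → u x = u y

/-- conditional expectation on the coordinates in `J`. -/
noncomputable def cE {K : Type*} [Field K] [CharZero K] (J : Finset ι) (u : (∀ i, Z i) → K)
    (h : ∀ i, Z i) : K := 𝔼 h', u (J.piecewise h h')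

lemma Dep.mono {α : Type*} {u : (∀ i, Z i) → α} {S T : Finset ι} (hu : Dep u S) (h : S ⊆ T) :
    Dep u T := fun x y hxy => hu x y fun i hi => hxy i (h hi)

lemma Dep.comp2 {α β γ : Type*} (F : α → β → γ) {u : (∀ i, Z i) → α} {v : (∀ i, Z i) → β}
    {S : Finset ι} (hu : Dep u S) (hv : Dep v S) : Dep (fun h => F (u h) (v h)) S :=
  fun x y hxy => by simp only [hu x y hxy, hv x y hxy]

lemma Dep.comp {α β : Type*} (F : α → β) {u : (∀ i, Z i) → α}
    {S : Finset ι} (hu : Dep u S) : Dep (fun h => F (u h)) S :=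
  fun x y hxy => by simp only [hu x y hxy]

lemma Dep.sum {α β : Type*} [AddCommMonoid β] (s : Finset α) {u : α → (∀ i, Z i) → β}
    {S : Finset ι} (hu : ∀ a ∈ s, Dep (u a) S) : Dep (fun h => ∑ a ∈ s, u a h) S :=
  fun x y hxy => Finset.sum_congr rfl fun a ha => hu a ha x y hxy

variable {K : Type*} [Field K] [CharZero K]

lemma cE_dep (J : Finset ι) (u : (∀ i, Z i) → K) : Dep (cE J u) J := by
  intro x y hxy
  unfold cE
  refine Finset.expect_congr rfl fun h' _ => ?_
  congr 1
  ext i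
  by_cases hi : i ∈ J <;> simp [hi, hxy]

lemma expect_swap (J : Finset ι) (F : (∀ i, Z i) → (∀ i, Z i) → K) :
    𝔼 h, 𝔼 h', F (J.piecewise h h') (J.piecewise h' h) = 𝔼 h, 𝔼 h', F h h' := by
  rw [← Finset.expect_product' Finset.univ Finset.univ
    (fun h h' => F (J.piecewise h h') (J.piecewise h' h)),
    ← Finset.expect_product' Finset.univ Finset.univ (fun h h' => F h h')]
  have inv : Function.Involutive (fun q : (∀ i, Z i) × (∀ i, Z i) =>
      (J.piecewise q.1 q.2, J.piecewise q.2 q.1)) := by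
    intro q
    ext i <;> by_cases hi : i ∈ J <;> simp [hi]
  refine Finset.expect_equiv inv.toPerm (by simp) ?_
  intro q _
  simp [Function.Involutive.toPerm]

lemma expect_cE (J : Finset ι) (u : (∀ i, Z i) → K) : 𝔼 h, cE J u h = 𝔼 h, u h := by
  have := expect_swap J (fun h _ => u h)
  simp only [Fintype.expect_const] at this
  exact this

lemma cE_mul {J : Finset ι} {v : (∀ i, Z i) → K} (hv : Dep v J) (u : (∀ i, Z i) → K)
    (h : ∀ i, Z i) : cE J (fun h => v h * u h) h = v h * cE J u h := by
  unfold cE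
  rw [Finset.mul_expect]
  refine Finset.expect_congr rfl fun h' _ => ?_
  show v _ * u _ = _
  rw [hv (J.piecewise h h') h (fun i hi => by simp [hi])]

/-- The basic tool: `𝔼[v u] = 𝔼[v cE J u]` if `v` depends on `J`. -/
lemma expect_mul_cE {J : Finset ι} {v : (∀ i, Z i) → K} (hv : Dep v J) (u : (∀ i, Z i) → K) :
    𝔼 h, v h * cE J u h = 𝔼 h, v h * u h := by
  rw [← expect_cE J (fun h => v h * u h)]
  exact Finset.expect_congr rfl fun h _ => (cE_mul hv u h).symm

lemma cE_inter {A S : Finset ι} {u : (∀ i, Z i) → K} (hu : Dep u S) :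
    cE A u = cE (A ∩ S) u := by
  ext h
  unfold cE
  refine Finset.expect_congr rfl fun h' _ => hu _ _ fun i hi => ?_
  by_cases hA : i ∈ A <;> simp [hA, hi]

lemma cE_of_dep {J : Finset ι} {u : (∀ i, Z i) → K} (hu : Dep u J) : cE J u = u := by
  ext h
  unfold cE
  rw [← Fintype.expect_const (ι := ∀ i, Z i) (u h)]
  exact Finset.expect_congr rfl fun h' _ => hu _ _ (fun i hi => by simp [hi])

lemma cE_empty (u : (∀ i, Z i) → K) (h) : cE ∅ u h = 𝔼 h', u h' := by
  simp [cE]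

/-- independence -/
lemma expect_mul_of_disjoint {S T : Finset ι} (hST : Disjoint S T) {u v : (∀ i, Z i) → K}
    (hu : Dep u S) (hv : Dep v T) : 𝔼 h, u h * v h = (𝔼 h, u h) * 𝔼 h, v h := by
  rw [← expect_mul_cE hu v, cE_inter hv, Finset.disjoint_iff_inter_eq_empty.1 hST]
  simp_rw [cE_empty]
  rw [Finset.expect_mul]

lemma cE_sum {α : Type*} (J : Finset ι) (s : Finset α) (u : α → (∀ i, Z i) → K) (h) :
    cE J (fun h => ∑ a ∈ s, u a h) h = ∑ a ∈ s, cE J (u a) h := by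
  unfold cE
  rw [Finset.expect_sum_comm]

lemma expect_mono' {u v : (∀ i, Z i) → ℝ} (h : ∀ x, u x ≤ v x) : 𝔼 x, u x ≤ 𝔼 x, v x :=
  Finset.expect_le_expect fun x _ => h x

lemma expect_nonneg' {u : (∀ i, Z i) → ℝ} (h : ∀ x, 0 ≤ u x) : 0 ≤ 𝔼 x, u x :=
  Finset.expect_nonneg fun x _ => h x

lemma cE_nonneg (J : Finset ι) {u : (∀ i, Z i) → ℝ} (h : ∀ x, 0 ≤ u x) (x) : 0 ≤ cE J u x :=
  Finset.expect_nonneg fun x _ => h _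

lemma young_aux (r : ℕ) (hr : 1 ≤ r) {a b : ℝ} (ha : 0 ≤ a) (hb : 0 ≤ b) :
    a * b ^ r ≤ b ^ (r+1) + a ^ r * b := by
  rcases le_total a b with h | h
  · have : a * b ^ r ≤ b * b ^ r := by gcongr
    have h2 : 0 ≤ a ^ r * b := by positivity
    rw [pow_succ']; linarith
  · obtain ⟨k, rfl⟩ : ∃ k, r = k+1 := ⟨r-1, by omega⟩
    have : a * b ^ (k+1) ≤ a ^ (k+1) * b := by
      have h1 : b ^ k ≤ a ^ k := by gcongr
      calc a * b ^ (k+1) = a * b * b ^ k := by ring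
        _ ≤ a * b * a ^ k := by gcongr
        _ = _ := by ring
    have h2 : 0 ≤ b ^ (k+1+1) := by positivity
    linarith

/-- `G_J`. -/
noncomputable def GG (g : Finset ι → (∀ i, Z i) → ℝ) (J : Finset ι) (h : ∀ i, Z i) : ℝ :=
  ∑ S ∈ Finset.univ.filter (fun S => J ⊆ S), g S h

/-- `Γ_J`. -/
noncomputable def Gam (g : Finset ι → (∀ i, Z i) → ℝ) (J : Finset ι) : (∀ i, Z i) → ℝ :=
  cE J (GG g J)

lemma card_Icc_le {D : ℕ} {J S : Finset ι} (hS : S.card ≤ D) :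
    ((Finset.Icc J S).card : ℝ) ≤ 2 ^ D := by
  have h1 : (Finset.Icc J S).card ≤ S.powerset.card :=
    Finset.card_le_card (fun T hT => by simp [(Finset.mem_Icc.1 hT).2])
  rw [Finset.card_powerset] at h1
  have : (Finset.Icc J S).card ≤ 2 ^ D := h1.trans (Nat.pow_le_pow_right (by norm_num) hS)
  exact_mod_cast this

lemma lemmaR (D : ℕ) (r : ℕ) (hr : 1 ≤ r) : ∃ C : ℝ, 0 ≤ C ∧
    ∀ (ι : Type) [Fintype ι] [DecidableEq ι] (Z : ι → Type) [∀ i, Fintype (Z i)]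
      [∀ i, Nonempty (Z i)] (g : Finset ι → (∀ i, Z i) → ℝ), (∀ S h, 0 ≤ g S h) →
      (∀ S, Dep (g S) S) → (∀ S, D < S.card → g S = 0) →
      ∀ (J : Finset ι) (φ : (∀ i, Z i) → ℝ), (∀ h, 0 ≤ φ h) → Dep φ J →
      𝔼 h, φ h * GG g J h ^ r ≤
        C * ∑ J' ∈ Finset.univ.filter (fun J' => J ⊆ J'), 𝔼 h, φ h * Gam g J' h ^ r := by
  classical
  induction r, hr using Nat.le_induction with
  | base =>
    refine ⟨1, zero_le_one, ?_⟩
    intro ι _ _ Z _ _ g hg hgd hgD J φ hφ hφd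
    simp only [pow_one, one_mul]
    rw [← expect_mul_cE hφd]
    refine Finset.single_le_sum (f := fun J' => 𝔼 h, φ h * Gam g J' h) ?_ (by simp)
    intro J' _
    exact expect_nonneg' fun h => mul_nonneg (hφ h)
      (cE_nonneg _ (fun x => Finset.sum_nonneg fun S _ => hg S x) _)
  | succ r hr ih =>
    obtain ⟨C, hC, ih⟩ := ih
    refine ⟨((2:ℝ) ^ D) ^ r * (C * (2 * 2 ^ D)), by positivity, ?_⟩
    intro ι _ _ Z _ _ g hg hgd hgD J φ hφ hφd
    have hG0 : ∀ J h, 0 ≤ GG g J h := fun J h => Finset.sum_nonneg fun S _ => hg S h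
    have hΓ0 : ∀ J h, 0 ≤ Gam g J h := fun J h => cE_nonneg _ (hG0 J) h
    have hΓd : ∀ J, Dep (Gam g J) J := fun J => cE_dep _ _
    -- step 1
    have step1 : 𝔼 h, φ h * GG g J h ^ (r+1) ≤ ((2:ℝ) ^ D) ^ r *
        ∑ J' ∈ Finset.univ.filter (fun J' => J ⊆ J'), 𝔼 h, φ h * Gam g J' h * GG g J' h ^ r := by
      have key : ∀ S ∈ Finset.univ.filter (fun S => J ⊆ S), 𝔼 h, φ h * (g S h * GG g J h ^ r) ≤
          ((2:ℝ) ^ D) ^ r * ∑ J' ∈ Finset.Icc J S, 𝔼 h, φ h * cE J' (g S) h * GG g J' h ^ r := by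
        intro S hS
        have hJS : J ⊆ S := by simpa using hS
        by_cases hSD : D < S.card
        · have : g S = 0 := hgD S hSD
          simp only [this, Pi.zero_apply, zero_mul, mul_zero, Finset.expect_const_zero]
          have h0 : ∀ (J' : Finset ι) h, cE J' (0 : (∀ i, Z i) → ℝ) h = 0 := by
            intro J' h; simp [cE]
          simp [h0]
        push Not at hSD
        set GS : Finset ι → (∀ i, Z i) → ℝ := fun J' h =>
          ∑ S' ∈ Finset.univ.filter (fun S' => J ⊆ S' ∧ S' ∩ S = J'), g S' h with hGS
        have hGS0 : ∀ J' h, 0 ≤ GS J' h := fun J' h => Finset.sum_nonneg fun S _ => hg S h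
        have hGSle : ∀ J' h, GS J' h ≤ GG g J' h := by
          intro J' h
          refine Finset.sum_le_sum_of_subset_of_nonneg ?_ (fun S _ _ => hg S h)
          intro S' hS'
          simp only [Finset.mem_filter, Finset.mem_univ, true_and] at hS' ⊢
          rw [← hS'.2]; exact Finset.inter_subset_left
        have hsplit : ∀ h, GG g J h = ∑ J' ∈ Finset.Icc J S, GS J' h := by
          intro h
          simp only [GG, hGS]
          rw [← Finset.sum_fiberwise_of_maps_to (t := Finset.Icc J S) (g := fun S' => S' ∩ S)]
          · refine Finset.sum_congr rfl fun J' _ => ?_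
            rw [Finset.filter_filter]
          · intro S' hS'
            simp only [Finset.mem_filter, Finset.mem_univ, true_and] at hS'
            simp only [Finset.mem_Icc]
            exact ⟨Finset.subset_inter hS' hJS, Finset.inter_subset_right⟩
        have hpow : ∀ h, GG g J h ^ r ≤ ((2:ℝ) ^ D) ^ r * ∑ J' ∈ Finset.Icc J S, GS J' h ^ r := by
          intro h
          obtain ⟨k, rfl⟩ : ∃ k, r = k+1 := ⟨r-1, by omega⟩
          have h1 := pow_sum_div_card_le_sum_pow (s := Finset.Icc J S) (f := fun J' => GS J' h)
            (fun J' _ => hGS0 J' h) k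
          rw [hsplit h]
          have hc : (0:ℝ) < ((Finset.Icc J S).card : ℝ) := by
            have : (Finset.Icc J S).Nonempty := ⟨J, by simp [hJS]⟩
            exact_mod_cast this.card_pos
          rw [div_le_iff₀ (by positivity)] at h1
          have hs0 : 0 ≤ ∑ J' ∈ Finset.Icc J S, GS J' h ^ (k+1) :=
            Finset.sum_nonneg fun J' _ => pow_nonneg (hGS0 J' h) _
          have h2 : ((Finset.Icc J S).card : ℝ) ^ k ≤ ((2:ℝ)^D) ^ (k+1) := by
            calc ((Finset.Icc J S).card : ℝ) ^ k ≤ ((2:ℝ)^D) ^ k := by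
                  gcongr; exact card_Icc_le hSD
              _ ≤ _ := pow_le_pow_right₀ (one_le_pow₀ (by norm_num)) (by omega)
          calc _ ≤ _ := h1
            _ ≤ (∑ J' ∈ Finset.Icc J S, GS J' h ^ (k+1)) * ((2:ℝ)^D) ^ (k+1) := by gcongr
            _ = _ := by ring
        calc 𝔼 h, φ h * (g S h * GG g J h ^ r)
            ≤ 𝔼 h, ((2:ℝ) ^ D) ^ r * ∑ J' ∈ Finset.Icc J S, φ h * g S h * GS J' h ^ r := by
              refine expect_mono' fun h => ?_
              have := mul_le_mul_of_nonneg_left (hpow h) (mul_nonneg (hφ h) (hg S h))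
              rw [← Finset.mul_sum]
              linarith
          _ = ((2:ℝ) ^ D) ^ r * ∑ J' ∈ Finset.Icc J S, 𝔼 h, φ h * g S h * GS J' h ^ r := by
              rw [← Finset.mul_expect, Finset.expect_sum_comm]
          _ ≤ _ := by
              refine mul_le_mul_of_nonneg_left (Finset.sum_le_sum fun J' hJ' => ?_) (by positivity)
              obtain ⟨hJJ', hJ'S⟩ := Finset.mem_Icc.1 hJ'
              have hGSd : Dep (GS J') (S \ J')ᶜ := by
                refine Dep.sum _ fun S' hS' => (hgd S').mono ?_
                simp only [Finset.mem_filter, Finset.mem_univ, true_and] at hS'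
                intro i hi
                simp only [Finset.mem_compl, Finset.mem_sdiff, not_and, not_not]
                intro hiS; rw [← hS'.2]; simp [hi, hiS]
              have hvd : Dep (fun h => φ h * GS J' h ^ r) (S \ J')ᶜ := by
                refine Dep.comp2 (fun a b => a * b ^ r) (hφd.mono ?_) hGSd
                intro i hi
                simp only [Finset.mem_compl, Finset.mem_sdiff, not_and, not_not]
                intro _; exact hJJ' hi
              have hAS : (S \ J')ᶜ ∩ S = J' := by
                ext i
                simp only [Finset.mem_inter, Finset.mem_compl, Finset.mem_sdiff, not_and, not_not]
                exact ⟨fun h => h.1 h.2, fun h => ⟨fun _ => h, hJ'S h⟩⟩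
              have e := expect_mul_cE hvd (g S)
              rw [cE_inter (hgd S), hAS] at e
              calc 𝔼 h, φ h * g S h * GS J' h ^ r = 𝔼 h, φ h * GS J' h ^ r * g S h :=
                    Finset.expect_congr rfl fun h _ => by ring
                _ = _ := e.symm
                _ ≤ _ := by
                    refine expect_mono' fun h => ?_
                    have h1 : GS J' h ^ r ≤ GG g J' h ^ r :=
                      pow_le_pow_left₀ (hGS0 _ _) (hGSle _ _) _
                    have h2 : 0 ≤ φ h * cE J' (g S) h := mul_nonneg (hφ h) (cE_nonneg _ (hg S) h)
                    nlinarith [mul_le_mul_of_nonneg_left h1 h2]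
      calc 𝔼 h, φ h * GG g J h ^ (r+1)
          = ∑ S ∈ Finset.univ.filter (fun S => J ⊆ S), 𝔼 h, φ h * (g S h * GG g J h ^ r) := by
            rw [← Finset.expect_sum_comm]
            refine Finset.expect_congr rfl fun h _ => ?_
            rw [← Finset.mul_sum, ← Finset.sum_mul, pow_succ']; rfl
        _ ≤ ∑ S ∈ Finset.univ.filter (fun S => J ⊆ S), ((2:ℝ) ^ D) ^ r *
              ∑ J' ∈ Finset.Icc J S, 𝔼 h, φ h * cE J' (g S) h * GG g J' h ^ r :=
            Finset.sum_le_sum key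
        _ = _ := by
            rw [← Finset.mul_sum]
            congr 1
            rw [Finset.sum_comm' (t' := Finset.univ.filter (fun J' => J ⊆ J'))
              (s' := fun J' => Finset.univ.filter (fun S => J' ⊆ S))]
            · refine Finset.sum_congr rfl fun J' _ => ?_
              rw [← Finset.expect_sum_comm]
              refine Finset.expect_congr rfl fun h _ => ?_
              rw [← Finset.sum_mul, ← Finset.mul_sum, ← cE_sum]; rfl
            · intro S J'
              simp only [Finset.mem_filter, Finset.mem_univ, true_and, Finset.mem_Icc]
              exact ⟨fun h => ⟨h.2.2, h.2.1⟩, fun h => ⟨h.2.trans h.1, h.2, h.1⟩⟩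
    have hcount : ∀ J' h, ∑ J'' ∈ Finset.univ.filter (fun J'' => J' ⊆ J''), GG g J'' h ≤
        2 ^ D * GG g J' h := by
      intro J' h
      unfold GG
      rw [Finset.sum_comm' (t' := Finset.univ.filter (fun S => J' ⊆ S))
              (s' := fun S => Finset.Icc J' S)]
      · rw [Finset.mul_sum]
        refine Finset.sum_le_sum fun S _ => ?_
        rw [Finset.sum_const, nsmul_eq_mul]
        by_cases hSD : D < S.card
        · simp [hgD S hSD]
        · exact mul_le_mul_of_nonneg_right (card_Icc_le (by omega)) (hg S h)
      · intro S J''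
        simp only [Finset.mem_filter, Finset.mem_univ, true_and, Finset.mem_Icc]
        exact ⟨fun h => ⟨h, h.1.trans h.2⟩, fun h => h.1⟩
    have hΓzero : ∀ J' : Finset ι, D < J'.card → Gam g J' = 0 := by
      intro J' hJ'
      have : GG g J' = 0 := by
        ext h
        refine Finset.sum_eq_zero fun S hS => ?_
        rw [hgD S (hJ'.trans_le (Finset.card_le_card (by simpa using hS)))]; rfl
      unfold Gam; rw [this]; ext h; simp [cE]
    refine step1.trans ?_
    rw [mul_assoc]
    refine mul_le_mul_of_nonneg_left ?_ (by positivity)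
    calc ∑ J' ∈ Finset.univ.filter (fun J' => J ⊆ J'), 𝔼 h, φ h * Gam g J' h * GG g J' h ^ r
        ≤ ∑ J' ∈ Finset.univ.filter (fun J' => J ⊆ J'), C *
          ∑ J'' ∈ Finset.univ.filter (fun J'' => J' ⊆ J''),
            𝔼 h, φ h * Gam g J' h * Gam g J'' h ^ r := by
          refine Finset.sum_le_sum fun J' hJ' => ?_
          refine ih ι Z g hg hgd hgD J' (fun h => φ h * Gam g J' h)
            (fun h => mul_nonneg (hφ h) (hΓ0 _ _)) ?_
          exact Dep.comp2 (fun a b => a * b) (hφd.mono (by simpa using hJ')) (hΓd J')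
      _ ≤ C * (∑ J' ∈ Finset.univ.filter (fun J' => J ⊆ J'),
          ∑ J'' ∈ Finset.univ.filter (fun J'' => J' ⊆ J''), 𝔼 h, φ h * Gam g J'' h ^ (r+1) +
          ∑ J' ∈ Finset.univ.filter (fun J' => J ⊆ J'),
          ∑ J'' ∈ Finset.univ.filter (fun J'' => J' ⊆ J''),
            𝔼 h, φ h * (Gam g J' h ^ r * Gam g J'' h)) := by
          rw [← Finset.mul_sum, ← Finset.sum_add_distrib]
          refine mul_le_mul_of_nonneg_left ?_ hC
          refine Finset.sum_le_sum fun J' hJ' => ?_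
          rw [← Finset.sum_add_distrib]
          refine Finset.sum_le_sum fun J'' hJ'' => ?_
          rw [← Finset.expect_add_distrib]
          refine expect_mono' fun h => ?_
          have := mul_le_mul_of_nonneg_left
            (young_aux r hr (hΓ0 J' h) (hΓ0 J'' h)) (hφ h)
          linarith
      _ ≤ C * (2 ^ D * ∑ J' ∈ Finset.univ.filter (fun J' => J ⊆ J'),
            𝔼 h, φ h * Gam g J' h ^ (r+1) +
          2 ^ D * ∑ J' ∈ Finset.univ.filter (fun J' => J ⊆ J'),
            𝔼 h, φ h * Gam g J' h ^ (r+1)) := by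
          refine mul_le_mul_of_nonneg_left (add_le_add ?_ ?_) hC
          · rw [Finset.sum_comm' (t' := Finset.univ.filter (fun S => J ⊆ S))
              (s' := fun S => Finset.Icc J S)]
            · rw [Finset.mul_sum]
              refine Finset.sum_le_sum fun S _ => ?_
              rw [Finset.sum_const, nsmul_eq_mul]
              by_cases hSD : D < S.card
              · simp [hΓzero S hSD]
              · exact mul_le_mul_of_nonneg_right (card_Icc_le (by omega))
                  (expect_nonneg' fun h => mul_nonneg (hφ h) (pow_nonneg (hΓ0 _ _) _))
            · intro S J''
              simp only [Finset.mem_filter, Finset.mem_univ, true_and, Finset.mem_Icc]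
              exact ⟨fun h => ⟨h, h.1.trans h.2⟩, fun h => h.1⟩
          · rw [Finset.mul_sum]
            refine Finset.sum_le_sum fun J' hJ' => ?_
            have hJJ' : J ⊆ J' := by simpa using hJ'
            have hvd : Dep (fun h => φ h * Gam g J' h ^ r) J' :=
              Dep.comp2 (fun a b => a * b ^ r) (hφd.mono hJJ') (hΓd J')
            calc ∑ J'' ∈ Finset.univ.filter (fun J'' => J' ⊆ J''),
                  𝔼 h, φ h * (Gam g J' h ^ r * Gam g J'' h)
                = ∑ J'' ∈ Finset.univ.filter (fun J'' => J' ⊆ J''),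
                  𝔼 h, (φ h * Gam g J' h ^ r) * GG g J'' h := by
                  refine Finset.sum_congr rfl fun J'' hJ'' => ?_
                  rw [← expect_mul_cE (hvd.mono (by simpa using hJ'')) (GG g J'')]
                  exact Finset.expect_congr rfl fun h _ => by simp only [Gam]; ring
              _ = 𝔼 h, (φ h * Gam g J' h ^ r) *
                  ∑ J'' ∈ Finset.univ.filter (fun J'' => J' ⊆ J''), GG g J'' h := by
                  rw [← Finset.expect_sum_comm]
                  simp_rw [Finset.mul_sum]
              _ ≤ 𝔼 h, 2 ^ D * ((φ h * Gam g J' h ^ r) * GG g J' h) := by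
                  refine expect_mono' fun h => ?_
                  have := mul_le_mul_of_nonneg_left (hcount J' h)
                    (mul_nonneg (hφ h) (pow_nonneg (hΓ0 J' h) r))
                  linarith
              _ = 2 ^ D * 𝔼 h, (φ h * Gam g J' h ^ r) * Gam g J' h := by
                  rw [← Finset.mul_expect, ← expect_mul_cE hvd (GG g J')]; rfl
              _ = _ := by
                  congr 1
                  exact Finset.expect_congr rfl fun h _ => by ring
      _ = _ := by ring

end prod
end IW

open scoped BigOperators
set_option linter.unusedSectionVars false
set_option linter.unusedVariables false
namespace IW

lemma star_aux (r : ℕ) (hr : 1 ≤ r) : ∃ C : ℝ, 1 ≤ C ∧ ∀ s t w : ℝ, 0 ≤ s → 0 ≤ t →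
    w ^ 2 ≤ 4 * (s * t) → (s + w + t) ^ r ≤ r * (s ^ (r-1) * w) + (s + C * t) ^ r := by
  induction r, hr using Nat.le_induction with
  | base => exact ⟨1, le_rfl, fun s t w _ _ _ => by simp; linarith⟩
  | succ r hr ih =>
    obtain ⟨C, hC, ih⟩ := ih
    refine ⟨1 + 5 * r + r * C, by nlinarith [Nat.cast_nonneg (α := ℝ) r], ?_⟩
    intro s t w hs ht hw
    obtain ⟨k, rfl⟩ : ∃ k, r = k+1 := ⟨r-1, by omega⟩
    have ih := ih s t w hs ht hw
    simp only [Nat.add_sub_cancel] at ih ⊢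
    have hwa : |w| ≤ s + t := by
      apply abs_le_of_sq_le_sq _ (by linarith)
      nlinarith [sq_nonneg (s - t)]
    obtain ⟨hw1, hw2⟩ := abs_le.1 hwa
    have h0 : 0 ≤ s + w + t := by linarith
    set R : ℝ := ((k+1 : ℕ) : ℝ) with hR
    have hR0 : 0 ≤ R := Nat.cast_nonneg _
    set M := s + C * t with hM
    have hM0 : 0 ≤ M := by positivity
    have hsM : s ≤ M := by nlinarith
    have hstM : s + t ≤ M := by nlinarith
    have hsk : s ^ k ≤ M ^ k := by gcongr
    -- bound (M^(k+1) - s^(k+1)) ≤ R C t M^k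
    have hdiff : M ^ (k+1) - s ^ (k+1) ≤ R * (C * t) * M ^ k := by
      have : ∀ n : ℕ, M ^ (n+1) - s ^ (n+1) ≤ (n+1 : ℕ) * (C * t) * M ^ n := by
        intro n
        induction n with
        | zero => simp [hM]
        | succ n ihn =>
          have h1 : s ^ (n+1) ≤ M ^ (n+1) := by gcongr
          have e : M ^ (n+1+1) - s ^ (n+1+1) = M * (M ^ (n+1) - s ^ (n+1)) + (C * t) * s ^ (n+1) := by
            rw [hM]; ring
          rw [e]
          have h2 := mul_le_mul_of_nonneg_left ihn hM0
          have h3 := mul_le_mul_of_nonneg_left h1 (show 0 ≤ C * t by positivity)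
          push_cast at h2 ⊢
          calc _ ≤ _ := add_le_add h2 h3
            _ = _ := by ring
      exact this k
    have hMs : 0 ≤ M ^ (k+1) - s ^ (k+1) := by
      have : s ^ (k+1) ≤ M ^ (k+1) := by gcongr
      linarith
    have key : (s + w + t) ^ (k+1+1) ≤ (s + w + t) * (R * (s ^ k * w) + M ^ (k+1)) := by
      rw [pow_succ']; exact mul_le_mul_of_nonneg_left ih h0
    have a1 : w * (M ^ (k+1) - s ^ (k+1)) ≤ R * C * t * M ^ (k+1) := by
      calc w * (M ^ (k+1) - s ^ (k+1)) ≤ M * (R * (C * t) * M ^ k) :=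
            mul_le_mul (by linarith) hdiff hMs hM0
        _ = _ := by ring
    have a2 : R * s ^ k * w ^ 2 ≤ 4 * R * t * M ^ (k+1) := by
      calc R * s ^ k * w ^ 2 ≤ R * s ^ k * (4 * (s * t)) := by gcongr
        _ = 4 * R * t * s ^ (k+1) := by ring
        _ ≤ _ := by gcongr
    have a3 : R * s ^ k * w * t ≤ R * t * M ^ (k+1) := by
      calc R * s ^ k * w * t ≤ R * M ^ k * M * t := by
            have : s ^ k * w ≤ M ^ k * M :=
              (mul_le_mul_of_nonneg_left (by linarith : w ≤ M) (by positivity)).trans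
                (mul_le_mul_of_nonneg_right hsk hM0)
            have := mul_le_mul_of_nonneg_left this (mul_nonneg hR0 ht)
            linarith
        _ = _ := by ring
    have hfin : M ^ (k+1) * (s + (1 + 5 * R + R * C) * t) ≤ (s + (1 + 5 * R + R * C) * t) ^ (k+1+1) := by
      rw [pow_succ]
      have hR1 : 1 ≤ R := by rw [hR]; exact_mod_cast Nat.le_add_left 1 k
      have : M ≤ s + (1 + 5 * R + R * C) * t := by
        rw [hM]
        have : C ≤ 1 + 5 * R + R * C := by nlinarith
        nlinarith
      have h2 := pow_le_pow_left₀ hM0 this (k+1)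
      exact mul_le_mul_of_nonneg_right h2 (hM0.trans this)
    have hc : ((k + 1 + 1 : ℕ) : ℝ) = R + 1 := by rw [hR]; push_cast; ring
    rw [hc]
    refine key.trans (le_trans ?_ (add_le_add le_rfl hfin))
    have e : (s + w + t) * (R * (s ^ k * w) + M ^ (k+1)) =
      (R+1) * (s ^ (k+1) * w) + (R * s ^ k * w ^ 2 + R * s ^ k * w * t +
        w * (M ^ (k+1) - s ^ (k+1)) + (s + t) * M ^ (k+1)) := by ring
    rw [e]
    have : R * s ^ k * w ^ 2 + R * s ^ k * w * t + w * (M ^ (k+1) - s ^ (k+1)) + (s + t) * M ^ (k+1)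
      ≤ M ^ (k+1) * (s + (1 + 5 * R + R * C) * t) := by
      linarith
    linarith

section prod
variable {ι : Type*} [Fintype ι] [DecidableEq ι] {Z : ι → Type*} [∀ i, Fintype (Z i)]
  [∀ i, Nonempty (Z i)]

lemma re_expect {α : Type*} [Fintype α] (f : α → ℂ) : (𝔼 x, f x).re = 𝔼 x, (f x).re := by
  simp [Fintype.expect_eq_sum_div_card, Complex.div_natCast_re]

lemma ofReal_expect {α : Type*} [Fintype α] (f : α → ℝ) :
    ((𝔼 x, f x : ℝ) : ℂ) = 𝔼 x, (f x : ℂ) := by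
  simp [Fintype.expect_eq_sum_div_card]

lemma expect_inner_zero {i : ι} {a : (∀ i, Z i) → ℝ} {u v : (∀ i, Z i) → ℂ}
    (ha : Dep a {i}ᶜ) (hu : Dep u {i}ᶜ) (hv : ∀ h, cE {i}ᶜ v h = 0) :
    𝔼 h, a h * inner ℝ (u h) (v h) = 0 := by
  have h1 : ∀ h, a h * inner ℝ (u h) (v h) = (((a h : ℂ) * (starRingEnd ℂ) (u h)) * v h).re := by
    intro h
    rw [mul_assoc, Complex.re_ofReal_mul, Complex.inner, mul_comm (v h)]
  simp_rw [h1]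
  rw [← re_expect, ← expect_mul_cE (J := {i}ᶜ)]
  · simp [hv]
  · exact Dep.comp2 (fun (a : ℝ) b => (a : ℂ) * (starRingEnd ℂ) b) ha hu

end prod

lemma sqfun (r : ℕ) (hr : 1 ≤ r) : ∃ C : ℝ, 1 ≤ C ∧
    ∀ (ι : Type) [Fintype ι] [DecidableEq ι] (Z : ι → Type) [∀ i, Fintype (Z i)]
      [∀ i, Nonempty (Z i)] (F : Finset ι → (∀ i, Z i) → ℂ),
      (∀ S, Dep (F S) S) → (∀ S, ∀ i ∈ S, ∀ h, cE {i}ᶜ (F S) h = 0) →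
      𝔼 h, ‖∑ S, F S h‖ ^ (2 * r) ≤ 𝔼 h, (∑ S, C ^ S.card * ‖F S h‖ ^ 2) ^ r := by
  obtain ⟨C, hC, star⟩ := star_aux r hr
  refine ⟨C, hC, ?_⟩
  intro ι _ _ Z _ _ F hF hF0
  have hCpos : 0 < C := by linarith
  set U : Finset ι → Finset ι → (∀ i, Z i) → ℂ := fun A B h =>
    ∑ S ∈ Finset.univ.filter (fun S => S ∩ A = B), F S h with hU
  have main : ∀ A : Finset ι, 𝔼 h, ‖∑ S, F S h‖ ^ (2 * r) ≤
      𝔼 h, (∑ B ∈ A.powerset, C ^ B.card * ‖U A B h‖ ^ 2) ^ r := by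
    intro A
    induction A using Finset.induction_on with
    | empty =>
      simp [hU, pow_mul]
    | insert i A hi ih =>
      refine ih.trans ?_
      have hsplit : ∀ B ∈ A.powerset, ∀ h, U A B h = U (insert i A) B h + U (insert i A) (insert i B) h := by
        intro B hB h
        have hBA : B ⊆ A := by simpa using hB
        have hiB : i ∉ B := fun h => hi (hBA h)
        simp only [hU]
        rw [← Finset.sum_union]
        · refine Finset.sum_congr ?_ fun _ _ => rfl
          ext S
          simp only [Finset.mem_filter, Finset.mem_univ, true_and, Finset.mem_union]
          by_cases hiS : i ∈ S
          · rw [Finset.inter_insert_of_mem hiS]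
            constructor
            · intro h; right; rw [h]
            · rintro (h | h)
              · exact absurd (h ▸ Finset.mem_insert_self _ _) hiB
              · have := congrArg (fun T => T.erase i) h
                simpa [Finset.erase_insert, hiB, hi] using this
          · rw [Finset.inter_insert_of_notMem hiS]
            constructor
            · intro h; left; exact h
            · rintro (h | h)
              · exact h
              · exfalso
                have : i ∈ S ∩ A := h ▸ Finset.mem_insert_self _ _
                exact hiS (Finset.mem_inter.1 this).1
        · rw [Finset.disjoint_left]
          intro S h1 h2
          simp only [Finset.mem_filter, Finset.mem_univ, true_and] at h1 h2
          have : B = insert i B := h1.symm.trans h2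
          exact hiB (this ▸ Finset.mem_insert_self _ _)
      set u := fun B => U (insert i A) B with hu
      set v := fun B => U (insert i A) (insert i B) with hv
      have hud : ∀ B ∈ A.powerset, Dep (u B) {i}ᶜ := by
        intro B hB
        have hBA : B ⊆ A := by simpa using hB
        have hiB : i ∉ B := fun h => hi (hBA h)
        refine Dep.sum _ fun S hS => (hF S).mono ?_
        simp only [Finset.mem_filter, Finset.mem_univ, true_and] at hS
        intro j hj
        simp only [Finset.mem_compl, Finset.mem_singleton]
        rintro rfl
        exact hiB (hS ▸ by simp [hj])
      have hv0 : ∀ B ∈ A.powerset, ∀ h, cE {i}ᶜ (v B) h = 0 := by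
        intro B hB h
        simp only [hv, hU]
        rw [cE_sum]
        refine Finset.sum_eq_zero fun S hS => hF0 S i ?_ h
        simp only [Finset.mem_filter, Finset.mem_univ, true_and] at hS
        have : i ∈ S ∩ insert i A := hS ▸ Finset.mem_insert_self _ _
        exact (Finset.mem_inter.1 this).1
      set s : (∀ i, Z i) → ℝ := fun h => ∑ B ∈ A.powerset, C ^ B.card * ‖u B h‖ ^ 2 with hs
      set t : (∀ i, Z i) → ℝ := fun h => ∑ B ∈ A.powerset, C ^ B.card * ‖v B h‖ ^ 2 with ht
      set w : (∀ i, Z i) → ℝ := fun h => ∑ B ∈ A.powerset, C ^ B.card * (2 * inner ℝ (u B h) (v B h)) with hw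
      have hQA : ∀ h, ∑ B ∈ A.powerset, C ^ B.card * ‖U A B h‖ ^ 2 = s h + w h + t h := by
        intro h
        simp only [hs, hw, ht]
        rw [← Finset.sum_add_distrib, ← Finset.sum_add_distrib]
        refine Finset.sum_congr rfl fun B hB => ?_
        rw [hsplit B hB h, norm_add_sq_real]
        ring
      have hQA' : ∀ h, ∑ B ∈ (insert i A).powerset, C ^ B.card * ‖U (insert i A) B h‖ ^ 2 =
          s h + C * t h := by
        intro h
        rw [Finset.sum_powerset_insert hi]
        simp only [hs, ht, Finset.mul_sum]
        congr 1
        refine Finset.sum_congr rfl fun B hB => ?_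
        have hBA : B ⊆ A := by simpa using hB
        have hiB : i ∉ B := fun h => hi (hBA h)
        rw [Finset.card_insert_of_notMem hiB]
        simp only [hv]
        ring
      have hs0 : ∀ h, 0 ≤ s h := fun h => Finset.sum_nonneg fun B _ => by positivity
      have ht0 : ∀ h, 0 ≤ t h := fun h => Finset.sum_nonneg fun B _ => by positivity
      have hw2 : ∀ h, w h ^ 2 ≤ 4 * (s h * t h) := by
        intro h
        have h1 := Finset.sum_sq_le_sum_mul_sum_of_sq_le_mul A.powerset
          (r := fun B => C ^ B.card * (‖u B h‖ * ‖v B h‖))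
          (f := fun B => C ^ B.card * ‖u B h‖ ^ 2) (g := fun B => C ^ B.card * ‖v B h‖ ^ 2)
          (fun B _ => by positivity) (fun B _ => by positivity) (fun B _ => le_of_eq (by ring))
        have h2 : |w h| ≤ 2 * ∑ B ∈ A.powerset, C ^ B.card * (‖u B h‖ * ‖v B h‖) := by
          rw [Finset.mul_sum]
          refine (Finset.abs_sum_le_sum_abs _ _).trans (Finset.sum_le_sum fun B _ => ?_)
          rw [abs_mul, abs_mul, abs_of_pos (by positivity : 0 < C ^ B.card), abs_two]
          have := abs_real_inner_le_norm (u B h) (v B h)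
          have := mul_le_mul_of_nonneg_left this (by positivity : 0 ≤ C ^ B.card)
          linarith
        calc w h ^ 2 = |w h| ^ 2 := (sq_abs _).symm
          _ ≤ (2 * ∑ B ∈ A.powerset, C ^ B.card * (‖u B h‖ * ‖v B h‖)) ^ 2 := by gcongr
          _ = 4 * (∑ B ∈ A.powerset, C ^ B.card * (‖u B h‖ * ‖v B h‖)) ^ 2 := by ring
          _ ≤ _ := by linarith
      have hsd : Dep (fun h => s h ^ (r-1)) {i}ᶜ := by
        refine Dep.comp (fun a => a ^ (r-1)) (Dep.sum _ fun B hB => ?_)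
        exact Dep.comp (fun a => C ^ B.card * ‖a‖ ^ 2) (hud B hB)
      have hsw : 𝔼 h, s h ^ (r-1) * w h = 0 := by
        simp only [hw, Finset.mul_sum]
        rw [Finset.expect_sum_comm]
        refine Finset.sum_eq_zero fun B hB => ?_
        have := expect_inner_zero hsd (hud B hB) (hv0 B hB)
        calc _ = 𝔼 h, (C ^ B.card * 2) * (s h ^ (r-1) * inner ℝ (u B h) (v B h)) :=
              Finset.expect_congr rfl fun h _ => by ring
          _ = 0 := by rw [← Finset.mul_expect, this, mul_zero]
      simp_rw [hQA, hQA']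
      calc 𝔼 h, (s h + w h + t h) ^ r
          ≤ 𝔼 h, (r * (s h ^ (r-1) * w h) + (s h + C * t h) ^ r) :=
            expect_mono' fun h => star _ _ _ (hs0 h) (ht0 h) (hw2 h)
        _ = _ := by rw [Finset.expect_add_distrib, ← Finset.mul_expect, hsw]; simp
  refine (main Finset.univ).trans (le_of_eq ?_)
  refine Finset.expect_congr rfl fun h _ => ?_
  congr 1
  rw [Finset.powerset_univ]
  refine Finset.sum_congr rfl fun B _ => ?_
  congr 3
  simp only [hU, Finset.inter_univ]
  rw [Finset.filter_eq']; simp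
end IW

open scoped BigOperators
set_option linter.unusedSectionVars false
set_option linter.unusedVariables false
namespace IW
section prod
variable {ι : Type} [Fintype ι] [DecidableEq ι] {Z : ι → Type} [∀ i, Fintype (Z i)]
  [∀ i, Nonempty (Z i)]

lemma expect_prod {K : Type*} [Field K] [CharZero K] (g : ∀ i, Z i → K) :
    𝔼 h : (∀ i, Z i), ∏ i, g i (h i) = ∏ i, 𝔼 z, g i z := by
  classical
  simp_rw [Fintype.expect_eq_sum_div_card]
  rw [Finset.prod_div_distrib, Finset.prod_univ_sum, Fintype.card_pi]
  simp

/-- normalized delta -/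
noncomputable def dl {i : ι} (z w : Z i) : ℝ :=
  open Classical in if z = w then (Fintype.card (Z i) : ℝ) else 0

lemma dl_nonneg {i : ι} (z w : Z i) : 0 ≤ dl z w := by
  unfold dl; split_ifs <;> positivity

lemma dl_comm {i : ι} (z w : Z i) : dl z w = dl w z := by
  unfold dl; by_cases h : z = w
  · subst h; rfl
  · rw [if_neg h, if_neg (Ne.symm h)]

lemma expect_dl_mul {i : ι} (g : Z i → ℝ) (a : Z i) : 𝔼 z, dl a z * g z = g a := by
  classical
  have hc : (Fintype.card (Z i) : ℝ) ≠ 0 := by exact_mod_cast Fintype.card_ne_zero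
  simp only [dl, Fintype.expect_eq_sum_div_card]
  simp [hc]

lemma expect_dl {i : ι} (a : Z i) : 𝔼 z, dl a z = 1 := by
  simpa using expect_dl_mul (fun _ => (1:ℝ)) a

lemma expect_phi {i : ι} (a : Z i) : 𝔼 z, (dl a z - 1) = 0 := by
  rw [Finset.expect_sub_distrib, expect_dl]; simp

lemma expect_phi_phi {i : ι} (a b : Z i) : 𝔼 z, (dl a z - 1) * (dl z b - 1) = dl a b - 1 := by
  have : ∀ z, (dl a z - 1) * (dl z b - 1) = dl a z * (dl z b - 1) - (dl b z - 1) := by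
    intro z; rw [dl_comm b z]; ring
  simp_rw [this]
  rw [Finset.expect_sub_distrib, expect_dl_mul (fun z => dl z b - 1), expect_phi, sub_zero]

noncomputable def Dl (S : Finset ι) (h h' : ∀ i, Z i) : ℝ := ∏ i ∈ S, dl (h i) (h' i)
noncomputable def Phi (S : Finset ι) (h h' : ∀ i, Z i) : ℝ := ∏ i ∈ S, (dl (h i) (h' i) - 1)

lemma Dl_nonneg (S : Finset ι) (h h' : ∀ i, Z i) : 0 ≤ Dl S h h' :=
  Finset.prod_nonneg fun i _ => dl_nonneg _ _

lemma Phi_comm (S : Finset ι) (h h' : ∀ i, Z i) : Phi S h h' = Phi S h' h := by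
  unfold Phi; exact Finset.prod_congr rfl fun i _ => by rw [dl_comm]

lemma Dl_comm (S : Finset ι) (h h' : ∀ i, Z i) : Dl S h h' = Dl S h' h := by
  unfold Dl; exact Finset.prod_congr rfl fun i _ => by rw [dl_comm]

lemma Phi_dep (S : Finset ι) (a : ∀ i, Z i) : Dep (Phi S a) S := by
  intro x y hxy
  exact Finset.prod_congr rfl fun i hi => by rw [hxy i hi]

lemma Dl_dep (S : Finset ι) (a : ∀ i, Z i) : Dep (Dl S a) S := by
  intro x y hxy
  exact Finset.prod_congr rfl fun i hi => by rw [hxy i hi]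

lemma prod_ite_univ {K : Type*} [CommMonoid K] (S : Finset ι) (f : ι → K) :
    ∏ i ∈ S, f i = ∏ i, if i ∈ S then f i else 1 := by
  rw [Finset.prod_ite_mem]; simp

lemma expect_Dl (S : Finset ι) (a : ∀ i, Z i) : 𝔼 h, Dl S a h = 1 := by
  unfold Dl
  simp_rw [prod_ite_univ S]
  rw [expect_prod (fun i z => if i ∈ S then dl (a i) z else 1)]
  refine Finset.prod_eq_one fun i _ => ?_
  by_cases hi : i ∈ S <;> simp [hi, expect_dl]

lemma expect_Phi_Phi (S T : Finset ι) (a b : ∀ i, Z i) :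
    𝔼 h, Phi S a h * Phi T h b = if S = T then Phi S a b else 0 := by
  unfold Phi
  simp_rw [prod_ite_univ S, prod_ite_univ T, ← Finset.prod_mul_distrib]
  rw [expect_prod (fun i z => (if i ∈ S then dl (a i) z - 1 else 1) *
    (if i ∈ T then dl z (b i) - 1 else 1))]
  split_ifs with hST
  · subst hST
    refine Finset.prod_congr rfl fun i _ => ?_
    by_cases hi : i ∈ S
    · simp only [hi, if_true]; exact expect_phi_phi _ _
    · simp [hi]
  · obtain ⟨i, hi⟩ : ∃ i, ¬ (i ∈ S ↔ i ∈ T) := by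
      by_contra hcon; push Not at hcon; exact hST (Finset.ext hcon)
    refine Finset.prod_eq_zero (Finset.mem_univ i) ?_
    by_cases hS : i ∈ S
    · have hT : i ∉ T := fun h => hi ⟨fun _ => h, fun _ => hS⟩
      simp only [hS, hT, if_true, if_false, mul_one]; exact expect_phi _
    · have hT : i ∈ T := by by_contra h; exact hi ⟨fun h' => absurd h' hS, fun h' => absurd h' h⟩
      simp only [hS, hT, if_true, if_false, one_mul]
      simp_rw [dl_comm _ (b i)]; exact expect_phi _

lemma cE_Phi {S : Finset ι} {i : ι} (hi : i ∈ S) (a h : ∀ i, Z i) : cE {i}ᶜ (Phi S a) h = 0 := by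
  have h1 : ∀ h', Phi S a (({i}ᶜ : Finset ι).piecewise h h') =
      Phi (S.erase i) a h * ∏ j, (if j = i then dl (a j) (h' j) - 1 else 1) := by
    intro h'
    unfold Phi
    rw [← Finset.mul_prod_erase S _ hi, mul_comm]
    congr 1
    · refine Finset.prod_congr rfl fun j hj => ?_
      have : j ≠ i := Finset.ne_of_mem_erase hj
      simp [this]
    · simp
  unfold cE
  simp_rw [h1]
  rw [← Finset.mul_expect, expect_prod (fun j z => if j = i then dl (a j) z - 1 else 1),
    Finset.prod_eq_zero (Finset.mem_univ i), mul_zero]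
  simp only [if_true]
  exact expect_phi _

/-- span of functions of few coordinates -/
def LowDeg (Z : ι → Type) (n : ℕ) : Submodule ℝ ((∀ i, Z i) → ℝ) :=
  Submodule.span ℝ {ψ | ∃ S : Finset ι, S.card ≤ n ∧ Dep ψ S}

lemma LowDeg.of_dep {n : ℕ} {ψ : (∀ i, Z i) → ℝ} {S : Finset ι} (hS : S.card ≤ n) (h : Dep ψ S) :
    ψ ∈ LowDeg Z n := Submodule.subset_span ⟨S, hS, h⟩

lemma LowDeg.mono {n m : ℕ} (h : n ≤ m) : LowDeg Z n ≤ LowDeg Z m :=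
  Submodule.span_mono fun ψ ⟨S, hS, hd⟩ => ⟨S, hS.trans h, hd⟩

lemma LowDeg.mul {n m : ℕ} {ψ χ : (∀ i, Z i) → ℝ} (h1 : ψ ∈ LowDeg Z n) (h2 : χ ∈ LowDeg Z m) :
    ψ * χ ∈ LowDeg Z (n + m) := by
  have h : ψ * χ ∈ LowDeg Z n * LowDeg Z m := Submodule.mul_mem_mul h1 h2
  unfold LowDeg at h
  rw [Submodule.span_mul_span] at h
  refine Submodule.span_mono ?_ h
  rintro _ ⟨a, ⟨S, hS, ha⟩, b, ⟨T, hT, hb⟩, rfl⟩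
  refine ⟨S ∪ T, (Finset.card_union_le _ _).trans (by omega), ?_⟩
  exact Dep.comp2 (fun a b => a * b) (ha.mono Finset.subset_union_left)
    (hb.mono Finset.subset_union_right)

lemma LowDeg.pow {n : ℕ} {ψ : (∀ i, Z i) → ℝ} (h1 : ψ ∈ LowDeg Z n) (r : ℕ) :
    ψ ^ r ∈ LowDeg Z (n * r) := by
  induction r with
  | zero => exact LowDeg.of_dep (S := ∅) (by simp) (fun x y _ => by simp)
  | succ r ih => rw [pow_succ, Nat.mul_succ]; exact LowDeg.mul ih h1

lemma LowDeg.normSq_sum {n : ℕ} (𝒯 : Finset (Finset ι)) (h𝒯 : ∀ T ∈ 𝒯, T.card ≤ n)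
    (c : Finset ι → (∀ i, Z i) → ℂ) (hc : ∀ T ∈ 𝒯, Dep (c T) T) :
    (fun h => ‖∑ T ∈ 𝒯, c T h‖ ^ 2) ∈ LowDeg Z (n + n) := by
  have e : (fun h => ‖∑ T ∈ 𝒯, c T h‖ ^ 2) =
      (∑ T ∈ 𝒯, fun h => (c T h).re) * (∑ T ∈ 𝒯, fun h => (c T h).re) +
      (∑ T ∈ 𝒯, fun h => (c T h).im) * (∑ T ∈ 𝒯, fun h => (c T h).im) := by
    ext h
    simp only [Pi.add_apply, Pi.mul_apply, Finset.sum_apply]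
    rw [← Complex.normSq_eq_norm_sq, Complex.normSq_apply, Complex.re_sum, Complex.im_sum]
  rw [e]
  have h1 : (∑ T ∈ 𝒯, fun h => (c T h).re) ∈ LowDeg Z n :=
    Submodule.sum_mem _ fun T hT => LowDeg.of_dep (h𝒯 T hT) ((hc T hT).comp Complex.re)
  have h2 : (∑ T ∈ 𝒯, fun h => (c T h).im) ∈ LowDeg Z n :=
    Submodule.sum_mem _ fun T hT => LowDeg.of_dep (h𝒯 T hT) ((hc T hT).comp Complex.im)
  exact Submodule.add_mem _ (LowDeg.mul h1 h1) (LowDeg.mul h2 h2)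

/-- domination hypothesis -/
def Dom {Ω : Type} [Fintype Ω] (n : ℕ) (μ : Ω → ℝ) (X : Ω → ∀ i, Z i) : Prop :=
  (∀ x, 0 ≤ μ x) ∧ ∀ ψ ∈ LowDeg Z n, (∀ h, 0 ≤ ψ h) → ∑ x, μ x * ψ (X x) ≤ 𝔼 h, ψ h

lemma Dom.mono {Ω : Type} [Fintype Ω] {n m : ℕ} (hnm : n ≤ m) {μ : Ω → ℝ} {X : Ω → ∀ i, Z i}
    (h : Dom m μ X) : Dom n μ X :=
  ⟨h.1, fun ψ hψ h0 => h.2 ψ (LowDeg.mono hnm hψ) h0⟩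

/-- the coefficients `c_T` -/
noncomputable def cT {Ω : Type} [Fintype Ω] (ν : Ω → ℝ) (X : Ω → ∀ i, Z i) (f : Ω → ℂ)
    (T : Finset ι) (h : ∀ i, Z i) : ℂ := ∑ x, (ν x : ℂ) * f x * (Phi T (X x) h : ℂ)

lemma cT_dep {Ω : Type} [Fintype Ω] (ν : Ω → ℝ) (X : Ω → ∀ i, Z i) (f : Ω → ℂ)
    (T : Finset ι) : Dep (cT ν X f T) T :=
  Dep.sum _ fun x _ => (Phi_dep T (X x)).comp (fun a : ℝ => (ν x : ℂ) * f x * (a : ℂ))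

lemma cE_cT {Ω : Type} [Fintype Ω] (ν : Ω → ℝ) (X : Ω → ∀ i, Z i) (f : Ω → ℂ)
    (T : Finset ι) (i : ι) (hi : i ∈ T) (h) : cE {i}ᶜ (cT ν X f T) h = 0 := by
  unfold cT
  rw [cE_sum]
  refine Finset.sum_eq_zero fun x _ => ?_
  have := cE_Phi hi (X x) h
  unfold cE at this ⊢
  rw [← Finset.mul_expect, ← ofReal_expect, this]; simp

lemma ip_cT {Ω : Type} [Fintype Ω] (ν : Ω → ℝ) (X : Ω → ∀ i, Z i) (f : Ω → ℂ)
    (S T : Finset ι) : 𝔼 h, cT ν X f S h * (starRingEnd ℂ) (cT ν X f T h) =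
      if S = T then ∑ x, (ν x : ℂ) * f x * (starRingEnd ℂ) (cT ν X f T (X x)) else 0 := by
  have e : ∀ x y, 𝔼 h, (Phi S (X x) h : ℂ) * (Phi T (X y) h : ℂ) =
      if S = T then (Phi T (X y) (X x) : ℂ) else 0 := by
    intro x y
    have := expect_Phi_Phi S T (X x) (X y)
    simp_rw [Phi_comm T _ (X y)] at this
    simp_rw [← Complex.ofReal_mul]
    rw [← ofReal_expect, this]
    split_ifs with h
    · rw [h, Phi_comm]
    · simp
  have e2 : ∀ h, cT ν X f S h * (starRingEnd ℂ) (cT ν X f T h) = ∑ x, ∑ y,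
      ((ν x : ℂ) * f x * ((ν y : ℂ) * (starRingEnd ℂ) (f y))) *
        ((Phi S (X x) h : ℂ) * (Phi T (X y) h : ℂ)) := by
    intro h
    unfold cT
    rw [map_sum, Finset.sum_mul_sum]
    refine Finset.sum_congr rfl fun x _ => Finset.sum_congr rfl fun y _ => ?_
    simp only [map_mul, Complex.conj_ofReal]; ring
  simp_rw [e2]
  rw [Finset.expect_sum_comm]
  simp_rw [Finset.expect_sum_comm, ← Finset.mul_expect, e]
  split_ifs with h
  · refine Finset.sum_congr rfl fun x _ => ?_
    unfold cT
    rw [map_sum, Finset.mul_sum]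
    refine Finset.sum_congr rfl fun y _ => ?_
    simp only [map_mul, Complex.conj_ofReal]; ring
  · simp

lemma bessel {Ω : Type} [Fintype Ω] (ν : Ω → ℝ) (hν : ∀ x, 0 ≤ ν x) (X : Ω → ∀ i, Z i) (f : Ω → ℂ)
    (𝒯 : Finset (Finset ι))
    (hyp : ∑ x, ν x * ‖∑ T ∈ 𝒯, cT ν X f T (X x)‖ ^ 2 ≤ 𝔼 h, ‖∑ T ∈ 𝒯, cT ν X f T h‖ ^ 2) :
    ∑ T ∈ 𝒯, 𝔼 h, ‖cT ν X f T h‖ ^ 2 ≤ ∑ x, ν x * ‖f x‖ ^ 2 := by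
  set B := ∑ T ∈ 𝒯, 𝔼 h, ‖cT ν X f T h‖ ^ 2 with hB
  have hBc : (B : ℂ) = ∑ T ∈ 𝒯, 𝔼 h, cT ν X f T h * (starRingEnd ℂ) (cT ν X f T h) := by
    rw [hB, Complex.ofReal_sum]
    refine Finset.sum_congr rfl fun T _ => ?_
    rw [ofReal_expect]
    refine Finset.expect_congr rfl fun h _ => ?_
    rw [Complex.mul_conj, Complex.normSq_eq_norm_sq]
  have h1 : 𝔼 h, ‖∑ T ∈ 𝒯, cT ν X f T h‖ ^ 2 = B := by
    apply Complex.ofReal_injective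
    rw [hBc, ofReal_expect]
    have : ∀ h, ((‖∑ T ∈ 𝒯, cT ν X f T h‖ ^ 2 : ℝ) : ℂ) =
        ∑ S ∈ 𝒯, ∑ T ∈ 𝒯, cT ν X f S h * (starRingEnd ℂ) (cT ν X f T h) := by
      intro h
      rw [← Complex.normSq_eq_norm_sq, ← Complex.mul_conj, map_sum, Finset.sum_mul_sum]
    simp_rw [this]
    rw [Finset.expect_sum_comm]
    refine Finset.sum_congr rfl fun S hS => ?_
    rw [Finset.expect_sum_comm]
    simp_rw [ip_cT]
    rw [Finset.sum_ite_eq]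
    simp [hS]
  have h2 : (B : ℂ) = ∑ x, (ν x : ℂ) * (f x * (starRingEnd ℂ) (∑ T ∈ 𝒯, cT ν X f T (X x))) := by
    rw [hBc]
    simp_rw [ip_cT, if_true]
    rw [Finset.sum_comm]
    refine Finset.sum_congr rfl fun x _ => ?_
    rw [map_sum, Finset.mul_sum, Finset.mul_sum]
    exact Finset.sum_congr rfl fun T _ => by ring
  have h3 : B = ∑ x, ν x * (f x * (starRingEnd ℂ) (∑ T ∈ 𝒯, cT ν X f T (X x))).re := by
    have := congrArg Complex.re h2
    rw [Complex.ofReal_re, Complex.re_sum] at this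
    simpa [Complex.re_ofReal_mul] using this
  have h4 : B ≤ ∑ x, ν x * ((‖f x‖ ^ 2 + ‖∑ T ∈ 𝒯, cT ν X f T (X x)‖ ^ 2) / 2) := by
    rw [h3]
    refine Finset.sum_le_sum fun x _ => mul_le_mul_of_nonneg_left ?_ (hν x)
    refine (Complex.re_le_norm _).trans ?_
    rw [norm_mul, RCLike.norm_conj]
    nlinarith [sq_nonneg (‖f x‖ - ‖∑ T ∈ 𝒯, cT ν X f T (X x)‖)]
  have h5 : ∑ x, ν x * ((‖f x‖ ^ 2 + ‖∑ T ∈ 𝒯, cT ν X f T (X x)‖ ^ 2) / 2) =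
      (∑ x, ν x * ‖f x‖ ^ 2) / 2 + (∑ x, ν x * ‖∑ T ∈ 𝒯, cT ν X f T (X x)‖ ^ 2) / 2 := by
    rw [Finset.sum_div, Finset.sum_div, ← Finset.sum_add_distrib]
    exact Finset.sum_congr rfl fun x _ => by ring
  linarith

/-- `F_S`. -/
noncomputable def FS {Ω : Type} [Fintype Ω] (D : ℕ) (μ : Ω → ℝ) (X : Ω → ∀ i, Z i) (f : Ω → ℂ)
    (S : Finset ι) (h : ∀ i, Z i) : ℂ := if S.card ≤ D then cT μ X f S h else 0

/-- `|F_S|²` -/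
noncomputable def gS {Ω : Type} [Fintype Ω] (D : ℕ) (μ : Ω → ℝ) (X : Ω → ∀ i, Z i) (f : Ω → ℂ)
    (S : Finset ι) (h : ∀ i, Z i) : ℝ := ‖FS D μ X f S h‖ ^ 2

lemma FS_dep {Ω : Type} [Fintype Ω] (D : ℕ) (μ : Ω → ℝ) (X : Ω → ∀ i, Z i) (f : Ω → ℂ)
    (S : Finset ι) : Dep (FS D μ X f S) S := by
  unfold FS
  split_ifs
  · exact cT_dep _ _ _ _
  · exact fun _ _ _ => rfl

lemma bessel_dom {Ω : Type} [Fintype Ω] (D : ℕ) (μ : Ω → ℝ) (X : Ω → ∀ i, Z i)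
    (hD : Dom (2 * D) μ X) (f : Ω → ℂ) :
    ∑ S, 𝔼 h, gS D μ X f S h ≤ ∑ x, μ x * ‖f x‖ ^ 2 := by
  have := bessel μ hD.1 X f (Finset.univ.filter (fun S => S.card ≤ D)) ?_
  · refine le_trans (le_of_eq ?_) this
    rw [Finset.sum_filter]
    refine Finset.sum_congr rfl fun S _ => ?_
    unfold gS FS
    split_ifs <;> simp
  · refine hD.2 (fun h => ‖∑ T ∈ Finset.univ.filter (fun S => S.card ≤ D), cT μ X f T h‖ ^ 2) ?_
      (fun h => by positivity)
    rw [two_mul]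
    exact LowDeg.normSq_sum _ (by simp) _ fun T _ => cT_dep _ _ _ _

lemma Gam_le {Ω : Type} [Fintype Ω] (D : ℕ) (μ : Ω → ℝ) (X : Ω → ∀ i, Z i)
    (hD : Dom (3 * D) μ X) (f : Ω → ℂ) {τ : ℝ} (hτ : 0 ≤ τ) (hf : ∀ x, ‖f x‖ ≤ τ) (J : Finset ι)
    (h : ∀ i, Z i) : Gam (gS D μ X f) J h ≤ 4 ^ D * τ ^ 2 := by
  by_cases hJ : J.card ≤ D
  swap
  · have : GG (gS D μ X f) J = 0 := by
      ext h
      refine Finset.sum_eq_zero fun S hS => ?_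
      have : ¬ S.card ≤ D := by
        have := Finset.card_le_card (show J ⊆ S by simpa using hS)
        omega
      simp [gS, FS, this]
    have h0 : Gam (gS D μ X f) J h = 0 := by simp [Gam, this, cE]
    rw [h0]; positivity
  set 𝒯 : Finset (Finset ι) := Finset.univ.filter (fun T => Disjoint T J ∧ T.card ≤ D) with h𝒯
  set ν : Finset ι → Ω → ℝ := fun t x => μ x * Dl (J \ t) h (X x) with hν
  have hν0 : ∀ t x, 0 ≤ ν t x := fun t x => mul_nonneg (hD.1 x) (Dl_nonneg _ _ _)
  have hνdom : ∀ t ∈ J.powerset, ∀ ψ : (∀ i, Z i) → ℝ, (∀ k, 0 ≤ ψ k) → ψ ∈ LowDeg Z (2 * D) →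
      Dep ψ Jᶜ → ∑ x, ν t x * ψ (X x) ≤ 𝔼 k, ψ k := by
    intro t ht ψ hψ0 hψ hψd
    have h1 := hD.2 (Dl (J \ t) h * ψ) ?_ (fun k => mul_nonneg (Dl_nonneg _ _ _) (hψ0 k))
    · have e : 𝔼 k, (Dl (J \ t) h * ψ) k = 𝔼 k, ψ k := by
        have := expect_mul_of_disjoint (S := J \ t) (T := Jᶜ) (u := Dl (J \ t) h) (v := ψ) ?_
          (Dl_dep _ _) hψd
        · rw [expect_Dl, one_mul] at this
          exact this
        · rw [Finset.disjoint_left]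
          intro i hi; simp only [Finset.mem_sdiff] at hi; simp [hi.1]
      rw [e] at h1
      refine le_trans (le_of_eq ?_) h1
      refine Finset.sum_congr rfl fun x _ => ?_
      simp only [hν, Pi.mul_apply]; ring
    · have : 3 * D = D + 2 * D := by ring
      rw [this]
      refine LowDeg.mul (LowDeg.of_dep (S := J \ t) ?_ (Dl_dep _ _)) hψ
      exact (Finset.card_le_card Finset.sdiff_subset).trans hJ
  have hbes : ∀ t ∈ J.powerset, ∑ T ∈ 𝒯, 𝔼 k, ‖cT (ν t) X f T k‖ ^ 2 ≤ τ ^ 2 := by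
    intro t ht
    refine (bessel (ν t) (hν0 t) X f 𝒯 ?_).trans ?_
    · refine hνdom t ht (fun k => ‖∑ T ∈ 𝒯, cT (ν t) X f T k‖ ^ 2) (fun k => by positivity) ?_ ?_
      · rw [two_mul]
        exact LowDeg.normSq_sum _ (fun T hT => by simp [h𝒯] at hT; exact hT.2) _
          fun T _ => cT_dep _ _ _ _
      · refine Dep.comp (fun z : ℂ => ‖z‖ ^ 2) (Dep.sum _ fun T hT => (cT_dep _ _ _ _).mono ?_)
        intro i hi
        simp only [h𝒯, Finset.mem_filter, Finset.mem_univ, true_and] at hT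
        simp only [Finset.mem_compl]
        exact Finset.disjoint_left.1 hT.1 hi
    · have h1 := hνdom t ht (fun _ => 1) (fun _ => zero_le_one)
        (LowDeg.of_dep (S := ∅) (by simp) (fun _ _ _ => rfl)) (fun _ _ _ => rfl)
      simp only [mul_one, Fintype.expect_const] at h1
      calc ∑ x, ν t x * ‖f x‖ ^ 2 ≤ ∑ x, ν t x * τ ^ 2 := by
            refine Finset.sum_le_sum fun x _ => mul_le_mul_of_nonneg_left ?_ (hν0 t x)
            exact pow_le_pow_left₀ (norm_nonneg _) (hf x) 2
        _ = (∑ x, ν t x) * τ ^ 2 := by rw [Finset.sum_mul]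
        _ ≤ 1 * τ ^ 2 := by gcongr
        _ = _ := one_mul _
  -- pointwise expansion
  have hexp : ∀ S, J ⊆ S → ∀ k, gS D μ X f S (J.piecewise h k) ≤
      if S.card ≤ D then 2 ^ D * ∑ t ∈ J.powerset, ‖cT (ν t) X f (S \ J) k‖ ^ 2 else 0 := by
    intro S hJS k
    unfold gS FS
    split_ifs with hS
    swap
    · simp
    have hPhi : ∀ a, Phi S a (J.piecewise h k) =
        ∑ t ∈ J.powerset, (-1) ^ t.card * Dl (J \ t) h a * Phi (S \ J) a k := by
      intro a
      have e1 : Phi S a (J.piecewise h k) = Phi J a h * Phi (S \ J) a k := by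
        unfold Phi
        rw [← Finset.prod_sdiff hJS, mul_comm]
        congr 1
        · exact Finset.prod_congr rfl fun i hi => by simp [hi]
        · exact Finset.prod_congr rfl fun i hi => by simp [(Finset.mem_sdiff.1 hi).2]
      rw [e1, ← Finset.sum_mul]
      congr 1
      unfold Phi
      rw [Finset.prod_sub]
      refine Finset.sum_congr rfl fun t _ => ?_
      rw [Dl_comm]
      simp [Dl]
    have hc : cT μ X f S (J.piecewise h k) =
        ∑ t ∈ J.powerset, (-1) ^ t.card * cT (ν t) X f (S \ J) k := by
      unfold cT
      simp_rw [Finset.mul_sum]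
      rw [Finset.sum_comm]
      refine Finset.sum_congr rfl fun x _ => ?_
      rw [hPhi, Complex.ofReal_sum, Finset.mul_sum]
      refine Finset.sum_congr rfl fun t _ => ?_
      simp only [hν]; push_cast; ring
    rw [hc]
    calc ‖∑ t ∈ J.powerset, (-1) ^ t.card * cT (ν t) X f (S \ J) k‖ ^ 2
        ≤ (∑ t ∈ J.powerset, ‖cT (ν t) X f (S \ J) k‖) ^ 2 := by
          gcongr
          refine (norm_sum_le _ _).trans (Finset.sum_le_sum fun t _ => ?_)
          simp
      _ ≤ J.powerset.card * ∑ t ∈ J.powerset, ‖cT (ν t) X f (S \ J) k‖ ^ 2 :=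
          sq_sum_le_card_mul_sum_sq
      _ ≤ _ := by
          rw [Finset.card_powerset]
          push_cast
          gcongr
          norm_num
  unfold Gam cE GG
  calc 𝔼 k, ∑ S ∈ Finset.univ.filter (fun S => J ⊆ S), gS D μ X f S (J.piecewise h k)
      ≤ 𝔼 k, 2 ^ D * ∑ t ∈ J.powerset, ∑ T ∈ 𝒯, ‖cT (ν t) X f T k‖ ^ 2 := by
        refine expect_mono' fun k => ?_
        calc _ ≤ ∑ S ∈ Finset.univ.filter (fun S => J ⊆ S), (if S.card ≤ D then
              2 ^ D * ∑ t ∈ J.powerset, ‖cT (ν t) X f (S \ J) k‖ ^ 2 else 0) :=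
              Finset.sum_le_sum fun S hS => hexp S (by simpa using hS) k
          _ = ∑ S ∈ Finset.univ.filter (fun S => J ⊆ S ∧ S.card ≤ D),
              2 ^ D * ∑ t ∈ J.powerset, ‖cT (ν t) X f (S \ J) k‖ ^ 2 := by
              rw [← Finset.sum_filter, Finset.filter_filter]
          _ = ∑ T ∈ (Finset.univ.filter (fun S => J ⊆ S ∧ S.card ≤ D)).image (fun S => S \ J),
              2 ^ D * ∑ t ∈ J.powerset, ‖cT (ν t) X f T k‖ ^ 2 := by
              rw [Finset.sum_image]
              intro S hS S' hS' hSS'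
              simp only [Finset.coe_filter, Set.mem_ofPred_eq, Finset.mem_univ, true_and] at hS hS'
              rw [← Finset.sdiff_union_of_subset hS.1, ← Finset.sdiff_union_of_subset hS'.1]
              simp only at hSS'
              rw [hSS']
          _ ≤ ∑ T ∈ 𝒯, 2 ^ D * ∑ t ∈ J.powerset, ‖cT (ν t) X f T k‖ ^ 2 := by
              refine Finset.sum_le_sum_of_subset_of_nonneg ?_ fun T _ _ => by positivity
              intro T hT
              simp only [Finset.mem_image, Finset.mem_filter, Finset.mem_univ, true_and] at hT
              obtain ⟨S, hS, rfl⟩ := hT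
              simp only [h𝒯, Finset.mem_filter, Finset.mem_univ, true_and]
              exact ⟨Finset.sdiff_disjoint, (Finset.card_le_card Finset.sdiff_subset).trans hS.2⟩
          _ = _ := by rw [← Finset.mul_sum, Finset.sum_comm]
    _ = 2 ^ D * ∑ t ∈ J.powerset, ∑ T ∈ 𝒯, 𝔼 k, ‖cT (ν t) X f T k‖ ^ 2 := by
        rw [← Finset.mul_expect, Finset.expect_sum_comm]
        simp_rw [Finset.expect_sum_comm]
    _ ≤ 2 ^ D * ∑ t ∈ J.powerset, τ ^ 2 := by
        refine mul_le_mul_of_nonneg_left (Finset.sum_le_sum hbes) (by positivity)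
    _ ≤ 4 ^ D * τ ^ 2 := by
        rw [Finset.sum_const, nsmul_eq_mul, Finset.card_powerset, ← mul_assoc]
        have h1 : ((2 ^ J.card : ℕ) : ℝ) ≤ 2 ^ D := by
          push_cast
          exact pow_le_pow_right₀ (by norm_num) hJ
        have : (4:ℝ) ^ D = 2 ^ D * 2 ^ D := by rw [← mul_pow]; norm_num
        rw [this]
        gcongr

lemma sum_Gam_le {Ω : Type} [Fintype Ω] (D : ℕ) (μ : Ω → ℝ) (X : Ω → ∀ i, Z i)
    (hD : Dom (2 * D) μ X) (f : Ω → ℂ) :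
    ∑ J, 𝔼 h, Gam (gS D μ X f) J h ≤ 2 ^ D * ∑ x, μ x * ‖f x‖ ^ 2 := by
  refine le_trans ?_ (mul_le_mul_of_nonneg_left (bessel_dom D μ X hD f) (by positivity))
  unfold Gam
  simp_rw [expect_cE]
  unfold GG
  simp_rw [Finset.expect_sum_comm]
  rw [Finset.sum_comm' (t' := Finset.univ) (s' := fun S => S.powerset) (by simp), Finset.mul_sum]
  refine Finset.sum_le_sum fun S _ => ?_
  rw [Finset.sum_const, nsmul_eq_mul, Finset.card_powerset]
  by_cases hS : S.card ≤ D
  · refine mul_le_mul_of_nonneg_right ?_ (expect_nonneg' fun h => by unfold gS; positivity)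
    push_cast
    exact pow_le_pow_right₀ (by norm_num) hS
  · simp [gS, FS, hS]

end prod
end IW

open scoped BigOperators
set_option linter.unusedSectionVars false
set_option linter.unusedVariables false
namespace IW
open MeasureTheory

lemma lowI {s a : ℝ} (hs : -1 < s) (ha : 0 ≤ a) :
    IntegrableOn ((Set.Iio a).indicator (fun τ : ℝ => τ ^ s)) (Set.Ioi 0) ∧
    ∫ τ in Set.Ioi (0:ℝ), (Set.Iio a).indicator (fun τ : ℝ => τ ^ s) τ = a ^ (s+1) / (s+1) := by
  have hset : Set.Ioi (0:ℝ) ∩ Set.Iio a = Set.Ioo 0 a := rfl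
  constructor
  · rw [integrableOn_indicator_iff measurableSet_Iio, Set.inter_comm, hset]
    have := (intervalIntegral.intervalIntegrable_rpow' hs (a := 0) (b := a)).1
    exact this.mono_set Set.Ioo_subset_Ioc_self
  · rw [setIntegral_indicator measurableSet_Iio, hset, ← integral_Ioc_eq_integral_Ioo,
      ← intervalIntegral.integral_of_le ha, integral_rpow (Or.inl hs)]
    rw [Real.zero_rpow (by linarith)]; simp

lemma highI {s a : ℝ} (hs : s < -1) (ha : 0 < a) :
    IntegrableOn ((Set.Ici a).indicator (fun τ : ℝ => τ ^ s)) (Set.Ioi 0) ∧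
    ∫ τ in Set.Ioi (0:ℝ), (Set.Ici a).indicator (fun τ : ℝ => τ ^ s) τ = -a ^ (s+1) / (s+1) := by
  have hset : Set.Ioi (0:ℝ) ∩ Set.Ici a = Set.Ici a := by
    ext x; simp; intro h; linarith
  constructor
  · rw [integrableOn_indicator_iff measurableSet_Ici, Set.inter_comm, hset, integrableOn_Ici_iff_integrableOn_Ioi]
    exact integrableOn_Ioi_rpow_of_lt hs ha
  · rw [setIntegral_indicator measurableSet_Ici, hset, integral_Ici_eq_integral_Ioi,
      integral_Ioi_rpow_of_lt hs ha]

/-- distribution function interpolation -/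
lemma interp {p q A B c : ℝ} (hp : 2 < p) (hpq : p < q) (hA : 0 ≤ A) (hB : 0 ≤ B) (hc : 0 < c) :
    ∃ C : ℝ, 0 ≤ C ∧ ∀ {Y Ω : Type} [Fintype Y] [Fintype Ω] (ν : Y → ℝ) (μ : Ω → ℝ)
      (g : Y → ℝ) (F : Ω → ℝ), (∀ y, 0 ≤ ν y) → (∀ x, 0 ≤ μ x) → (∀ y, 0 ≤ g y) → (∀ x, 0 ≤ F x) →
      (∀ τ : ℝ, 0 < τ → ∑ y, ν y * (if τ < g y then 1 else 0) ≤
        A * τ ^ (-2 : ℝ) * ∑ x, μ x * (if c * τ < F x then F x ^ (2:ℝ) else 0) +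
        B * τ ^ (-q) * ∑ x, μ x * (if F x ≤ c * τ then F x ^ q else 0)) →
      ∑ y, ν y * g y ^ p ≤ C * ∑ x, μ x * F x ^ p := by
  refine ⟨p * (A * c ^ (2 - p) / (p - 2) + B * c ^ (q - p) / (q - p)), ?_, ?_⟩
  · have : 0 < p - 2 := by linarith
    have : 0 < q - p := by linarith
    positivity
  intro Y Ω _ _ ν μ g F hν hμ hg hF hyp
  have hI1 : ∀ y, _ := fun y => lowI (s := p - 1) (by linarith) (hg y)
  have hI2 : ∀ x, _ := fun x => lowI (s := p - 3) (by linarith) (div_nonneg (hF x) hc.le)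
  have hI3 : ∀ x, IntegrableOn (fun τ => F x ^ q * (Set.Ici (F x / c)).indicator (fun τ : ℝ => τ ^ (p - 1 - q)) τ)
      (Set.Ioi 0) ∧ ∫ τ in Set.Ioi (0:ℝ), F x ^ q * (Set.Ici (F x / c)).indicator
        (fun τ : ℝ => τ ^ (p - 1 - q)) τ = c ^ (q - p) / (q - p) * F x ^ p := by
    intro x
    rcases (hF x).eq_or_lt with h0 | h0
    · rw [← h0, Real.zero_rpow (by linarith), Real.zero_rpow (by linarith)]
      simp
    · obtain ⟨h1, h2⟩ := highI (s := p - 1 - q) (by linarith) (div_pos h0 hc)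
      refine ⟨h1.const_mul _, ?_⟩
      rw [integral_const_mul, h2]
      have e1 : p - 1 - q + 1 = -(q - p) := by ring
      rw [e1, Real.div_rpow h0.le hc.le, Real.rpow_neg hc.le, div_inv_eq_mul]
      have e2 : F x ^ p = F x ^ q * F x ^ (-(q-p)) := by
        rw [← Real.rpow_add h0]; congr 1; ring
      rw [e2]
      have : q - p ≠ 0 := by linarith
      field_simp
  set L : ℝ → ℝ := fun τ => ∑ y, ν y * (Set.Iio (g y)).indicator (fun τ : ℝ => τ ^ (p-1)) τ with hL
  set Rr : ℝ → ℝ := fun τ => ∑ x, μ x * (A * F x ^ (2:ℝ) *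
      (Set.Iio (F x / c)).indicator (fun τ : ℝ => τ ^ (p-3)) τ +
      B * (F x ^ q * (Set.Ici (F x / c)).indicator (fun τ : ℝ => τ ^ (p-1-q)) τ)) with hRr
  have hLi : IntegrableOn L (Set.Ioi 0) :=
    integrable_finsetSum _ fun y _ => (hI1 y).1.const_mul _
  have hRx : ∀ x, IntegrableOn (fun τ => (A * F x ^ (2:ℝ) *
      (Set.Iio (F x / c)).indicator (fun τ : ℝ => τ ^ (p-3)) τ +
      B * (F x ^ q * (Set.Ici (F x / c)).indicator (fun τ : ℝ => τ ^ (p-1-q)) τ))) (Set.Ioi 0) :=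
    fun x => ((hI2 x).1.const_mul _).add ((hI3 x).1.const_mul _)
  have hRi : IntegrableOn Rr (Set.Ioi 0) :=
    integrable_finsetSum _ fun x _ => (hRx x).const_mul _
  have hle : ∫ τ in Set.Ioi (0:ℝ), L τ ≤ ∫ τ in Set.Ioi (0:ℝ), Rr τ := by
    refine setIntegral_mono_on hLi hRi measurableSet_Ioi fun τ hτ => ?_
    have hτ : 0 < τ := hτ
    have h1 := mul_le_mul_of_nonneg_left (hyp τ hτ) (Real.rpow_nonneg hτ.le (p-1))
    have e1 : L τ = τ ^ (p-1) * ∑ y, ν y * (if τ < g y then 1 else 0) := by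
      rw [hL, Finset.mul_sum]
      refine Finset.sum_congr rfl fun y _ => ?_
      by_cases h : τ < g y <;> simp [Set.indicator, h, mul_comm]
    have e2 : Rr τ = τ ^ (p-1) * (A * τ ^ (-2 : ℝ) * ∑ x, μ x * (if c * τ < F x then F x ^ (2:ℝ) else 0) +
        B * τ ^ (-q) * ∑ x, μ x * (if F x ≤ c * τ then F x ^ q else 0)) := by
      rw [hRr, mul_add, Finset.mul_sum, Finset.mul_sum, Finset.mul_sum, Finset.mul_sum,
        ← Finset.sum_add_distrib]
      refine Finset.sum_congr rfl fun x _ => ?_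
      have t1 : τ ^ (p-3) = τ ^ (p-1) * τ ^ (-2:ℝ) := by
        rw [← Real.rpow_add hτ]; congr 1; ring
      have t2 : τ ^ (p-1-q) = τ ^ (p-1) * τ ^ (-q) := by
        rw [← Real.rpow_add hτ]; congr 1
      have c1 : τ < F x / c ↔ c * τ < F x := by rw [lt_div_iff₀ hc, mul_comm]
      have c2 : F x / c ≤ τ ↔ F x ≤ c * τ := by rw [div_le_iff₀ hc, mul_comm]
      simp only [Set.indicator, Set.mem_Iio, Set.mem_Ici, c1, c2]
      rw [t1, t2]
      split_ifs <;> ring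
    rw [e1, e2]; exact h1
  have eL : ∫ τ in Set.Ioi (0:ℝ), L τ = (∑ y, ν y * g y ^ p) / p := by
    rw [hL, integral_finsetSum _ (fun y _ => (hI1 y).1.const_mul _), Finset.sum_div]
    refine Finset.sum_congr rfl fun y _ => ?_
    rw [integral_const_mul, (hI1 y).2]
    have : p - 1 + 1 = p := by ring
    rw [this]; ring
  have eR : ∫ τ in Set.Ioi (0:ℝ), Rr τ = (A * c ^ (2 - p) / (p - 2) + B * c ^ (q - p) / (q - p)) *
      ∑ x, μ x * F x ^ p := by
    rw [hRr, integral_finsetSum _ (fun x _ => (hRx x).const_mul _), Finset.mul_sum]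
    refine Finset.sum_congr rfl fun x _ => ?_
    rw [integral_const_mul, integral_add ((hI2 x).1.const_mul _) ((hI3 x).1.const_mul _),
      integral_const_mul, integral_const_mul, (hI2 x).2, (hI3 x).2]
    have e1 : p - 3 + 1 = p - 2 := by ring
    have e2 : F x ^ (2:ℝ) * (F x / c) ^ (p-2) = c ^ (2-p) * F x ^ p := by
      rcases (hF x).eq_or_lt with h0 | h0
      · rw [← h0, Real.zero_rpow (by norm_num), Real.zero_rpow (by linarith)]; simp
      · rw [Real.div_rpow h0.le hc.le, show 2 - p = -(p-2) by ring, Real.rpow_neg hc.le,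
          show F x ^ p = F x ^ (2:ℝ) * F x ^ (p-2) by rw [← Real.rpow_add h0]; congr 1; ring]
        ring
    rw [e1]
    calc _ = μ x * (A * (F x ^ (2:ℝ) * (F x / c) ^ (p-2)) / (p-2) + B * (c ^ (q - p) / (q - p) * F x ^ p)) := by ring
      _ = _ := by rw [e2]; ring
  rw [eL, eR, div_le_iff₀ (by linarith)] at hle
  linarith

lemma cheb {Y : Type} [Fintype Y] (ν : Y → ℝ) (hν : ∀ y, 0 ≤ ν y) (g : Y → ℝ) (hg : ∀ y, 0 ≤ g y)
    {σ q : ℝ} (hσ : 0 < σ) (hq : 0 ≤ q) :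
    ∑ y, ν y * (if σ < g y then 1 else 0) ≤ σ ^ (-q) * ∑ y, ν y * g y ^ q := by
  rw [Finset.mul_sum]
  refine Finset.sum_le_sum fun y _ => ?_
  split_ifs with h
  · have : σ ^ q ≤ g y ^ q := Real.rpow_le_rpow hσ.le h.le hq
    rw [Real.rpow_neg hσ.le]
    have h1 : 1 ≤ (σ ^ q)⁻¹ * g y ^ q := by
      rw [inv_mul_eq_div, one_le_div (by positivity)]; exact this
    nlinarith [hν y]
  · have := hν y; have := hg y; rw [mul_zero]; positivity

/-- Marcinkiewicz between `2` and `q`. -/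
lemma marc {p q A B : ℝ} (hp : 2 < p) (hpq : p < q) (hA : 0 ≤ A) (hB : 0 ≤ B) :
    ∃ C : ℝ, 0 ≤ C ∧ ∀ {Y Ω : Type} [Fintype Y] [Fintype Ω] (ν : Y → ℝ) (μ : Ω → ℝ)
      (T : (Ω → ℂ) → Y → ℂ), (∀ y, 0 ≤ ν y) → (∀ x, 0 ≤ μ x) →
      (∀ f g y, T (fun x => f x + g x) y = T f y + T g y) →
      (∀ f, ∑ y, ν y * ‖T f y‖ ^ (2:ℝ) ≤ A * ∑ x, μ x * ‖f x‖ ^ (2:ℝ)) →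
      (∀ f, ∑ y, ν y * ‖T f y‖ ^ q ≤ B * ∑ x, μ x * ‖f x‖ ^ q) →
      ∀ f, ∑ y, ν y * ‖T f y‖ ^ p ≤ C * ∑ x, μ x * ‖f x‖ ^ p := by
  obtain ⟨C, hC, hi⟩ := interp (A := (1/2) ^ (-2:ℝ) * A) (B := (1/2) ^ (-q) * B) (c := 1) hp hpq
    (by positivity) (by positivity) one_pos
  refine ⟨C, hC, ?_⟩
  intro Y Ω _ _ ν μ T hν hμ hT h2 hq f
  refine hi ν μ (fun y => ‖T f y‖) (fun x => ‖f x‖) hν hμ (fun _ => norm_nonneg _)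
    (fun _ => norm_nonneg _) ?_
  intro τ hτ
  simp only [one_mul]
  set f1 : Ω → ℂ := fun x => if τ < ‖f x‖ then f x else 0 with hf1
  set f2 : Ω → ℂ := fun x => if ‖f x‖ ≤ τ then f x else 0 with hf2
  have hf : f = fun x => f1 x + f2 x := by
    ext x; simp only [hf1, hf2]
    by_cases h : τ < ‖f x‖
    · simp [h, not_le.2 h]
    · simp [h, not_lt.1 h]
  have hTf : ∀ y, T f y = T f1 y + T f2 y := by
    intro y; conv_lhs => rw [hf]
    exact hT _ _ _
  have hstep : ∑ y, ν y * (if τ < ‖T f y‖ then (1:ℝ) else 0) ≤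
      ∑ y, ν y * (if 1/2 * τ < ‖T f1 y‖ then (1:ℝ) else 0) + ∑ y, ν y * (if 1/2 * τ < ‖T f2 y‖ then (1:ℝ) else 0) := by
    rw [← Finset.sum_add_distrib]
    refine Finset.sum_le_sum fun y _ => ?_
    rw [← mul_add]
    refine mul_le_mul_of_nonneg_left ?_ (hν y)
    have h3 : ‖T f y‖ ≤ ‖T f1 y‖ + ‖T f2 y‖ := by rw [hTf]; exact norm_add_le _ _
    split_ifs <;> first | (exfalso; linarith) | norm_num
  have b1 := cheb ν hν (fun y => ‖T f1 y‖) (fun _ => norm_nonneg _) (show 0 < 1/2 * τ by linarith) (q := 2) (by norm_num)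
  have b2 := cheb ν hν (fun y => ‖T f2 y‖) (fun _ => norm_nonneg _) (show 0 < 1/2 * τ by linarith) (q := q) (by linarith)
  have c1 : ∑ x, μ x * ‖f1 x‖ ^ (2:ℝ) = ∑ x, μ x * (if τ < ‖f x‖ then ‖f x‖ ^ (2:ℝ) else 0) := by
    refine Finset.sum_congr rfl fun x _ => ?_
    simp only [hf1]; split_ifs <;> simp
  have c2 : ∑ x, μ x * ‖f2 x‖ ^ q = ∑ x, μ x * (if ‖f x‖ ≤ τ then ‖f x‖ ^ q else 0) := by
    refine Finset.sum_congr rfl fun x _ => ?_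
    simp only [hf2]; split_ifs
    · rfl
    · simp [Real.zero_rpow (by linarith : q ≠ 0)]
  rw [← c1, ← c2]
  have hpos : ∀ s : ℝ, (0:ℝ) ≤ (1/2 * τ) ^ s := fun s => Real.rpow_nonneg (by linarith) _
  have d1 := b1.trans (mul_le_mul_of_nonneg_left (h2 f1) (hpos _))
  have d2 := b2.trans (mul_le_mul_of_nonneg_left (hq f2) (hpos _))
  refine hstep.trans ((add_le_add d1 d2).trans (le_of_eq ?_))
  rw [Real.mul_rpow (by norm_num) hτ.le, Real.mul_rpow (by norm_num) hτ.le]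
  ring

lemma holder_w {Ω : Type} (s : Finset Ω) (μ a b : Ω → ℝ) (hμ : ∀ x ∈ s, 0 ≤ μ x)
    (ha : ∀ x ∈ s, 0 ≤ a x) (hb : ∀ x ∈ s, 0 ≤ b x) {p q : ℝ} (hpq : p.HolderConjugate q) :
    ∑ x ∈ s, μ x * (a x * b x) ≤
      (∑ x ∈ s, μ x * a x ^ p) ^ (1/p) * (∑ x ∈ s, μ x * b x ^ q) ^ (1/q) := by
  have h := Real.inner_le_Lp_mul_Lq_of_nonneg s hpq
    (f := fun x => μ x ^ (1/p) * a x) (g := fun x => μ x ^ (1/q) * b x)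
    (fun x hx => mul_nonneg (Real.rpow_nonneg (hμ x hx) _) (ha x hx))
    (fun x hx => mul_nonneg (Real.rpow_nonneg (hμ x hx) _) (hb x hx))
  have hp := hpq.pos
  have hq := hpq.symm.pos
  have e1 : ∑ x ∈ s, (μ x ^ (1/p) * a x) * (μ x ^ (1/q) * b x) = ∑ x ∈ s, μ x * (a x * b x) := by
    refine Finset.sum_congr rfl fun x hx => ?_
    have : μ x ^ (1/p) * μ x ^ (1/q) = μ x := by
      rw [← Real.rpow_add_of_nonneg (hμ x hx) (by positivity) (by positivity), one_div, one_div,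
        hpq.inv_add_inv_eq_one, Real.rpow_one]
    calc _ = (μ x ^ (1/p) * μ x ^ (1/q)) * (a x * b x) := by ring
      _ = _ := by rw [this]
  have e2 : ∑ x ∈ s, (μ x ^ (1/p) * a x) ^ p = ∑ x ∈ s, μ x * a x ^ p := by
    refine Finset.sum_congr rfl fun x hx => ?_
    rw [Real.mul_rpow (Real.rpow_nonneg (hμ x hx) _) (ha x hx), ← Real.rpow_mul (hμ x hx),
      one_div_mul_cancel hp.ne', Real.rpow_one]
  have e3 : ∑ x ∈ s, (μ x ^ (1/q) * b x) ^ q = ∑ x ∈ s, μ x * b x ^ q := by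
    refine Finset.sum_congr rfl fun x hx => ?_
    rw [Real.mul_rpow (Real.rpow_nonneg (hμ x hx) _) (hb x hx), ← Real.rpow_mul (hμ x hx),
      one_div_mul_cancel hq.ne', Real.rpow_one]
  rw [e1, e2, e3] at h
  exact h

lemma duality {Y : Type} (s : Finset Y) (ν : Y → ℝ) (hν : ∀ y ∈ s, 0 ≤ ν y) (u : Y → ℂ)
    {p q M : ℝ} (hpq : p.HolderConjugate q) (hM : 0 ≤ M)
    (h : ∀ g : Y → ℂ, (∀ y ∉ s, g y = 0) →
      ‖∑ y ∈ s, (ν y : ℂ) * (u y * g y)‖ ≤ M * (∑ y ∈ s, ν y * ‖g y‖ ^ q) ^ (1/q)) :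
    ∑ y ∈ s, ν y * ‖u y‖ ^ p ≤ M ^ p := by
  classical
  have hp := hpq.pos
  have hq := hpq.symm.pos
  set A := ∑ y ∈ s, ν y * ‖u y‖ ^ p with hA
  have hA0 : 0 ≤ A := Finset.sum_nonneg fun y hy => mul_nonneg (hν y hy) (by positivity)
  have h1 := h (fun y => if y ∈ s then ((‖u y‖ ^ (p-2) : ℝ) : ℂ) * (starRingEnd ℂ) (u y) else 0)
    (fun y hy => by simp [hy])
  have e1 : ∑ y ∈ s, (ν y : ℂ) * (u y * (if y ∈ s then ((‖u y‖ ^ (p-2) : ℝ) : ℂ) * (starRingEnd ℂ) (u y) else 0)) = (A : ℂ) := by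
    rw [hA, Complex.ofReal_sum]
    refine Finset.sum_congr rfl fun y hy => ?_
    rw [if_pos hy, Complex.ofReal_mul]
    congr 1
    by_cases hu : u y = 0
    · simp [hu, Real.zero_rpow hp.ne']
    · have hn : 0 < ‖u y‖ := norm_pos_iff.2 hu
      have : ‖u y‖ ^ p = ‖u y‖ ^ (p-2) * ‖u y‖ ^ 2 := by
        rw [← Real.rpow_natCast, ← Real.rpow_add hn]; congr 1; push_cast; ring
      rw [this]
      have h2 : u y * (starRingEnd ℂ) (u y) = ((‖u y‖ ^ 2 : ℝ) : ℂ) := by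
        rw [Complex.mul_conj, Complex.normSq_eq_norm_sq]
      rw [Complex.ofReal_mul, ← h2]; ring
  have e2 : ∑ y ∈ s, ν y * ‖(if y ∈ s then ((‖u y‖ ^ (p-2) : ℝ) : ℂ) * (starRingEnd ℂ) (u y) else 0)‖ ^ q = A := by
    rw [hA]
    refine Finset.sum_congr rfl fun y hy => ?_
    rw [if_pos hy]
    congr 1
    by_cases hu : u y = 0
    · simp [hu, Real.zero_rpow hp.ne', Real.zero_rpow hq.ne']
    · have hn : 0 < ‖u y‖ := norm_pos_iff.2 hu
      rw [norm_mul, RCLike.norm_conj, Complex.norm_real, Real.norm_of_nonneg (by positivity)]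
      have : ‖u y‖ ^ (p-2) * ‖u y‖ = ‖u y‖ ^ (p-1) := by
        conv_lhs => rw [← Real.rpow_one ‖u y‖, ← Real.rpow_mul hn.le, one_mul, ← Real.rpow_add hn]
        congr 1; ring
      rw [this, ← Real.rpow_mul hn.le, hpq.sub_one_mul_conj]
  rw [e1, e2, Complex.norm_real, Real.norm_of_nonneg hA0] at h1
  rcases hA0.eq_or_lt with h0 | h0
  · rw [← h0]; positivity
  · have h3 : A ^ (1/p) ≤ M := by
      have hA1 : A = A ^ (1/p) * A ^ (1/q) := by
        rw [← Real.rpow_add h0, one_div, one_div, hpq.inv_add_inv_eq_one, Real.rpow_one]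
      have hpos : 0 < A ^ (1/q) := by positivity
      refine le_of_mul_le_mul_right ?_ hpos
      rw [← hA1]; exact h1
    calc A = (A ^ (1/p)) ^ p := by
          rw [← Real.rpow_mul hA0, one_div_mul_cancel hp.ne', Real.rpow_one]
      _ ≤ M ^ p := Real.rpow_le_rpow (by positivity) h3 hp.le
end IW

open scoped BigOperators
set_option linter.unusedSectionVars false
set_option linter.unusedVariables false
namespace IW
section local_thm
variable {ι : Type} [Fintype ι] [DecidableEq ι] {Z : ι → Type} [∀ i, Fintype (Z i)]
  [∀ i, Nonempty (Z i)]

/-- uniform weight -/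
noncomputable def un (H : Type) [Fintype H] : H → ℝ := fun _ => (Fintype.card H : ℝ)⁻¹

lemma un_nonneg (H : Type) [Fintype H] (h : H) : 0 ≤ un H h := by unfold un; positivity

lemma expect_eq_un {H : Type} [Fintype H] (u : H → ℝ) : 𝔼 h, u h = ∑ h, un H h * u h := by
  simp only [un]; rw [Fintype.expect_eq_sum_div_card, ← Finset.mul_sum]; ring

lemma cexpect_eq_un {H : Type} [Fintype H] (u : H → ℂ) : 𝔼 h, u h = ∑ h, (un H h : ℂ) * u h := by
  simp only [un]; rw [Fintype.expect_eq_sum_div_card, ← Finset.mul_sum]; push_cast; ring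

lemma FS_add {Ω : Type} [Fintype Ω] (D : ℕ) (μ : Ω → ℝ) (X : Ω → ∀ i, Z i) (f g : Ω → ℂ)
    (S : Finset ι) (h : ∀ i, Z i) :
    FS D μ X (fun x => f x + g x) S h = FS D μ X f S h + FS D μ X g S h := by
  unfold FS
  split_ifs
  · unfold cT
    rw [← Finset.sum_add_distrib]
    exact Finset.sum_congr rfl fun x _ => by ring
  · simp

lemma Gam_add_le {Ω : Type} [Fintype Ω] (D : ℕ) (μ : Ω → ℝ) (X : Ω → ∀ i, Z i) (f g : Ω → ℂ)
    (J : Finset ι) (h : ∀ i, Z i) :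
    Gam (gS D μ X (fun x => f x + g x)) J h ≤
      2 * Gam (gS D μ X f) J h + 2 * Gam (gS D μ X g) J h := by
  unfold Gam cE
  rw [Finset.mul_expect, Finset.mul_expect, ← Finset.expect_add_distrib]
  refine expect_mono' fun h' => ?_
  unfold GG
  rw [Finset.mul_sum, Finset.mul_sum, ← Finset.sum_add_distrib]
  refine Finset.sum_le_sum fun S _ => ?_
  unfold gS
  rw [FS_add]
  have := norm_add_le (FS D μ X f S (J.piecewise h h')) (FS D μ X g S (J.piecewise h h'))
  nlinarith [norm_nonneg (FS D μ X f S (J.piecewise h h') + FS D μ X g S (J.piecewise h h')),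
    sq_nonneg (‖FS D μ X f S (J.piecewise h h')‖ - ‖FS D μ X g S (J.piecewise h h')‖)]

lemma GG_nonneg {Ω : Type} [Fintype Ω] (D : ℕ) (μ : Ω → ℝ) (X : Ω → ∀ i, Z i) (f : Ω → ℂ)
    (J : Finset ι) (h : ∀ i, Z i) : 0 ≤ GG (gS D μ X f) J h :=
  Finset.sum_nonneg fun S _ => by unfold gS; positivity

lemma Gam_nonneg {Ω : Type} [Fintype Ω] (D : ℕ) (μ : Ω → ℝ) (X : Ω → ∀ i, Z i) (f : Ω → ℂ)
    (J : Finset ι) (h : ∀ i, Z i) : 0 ≤ Gam (gS D μ X f) J h :=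
  cE_nonneg _ (fun h => GG_nonneg _ _ _ _ _ _) _

lemma sqrt_rpow_two_mul {a : ℝ} (ha : 0 ≤ a) (r : ℕ) : (Real.sqrt a) ^ (2 * (r:ℝ)) = a ^ r := by
  rw [Real.sqrt_eq_rpow, ← Real.rpow_mul ha]
  rw [show (1:ℝ)/2 * (2 * r) = r by ring, Real.rpow_natCast]

/-- interpolation for `Γ` -/
lemma gam_interp (D r : ℕ) (hr : 2 ≤ r) : ∃ C : ℝ, 0 ≤ C ∧
    ∀ (ι : Type) [Fintype ι] [DecidableEq ι] (Z : ι → Type) [∀ i, Fintype (Z i)]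
      [∀ i, Nonempty (Z i)] (Ω : Type) [Fintype Ω] (μ : Ω → ℝ) (X : Ω → ∀ i, Z i),
      Dom (3 * D) μ X → ∀ f : Ω → ℂ,
      ∑ J, 𝔼 h, Gam (gS D μ X f) J h ^ r ≤ C * ∑ x, μ x * ‖f x‖ ^ (2 * (r:ℝ)) := by
  have hr' : (2:ℝ) ≤ r := by exact_mod_cast hr
  obtain ⟨C, hC, hi⟩ := interp (p := 2 * r) (q := 2 * r + 1) (A := 4 * 2 ^ D) (B := 0)
    (c := (1/2) ^ (D+1)) (by linarith) (by linarith) (by positivity) le_rfl (by positivity)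
  refine ⟨C, hC, ?_⟩
  intro ι _ _ Z _ _ Ω _ μ X hD f
  have key := hi (Y := Finset ι × (∀ i, Z i)) (Ω := Ω) (fun y => un (∀ i, Z i) y.2) μ
    (fun y => Real.sqrt (Gam (gS D μ X f) y.1 y.2)) (fun x => ‖f x‖) (fun y => un_nonneg _ _) hD.1
    (fun y => Real.sqrt_nonneg _) (fun x => norm_nonneg _) ?_
  · refine le_trans (le_of_eq ?_) key
    rw [Fintype.sum_prod_type]
    refine Finset.sum_congr rfl fun J _ => ?_
    rw [expect_eq_un]
    refine Finset.sum_congr rfl fun h _ => ?_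
    rw [sqrt_rpow_two_mul (Gam_nonneg _ _ _ _ _ _)]
  · intro τ hτ
    simp only [zero_mul, add_zero]
    set c : ℝ := (1/2) ^ (D+1) with hc
    have hc0 : 0 < c := by positivity
    have hcc : 4 ^ D * (c * τ) ^ 2 = τ ^ 2 / 4 := by
      have : (4:ℝ) ^ D * c ^ 2 = 1/4 := by
        rw [hc, ← pow_mul, mul_comm (D+1) 2, pow_mul, pow_succ]
        rw [← mul_assoc, ← mul_pow]; norm_num
      rw [mul_pow, ← mul_assoc, this]; ring
    set f1 : Ω → ℂ := fun x => if c * τ < ‖f x‖ then f x else 0 with hf1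
    set f2 : Ω → ℂ := fun x => if c * τ < ‖f x‖ then 0 else f x with hf2
    have hf : f = fun x => f1 x + f2 x := by
      ext x; simp only [hf1, hf2]; split_ifs <;> simp
    have hf2b : ∀ x, ‖f2 x‖ ≤ c * τ := by
      intro x; simp only [hf2]; split_ifs with h
      · simp; positivity
      · exact not_lt.1 h
    have hpt : ∀ (J : Finset ι) (h : ∀ i, Z i), (if τ < Real.sqrt (Gam (gS D μ X f) J h) then (1:ℝ) else 0) ≤
        4 * τ ^ (-2:ℝ) * Gam (gS D μ X f1) J h := by
      intro J h
      have h0 := Gam_nonneg D μ X f1 J h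
      have hτ2 : τ ^ (-2:ℝ) = (τ^2)⁻¹ := by
        rw [Real.rpow_neg hτ.le]; norm_num
      rw [hτ2]
      split_ifs with hlt
      · have h1 : τ ^ 2 < Gam (gS D μ X f) J h := (Real.lt_sqrt hτ.le).1 hlt
        have h2 := Gam_add_le D μ X f1 f2 J h
        rw [← hf] at h2
        have h3 := Gam_le D μ X hD f2 (by positivity) hf2b J h
        rw [hcc] at h3
        have : τ ^ 2 ≤ 4 * Gam (gS D μ X f1) J h := by linarith
        rw [mul_comm (4:ℝ), mul_assoc, inv_mul_eq_div, one_le_div (by positivity)]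
        exact this
      · positivity
    calc ∑ y : Finset ι × (∀ i, Z i), un (∀ i, Z i) y.2 * (if τ < Real.sqrt (Gam (gS D μ X f) y.1 y.2) then (1:ℝ) else 0)
        ≤ ∑ y : Finset ι × (∀ i, Z i), un (∀ i, Z i) y.2 * (4 * τ ^ (-2:ℝ) * Gam (gS D μ X f1) y.1 y.2) :=
          Finset.sum_le_sum fun y _ => mul_le_mul_of_nonneg_left (hpt _ _) (un_nonneg _ _)
      _ = 4 * τ ^ (-2:ℝ) * ∑ J, 𝔼 h, Gam (gS D μ X f1) J h := by
          rw [Fintype.sum_prod_type, Finset.mul_sum]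
          refine Finset.sum_congr rfl fun J _ => ?_
          rw [expect_eq_un, Finset.mul_sum]
          exact Finset.sum_congr rfl fun h _ => by ring
      _ ≤ 4 * τ ^ (-2:ℝ) * (2 ^ D * ∑ x, μ x * ‖f1 x‖ ^ 2) := by
          refine mul_le_mul_of_nonneg_left ?_ (by positivity)
          exact sum_Gam_le D μ X (hD.mono (by omega)) f1
      _ = _ := by
          have : ∑ x, μ x * ‖f1 x‖ ^ 2 = ∑ x, μ x * (if c * τ < ‖f x‖ then ‖f x‖ ^ (2:ℝ) else 0) := by
            refine Finset.sum_congr rfl fun x _ => ?_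
            simp only [hf1]; split_ifs <;> simp
          rw [this]; ring

/-- the local operator -/
noncomputable def Wop {Ω : Type} [Fintype Ω] (D : ℕ) (μ : Ω → ℝ) (X : Ω → ∀ i, Z i) (f : Ω → ℂ)
    (h : ∀ i, Z i) : ℂ := ∑ S, FS D μ X f S h

lemma Wop_add {Ω : Type} [Fintype Ω] (D : ℕ) (μ : Ω → ℝ) (X : Ω → ∀ i, Z i) (f g : Ω → ℂ)
    (h : ∀ i, Z i) :
    Wop D μ X (fun x => f x + g x) h = Wop D μ X f h + Wop D μ X g h := by
  unfold Wop; rw [← Finset.sum_add_distrib]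
  exact Finset.sum_congr rfl fun S _ => FS_add _ _ _ _ _ _ _

lemma Wop_sq (D r : ℕ) (hr : 1 ≤ r) : ∃ C : ℝ, 0 ≤ C ∧
    ∀ (ι : Type) [Fintype ι] [DecidableEq ι] (Z : ι → Type) [∀ i, Fintype (Z i)]
      [∀ i, Nonempty (Z i)] (Ω : Type) [Fintype Ω] (μ : Ω → ℝ) (X : Ω → ∀ i, Z i),
      ∀ f : Ω → ℂ,
      𝔼 h, ‖Wop D μ X f h‖ ^ (2 * r) ≤ C * 𝔼 h, GG (gS D μ X f) ∅ h ^ r := by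
  obtain ⟨C, hC, hs⟩ := sqfun r hr
  refine ⟨(C ^ D) ^ r, by positivity, ?_⟩
  intro ι _ _ Z _ _ Ω _ μ X f
  refine (hs ι Z (FS D μ X f) (FS_dep D μ X f) ?_).trans ?_
  · intro S i hi h
    unfold FS
    split_ifs
    · exact cE_cT μ X f S i hi h
    · unfold cE; simp
  · rw [Finset.mul_expect]
    refine expect_mono' fun h => ?_
    rw [← mul_pow]
    refine pow_le_pow_left₀ (Finset.sum_nonneg fun S _ => by positivity) ?_ _
    unfold GG gS
    rw [Finset.mul_sum]
    simp only [Finset.empty_subset, Finset.filter_true]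
    refine Finset.sum_le_sum fun S _ => ?_
    by_cases hS : S.card ≤ D
    · exact mul_le_mul_of_nonneg_right (pow_le_pow_right₀ hC hS) (by positivity)
    · simp [FS, hS]

lemma Wop_two (D : ℕ) : ∃ C : ℝ, 0 ≤ C ∧
    ∀ (ι : Type) [Fintype ι] [DecidableEq ι] (Z : ι → Type) [∀ i, Fintype (Z i)]
      [∀ i, Nonempty (Z i)] (Ω : Type) [Fintype Ω] (μ : Ω → ℝ) (X : Ω → ∀ i, Z i),
      Dom (3 * D) μ X → ∀ f : Ω → ℂ,
      ∑ h, un (∀ i, Z i) h * ‖Wop D μ X f h‖ ^ (2:ℝ) ≤ C * ∑ x, μ x * ‖f x‖ ^ (2:ℝ) := by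
  obtain ⟨C, hC, hs⟩ := Wop_sq D 1 le_rfl
  refine ⟨C, hC, ?_⟩
  intro ι _ _ Z _ _ Ω _ μ X hD f
  have h1 := hs ι Z Ω μ X f
  have h2 := bessel_dom D μ X (hD.mono (by omega)) f
  rw [← expect_eq_un]
  simp only [mul_one, pow_one] at h1
  simp only [Real.rpow_two]
  refine h1.trans (mul_le_mul_of_nonneg_left ?_ hC)
  refine le_trans (le_of_eq ?_) h2
  unfold GG
  rw [Finset.expect_sum_comm]; simp

lemma Wop_even (D r : ℕ) (hr : 2 ≤ r) : ∃ C : ℝ, 0 ≤ C ∧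
    ∀ (ι : Type) [Fintype ι] [DecidableEq ι] (Z : ι → Type) [∀ i, Fintype (Z i)]
      [∀ i, Nonempty (Z i)] (Ω : Type) [Fintype Ω] (μ : Ω → ℝ) (X : Ω → ∀ i, Z i),
      Dom (3 * D) μ X → ∀ f : Ω → ℂ,
      ∑ h, un (∀ i, Z i) h * ‖Wop D μ X f h‖ ^ (2 * (r:ℝ)) ≤ C * ∑ x, μ x * ‖f x‖ ^ (2 * (r:ℝ)) := by
  obtain ⟨C1, hC1, h1⟩ := Wop_sq D r (by omega)
  obtain ⟨C2, hC2, h2⟩ := lemmaR D r (by omega)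
  obtain ⟨C3, hC3, h3⟩ := gam_interp D r hr
  refine ⟨C1 * (C2 * C3), by positivity, ?_⟩
  intro ι _ _ Z _ _ Ω _ μ X hD f
  have e : (2 * (r:ℝ)) = ((2 * r : ℕ) : ℝ) := by push_cast; ring
  have a1 := h1 ι Z Ω μ X f
  have a2 := h2 ι Z (gS D μ X f) (fun S h => by unfold gS; positivity)
    (fun S => (FS_dep D μ X f S).comp (fun z : ℂ => ‖z‖ ^ 2))
    (fun S hS => by ext h; simp [gS, FS, not_le.2 hS]) ∅ (fun _ => 1) (fun _ => zero_le_one)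
    (fun _ _ _ => rfl)
  have a3 := h3 ι Z Ω μ X hD f
  simp only [one_mul, Finset.empty_subset, Finset.filter_true] at a2
  rw [← expect_eq_un]
  have a4 : 𝔼 h, ‖Wop D μ X f h‖ ^ (2 * (r:ℝ)) = 𝔼 h, ‖Wop D μ X f h‖ ^ (2 * r) := by
    simp only [e, Real.rpow_natCast]
  rw [a4]
  calc _ ≤ _ := a1
    _ ≤ C1 * (C2 * (C3 * ∑ x, μ x * ‖f x‖ ^ (2 * (r:ℝ)))) :=
      mul_le_mul_of_nonneg_left (a2.trans (mul_le_mul_of_nonneg_left a3 hC2)) hC1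
    _ = _ := by ring

end local_thm
end IW

open scoped BigOperators
set_option linter.unusedSectionVars false
set_option linter.unusedVariables false
namespace IW
section local_thm2

lemma Wop_ge (D : ℕ) (p : ℝ) (hp : 2 ≤ p) : ∃ C : ℝ, 0 ≤ C ∧
    ∀ (ι : Type) [Fintype ι] [DecidableEq ι] (Z : ι → Type) [∀ i, Fintype (Z i)]
      [∀ i, Nonempty (Z i)] (Ω : Type) [Fintype Ω] (μ : Ω → ℝ) (X : Ω → ∀ i, Z i),
      Dom (3 * D) μ X → ∀ f : Ω → ℂ,
      ∑ h, un (∀ i, Z i) h * ‖Wop D μ X f h‖ ^ p ≤ C * ∑ x, μ x * ‖f x‖ ^ p := by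
  obtain ⟨C2, hC2, h2⟩ := Wop_two D
  rcases hp.eq_or_lt with rfl | hp
  · exact ⟨C2, hC2, h2⟩
  obtain ⟨R, hR⟩ := exists_nat_gt p
  obtain ⟨C3, hC3, h3⟩ := Wop_even D (R+2) (by omega)
  obtain ⟨C, hC, hm⟩ := marc (p := p) (q := 2 * ((R+2:ℕ):ℝ)) hp (by push_cast; linarith) hC2 hC3
  refine ⟨C, hC, ?_⟩
  intro ι _ _ Z _ _ Ω _ μ X hD f
  exact hm (un _) μ (Wop D μ X) (un_nonneg _) hD.1 (Wop_add D μ X) (h2 ι Z Ω μ X hD)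
    (h3 ι Z Ω μ X hD) f

lemma dom_un {ι : Type} [Fintype ι] [DecidableEq ι] {Z : ι → Type} [∀ i, Fintype (Z i)]
    [∀ i, Nonempty (Z i)] (n : ℕ) : Dom n (un (∀ i, Z i)) id := by
  refine ⟨un_nonneg _, fun ψ _ _ => ?_⟩
  rw [expect_eq_un]; simp

lemma Wop_lowDeg {ι : Type} [Fintype ι] [DecidableEq ι] {Z : ι → Type} [∀ i, Fintype (Z i)]
    [∀ i, Nonempty (Z i)] {Ω : Type} [Fintype Ω] (D : ℕ) (μ : Ω → ℝ) (X : Ω → ∀ i, Z i)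
    (f : Ω → ℂ) (R : ℕ) : (fun h => ‖Wop D μ X f h‖ ^ (2 * R)) ∈ LowDeg Z ((D + D) * R) := by
  have h1 := LowDeg.normSq_sum (n := D) (Finset.univ.filter (fun S => S.card ≤ D)) (by simp) (cT μ X f)
    (fun T _ => cT_dep μ X f T)
  have h2 := LowDeg.pow h1 R
  have e : (fun h => ‖Wop D μ X f h‖ ^ (2 * R)) =
      (fun h => ‖∑ T ∈ Finset.univ.filter (fun S => S.card ≤ D), cT μ X f T h‖ ^ 2) ^ R := by
    ext h
    rw [Pi.pow_apply, ← pow_mul, Finset.sum_filter]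
    rfl
  rw [e]
  first | exact h2 | (rw [mul_comm]; exact h2)

lemma Vop_even {ι : Type} [Fintype ι] [DecidableEq ι] {Z : ι → Type} [∀ i, Fintype (Z i)]
    [∀ i, Nonempty (Z i)] {Ω : Type} [Fintype Ω] (D R : ℕ) (μ : Ω → ℝ) (X : Ω → ∀ i, Z i)
    (hD : Dom ((D + D) * R) μ X) (G : (∀ i, Z i) → ℂ) :
    ∑ x, μ x * ‖Wop D (un _) id G (X x)‖ ^ (2 * (R:ℝ)) ≤
      ∑ h, un (∀ i, Z i) h * ‖Wop D (un _) id G h‖ ^ (2 * (R:ℝ)) := by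
  have e : (2 * (R:ℝ)) = ((2 * R : ℕ) : ℝ) := by push_cast; ring
  simp only [e, Real.rpow_natCast]
  rw [← expect_eq_un]
  exact hD.2 _ (Wop_lowDeg D (un _) id G R) (fun h => by positivity)

lemma Vop_ge (D : ℕ) (p : ℝ) (hp : 2 < p) : ∃ C : ℝ, 0 ≤ C ∧ ∃ n : ℕ,
    ∀ (ι : Type) [Fintype ι] [DecidableEq ι] (Z : ι → Type) [∀ i, Fintype (Z i)]
      [∀ i, Nonempty (Z i)] (Ω : Type) [Fintype Ω] (μ : Ω → ℝ) (X : Ω → ∀ i, Z i),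
      Dom n μ X → ∀ G : (∀ i, Z i) → ℂ,
      ∑ x, μ x * ‖Wop D (un _) id G (X x)‖ ^ p ≤ C * ∑ h, un (∀ i, Z i) h * ‖G h‖ ^ p := by
  obtain ⟨R, hR⟩ := exists_nat_gt p
  obtain ⟨C2, hC2, h2⟩ := Wop_two D
  obtain ⟨C3, hC3, h3⟩ := Wop_even D (R+2) (by omega)
  obtain ⟨C, hC, hm⟩ := marc (p := p) (q := 2 * ((R+2:ℕ):ℝ)) hp (by push_cast; linarith) hC2 hC3
  refine ⟨C, hC, (D + D) * (R + 2), ?_⟩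
  intro ι _ _ Z _ _ Ω _ μ X hD G
  refine hm μ (un _) (fun G x => Wop D (un _) id G (X x)) hD.1 (un_nonneg _)
    (fun f g x => Wop_add D (un _) id f g (X x)) ?_ ?_ G
  · intro G
    have := Vop_even D 1 μ X (hD.mono (Nat.mul_le_mul_left _ (by omega))) G
    simp only [Nat.cast_one, mul_one] at this
    exact this.trans (h2 ι Z _ _ id (dom_un _) G)
  · intro G
    exact (Vop_even D (R+2) μ X hD G).trans (h3 ι Z _ _ id (dom_un _) G)

lemma pair_WV {ι : Type} [Fintype ι] [DecidableEq ι] {Z : ι → Type} [∀ i, Fintype (Z i)]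
    [∀ i, Nonempty (Z i)] {Ω : Type} [Fintype Ω] (D : ℕ) (μ : Ω → ℝ) (X : Ω → ∀ i, Z i)
    (f : Ω → ℂ) (G : (∀ i, Z i) → ℂ) :
    ∑ h, (un (∀ i, Z i) h : ℂ) * (Wop D μ X f h * G h) =
      ∑ x, (μ x : ℂ) * (f x * Wop D (un _) id G (X x)) := by
  unfold Wop FS cT
  simp only [Finset.sum_mul, Finset.mul_sum, id]
  rw [Finset.sum_comm]
  conv_rhs => rw [Finset.sum_comm]
  refine Finset.sum_congr rfl fun S _ => ?_
  by_cases hS : S.card ≤ D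
  · simp only [hS, if_true, Finset.sum_mul, Finset.mul_sum]
    rw [Finset.sum_comm]
    refine Finset.sum_congr rfl fun x _ => Finset.sum_congr rfl fun h _ => ?_
    rw [Phi_comm S (X x) h]; ring
  · simp [hS]

/-- **Local theorem.** -/
theorem local_thm (D : ℕ) (p : ℝ) (hp : 1 < p) : ∃ C : ℝ, 0 ≤ C ∧ ∃ n : ℕ,
    ∀ (ι : Type) [Fintype ι] [DecidableEq ι] (Z : ι → Type) [∀ i, Fintype (Z i)]
      [∀ i, Nonempty (Z i)] (Ω : Type) [Fintype Ω] (μ : Ω → ℝ) (X : Ω → ∀ i, Z i),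
      Dom n μ X → ∀ f : Ω → ℂ,
      ∑ h, un (∀ i, Z i) h * ‖Wop D μ X f h‖ ^ p ≤ C * ∑ x, μ x * ‖f x‖ ^ p := by
  by_cases hp2 : 2 ≤ p
  · obtain ⟨C, hC, h⟩ := Wop_ge D p hp2
    exact ⟨C, hC, 3 * D, h⟩
  push Not at hp2
  have hpq := Real.HolderConjugate.conjExponent hp
  set q := p.conjExponent with hq
  have hq2 : 2 < q := by
    rw [hq, Real.conjExponent, lt_div_iff₀ (by linarith)]; linarith
  obtain ⟨C, hC, n, h⟩ := Vop_ge D q hq2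
  refine ⟨(C ^ (1/q)) ^ p, by positivity, n, ?_⟩
  intro ι _ _ Z _ _ Ω _ μ X hD f
  have hS0 : 0 ≤ ∑ x, μ x * ‖f x‖ ^ p :=
    Finset.sum_nonneg fun x _ => mul_nonneg (hD.1 x) (by positivity)
  have key := duality Finset.univ (un (∀ i, Z i)) (fun h _ => un_nonneg _ h) (Wop D μ X f) hpq
    (M := (∑ x, μ x * ‖f x‖ ^ p) ^ (1/p) * C ^ (1/q)) (by positivity) ?_
  · refine key.trans (le_of_eq ?_)
    rw [Real.mul_rpow (by positivity) (by positivity), ← Real.rpow_mul hS0,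
      one_div_mul_cancel (by linarith), Real.rpow_one, mul_comm]
  · intro G _
    rw [pair_WV]
    calc ‖∑ x, (μ x : ℂ) * (f x * Wop D (un _) id G (X x))‖
        ≤ ∑ x, μ x * (‖f x‖ * ‖Wop D (un _) id G (X x)‖) := by
          refine (norm_sum_le _ _).trans (le_of_eq (Finset.sum_congr rfl fun x _ => ?_))
          rw [norm_mul, norm_mul, Complex.norm_real, Real.norm_of_nonneg (hD.1 x)]
      _ ≤ (∑ x, μ x * ‖f x‖ ^ p) ^ (1/p) * (∑ x, μ x * ‖Wop D (un _) id G (X x)‖ ^ q) ^ (1/q) :=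
          holder_w Finset.univ μ _ _ (fun x _ => hD.1 x) (fun _ _ => norm_nonneg _)
            (fun _ _ => norm_nonneg _) hpq
      _ ≤ (∑ x, μ x * ‖f x‖ ^ p) ^ (1/p) * (C * ∑ h, un (∀ i, Z i) h * ‖G h‖ ^ q) ^ (1/q) := by
          refine mul_le_mul_of_nonneg_left ?_ (by positivity)
          refine Real.rpow_le_rpow (Finset.sum_nonneg fun x _ => mul_nonneg (hD.1 x) (by positivity))
            (h ι Z Ω μ X hD G) (by positivity)
      _ = _ := by
          rw [Real.mul_rpow hC (Finset.sum_nonneg fun x _ => mul_nonneg (un_nonneg _ _) (by positivity))]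
          ring

end local_thm2
end IW

open scoped BigOperators
set_option linter.unusedSectionVars false
set_option linter.unusedVariables false
namespace IW

/-- `e(t) = exp(2πit)` -/
noncomputable def ee (t : ℝ) : ℂ := Complex.exp (2 * Real.pi * Complex.I * t)

lemma ee_add (s t : ℝ) : ee (s + t) = ee s * ee t := by
  unfold ee; rw [← Complex.exp_add]; congr 1; push_cast; ring

lemma ee_zero : ee 0 = 1 := by simp [ee]

lemma ee_neg (t : ℝ) : ee (-t) = (ee t)⁻¹ := by
  unfold ee; rw [← Complex.exp_neg]; congr 1; push_cast; ring

lemma norm_ee (t : ℝ) : ‖ee t‖ = 1 := by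
  unfold ee
  rw [show (2 * Real.pi * Complex.I * t : ℂ) = ((2 * Real.pi * t : ℝ) : ℂ) * Complex.I by push_cast; ring]
  exact Complex.norm_exp_ofReal_mul_I _

lemma ee_ne_zero (t : ℝ) : ee t ≠ 0 := Complex.exp_ne_zero _

lemma ee_int (n : ℤ) : ee n = 1 := by
  unfold ee; rw [Complex.exp_eq_one_iff]; exact ⟨n, by push_cast; ring⟩

lemma ee_eq_one_iff (t : ℝ) : ee t = 1 ↔ ∃ n : ℤ, t = n := by
  constructor
  · intro h
    unfold ee at h
    rw [Complex.exp_eq_one_iff] at h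
    obtain ⟨n, hn⟩ := h
    refine ⟨n, ?_⟩
    have : (2 * Real.pi * Complex.I : ℂ) ≠ 0 := Complex.two_pi_I_ne_zero
    have h2 : (2 * Real.pi * Complex.I : ℂ) * t = (2 * Real.pi * Complex.I : ℂ) * n := by rw [hn]; ring
    have := mul_left_cancel₀ this h2
    exact_mod_cast this
  · rintro ⟨n, rfl⟩; exact ee_int n

lemma ee_sum {α : Type*} (s : Finset α) (t : α → ℝ) : ee (∑ i ∈ s, t i) = ∏ i ∈ s, ee (t i) := by
  classical
  induction s using Finset.induction_on with
  | empty => simp [ee_zero]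
  | insert a s ha ih => rw [Finset.sum_insert ha, Finset.prod_insert ha, ee_add, ih]

lemma ee_nat_mul (n : ℕ) (t : ℝ) : ee (n * t) = ee t ^ n := by
  unfold ee; rw [← Complex.exp_nat_mul]; congr 1; push_cast; ring

/-- complete exponential sums -/
lemma sum_ee (q : ℕ) (hq : 0 < q) (z : ℤ) :
    ∑ b ∈ Finset.Icc 1 q, ee ((b:ℝ) / q * z) = if (q:ℤ) ∣ z then (q:ℂ) else 0 := by
  have hq' : (q:ℝ) ≠ 0 := by positivity
  have e : ∀ b : ℕ, ee ((b:ℝ) / q * z) = ee (z / q) ^ b := by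
    intro b; rw [← ee_nat_mul]; congr 1; ring
  simp only [e]
  have hpow : ee (z / q) ^ q = 1 := by
    rw [← ee_nat_mul, mul_div_cancel₀ _ hq']; exact ee_int z
  have hsplit : ∑ b ∈ Finset.Icc 1 q, ee (z / q) ^ b = ∑ b ∈ Finset.range q, ee (z / q) ^ b := by
    have h1 := Finset.sum_range_succ (fun b => ee (z / q) ^ b) q
    have h2 := Finset.sum_range_succ' (fun b => ee (z / q) ^ b) q
    have h3 : ∑ b ∈ Finset.Icc 1 q, ee (z / q) ^ b = ∑ b ∈ Finset.range q, ee (z / q) ^ (b + 1) := by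
      rw [Finset.range_eq_Ico, Finset.sum_Ico_add' (fun b => ee (z / q) ^ b) 0 q 1]
      rfl
    rw [h3]
    rw [h1] at h2
    simp only [hpow, pow_zero] at h2
    exact (add_right_cancel h2).symm
  rw [hsplit]
  split_ifs with h
  · obtain ⟨k, rfl⟩ := h
    have : ee (((q * k : ℤ) : ℝ) / q) = 1 := by
      rw [ee_eq_one_iff]; exact ⟨k, by push_cast; field_simp⟩
    rw [this]; simp
  · have hne : ee (z / q) ≠ 1 := by
      rw [Ne, ee_eq_one_iff]
      rintro ⟨n, hn⟩
      apply h
      refine ⟨n, ?_⟩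
      rw [div_eq_iff hq'] at hn
      have : (z:ℝ) = ((q * n : ℤ) : ℝ) := by rw [hn]; push_cast; ring
      exact_mod_cast this
    rw [geom_sum_eq hne, hpow]; simp

/-- points of `(0,1]^d` with denominator `q` -/
noncomputable def Bset (d q : ℕ) : Finset (Fin d → ℝ) :=
  Fintype.piFinset fun _ => (Finset.Icc 1 q).image fun b : ℕ => (b : ℝ) / q

/-- integrality -/
def IsI {d : ℕ} (n : ℤ) (v : Fin d → ℝ) : Prop := ∀ j, ∃ k : ℤ, n * v j = k

lemma mem_Bset {d q : ℕ} (hq : 0 < q) (v : Fin d → ℝ) :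
    v ∈ Bset d q ↔ (∀ j, 0 < v j ∧ v j ≤ 1) ∧ IsI q v := by
  have hq' : (0:ℝ) < q := by positivity
  unfold Bset IsI
  rw [Fintype.mem_piFinset]
  simp only [Finset.mem_image, Finset.mem_Icc]
  constructor
  · intro h
    constructor
    · intro j
      obtain ⟨b, ⟨hb1, hb2⟩, hb⟩ := h j
      rw [← hb]
      have h1 : (1:ℝ) ≤ b := by exact_mod_cast hb1
      have h2 : (b:ℝ) ≤ q := by exact_mod_cast hb2
      exact ⟨by positivity, by rw [div_le_one hq']; exact h2⟩
    · intro j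
      obtain ⟨b, ⟨hb1, hb2⟩, hb⟩ := h j
      exact ⟨b, by rw [← hb]; push_cast; field_simp⟩
  · rintro ⟨h1, h2⟩ j
    obtain ⟨k, hk⟩ := h2 j
    have hk' : (q:ℝ) * v j = k := by exact_mod_cast hk
    have hkpos : 0 < k := by
      have : (0:ℝ) < k := by rw [← hk']; exact mul_pos hq' (h1 j).1
      exact_mod_cast this
    have hkle : k ≤ q := by
      have : (k:ℝ) ≤ q := by rw [← hk']; nlinarith [(h1 j).2]
      exact_mod_cast this
    lift k to ℕ using hkpos.le
    refine ⟨k, ⟨by exact_mod_cast hkpos, by exact_mod_cast hkle⟩, ?_⟩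
    rw [div_eq_iff hq'.ne']; push_cast at hk'; linarith

lemma sum_Bset {d q : ℕ} (hq : 0 < q) (z : Fin d → ℤ) :
    ∑ v ∈ Bset d q, ee (∑ j, v j * z j) = if ∀ j, (q:ℤ) ∣ z j then (q:ℂ) ^ d else 0 := by
  have hq' : (q:ℝ) ≠ 0 := by positivity
  unfold Bset
  simp only [ee_sum]
  rw [← Finset.prod_univ_sum (fun _ => (Finset.Icc 1 q).image fun b : ℕ => (b : ℝ) / q)
    (fun j x => ee (x * z j))]
  have : ∀ j, ∑ x ∈ (Finset.Icc 1 q).image (fun b : ℕ => (b : ℝ) / q), ee (x * z j) =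
      if (q:ℤ) ∣ z j then (q:ℂ) else 0 := by
    intro j
    rw [Finset.sum_image, sum_ee q hq]
    intro a _ b _ hab
    have : (a:ℝ) = b := by
      have := congrArg (· * (q:ℝ)) hab
      simpa [hq'] using this
    exact_mod_cast this
  simp only [this]
  split_ifs with h
  · rw [Finset.prod_congr rfl (fun j _ => if_pos (h j))]; simp
  · push Not at h
    obtain ⟨j, hj⟩ := h
    exact Finset.prod_eq_zero (Finset.mem_univ j) (if_neg hj)

section moduli
variable {ι : Type} [Fintype ι] [DecidableEq ι] (m : ι → ℕ) (Q : ℕ)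

/-- `q_S` -/
def qS (S : Finset ι) : ℕ := Q * ∏ i ∈ S, m i

variable {m Q}

lemma qS_pos (hm : ∀ i, 0 < m i) (hQ : 0 < Q) (S : Finset ι) : 0 < qS m Q S :=
  Nat.mul_pos hQ (Finset.prod_pos fun i _ => hm i)

lemma IsI.of_dvd {d : ℕ} {v : Fin d → ℝ} {a b : ℤ} (h : a ∣ b) (ha : IsI a v) : IsI b v := by
  intro j
  obtain ⟨c, rfl⟩ := h
  obtain ⟨k, hk⟩ := ha j
  exact ⟨c * k, by push_cast; rw [← hk]; ring⟩

lemma IsI.of_coprime {d : ℕ} {v : Fin d → ℝ} {n a b : ℤ} (h : IsCoprime a b) (h1 : IsI (n * a) v)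
    (h2 : IsI (n * b) v) : IsI n v := by
  intro j
  obtain ⟨s, t, hst⟩ := h
  obtain ⟨k, hk⟩ := h1 j
  obtain ⟨l, hl⟩ := h2 j
  refine ⟨s * k + t * l, ?_⟩
  have : (s:ℝ) * a + t * b = 1 := by exact_mod_cast hst
  push_cast at hk hl ⊢
  rw [← hk, ← hl]
  linear_combination (-(n:ℝ) * v j) * this

open Classical in
/-- the minimal set for `v` -/
noncomputable def S0 {d : ℕ} (m : ι → ℕ) (Q : ℕ) (v : Fin d → ℝ) : Finset ι :=
  Finset.univ.filter fun i => ¬ IsI (qS m Q (Finset.univ.erase i) : ℤ) v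

lemma IsI_iff {d : ℕ} {v : Fin d → ℝ} (hcop : Pairwise fun i j => Nat.Coprime (m i) (m j))
    (hv : IsI (qS m Q Finset.univ : ℤ) v) (S : Finset ι) :
    IsI (qS m Q S : ℤ) v ↔ S0 m Q v ⊆ S := by
  constructor
  · intro h i hi
    by_contra hiS
    simp only [S0, Finset.mem_filter, Finset.mem_univ, true_and] at hi
    apply hi
    refine h.of_dvd ?_
    have : qS m Q S ∣ qS m Q (Finset.univ.erase i) := by
      apply Nat.mul_dvd_mul_left
      apply Finset.prod_dvd_prod_of_subset
      intro j hj
      rw [Finset.mem_erase]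
      exact ⟨fun e => hiS (e ▸ hj), Finset.mem_univ _⟩
    exact_mod_cast this
  · intro h
    have key : ∀ R : Finset ι, Disjoint R (S0 m Q v) → IsI (qS m Q Rᶜ : ℤ) v := by
      intro R
      induction R using Finset.induction_on with
      | empty => intro _; simpa using hv
      | insert i R hiR ih =>
        intro hd
        rw [Finset.disjoint_insert_left] at hd
        have h1 := ih hd.2
        have h2 : IsI (qS m Q (Finset.univ.erase i) : ℤ) v := by
          by_contra hc
          apply hd.1
          simp only [S0, Finset.mem_filter, Finset.mem_univ, true_and]; exact hc
        have e1 : qS m Q Rᶜ = qS m Q (insert i R)ᶜ * m i := by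
          unfold qS
          have : Rᶜ = insert i (insert i R)ᶜ := by
            ext j; simp only [Finset.mem_compl, Finset.mem_insert]
            by_cases hj : j = i
            · subst hj; simp [hiR]
            · simp [hj]
          rw [this, Finset.prod_insert (by simp)]; ring
        have e2 : qS m Q (Finset.univ.erase i) = qS m Q (insert i R)ᶜ * ∏ j ∈ R, m j := by
          unfold qS
          rw [mul_assoc, ← Finset.prod_union]
          · congr 2
            ext j; simp only [Finset.mem_compl, Finset.mem_insert, Finset.mem_erase, Finset.mem_union]
            by_cases hj : j = i
            · subst hj; simp [hiR]
            · simp [hj]; tauto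
          · rw [Finset.disjoint_left]; intro j hj hjR; simp at hj; exact hj.2 hjR
        rw [e1] at h1
        rw [e2] at h2
        push_cast at h1 h2
        refine IsI.of_coprime (a := m i) (b := ∏ j ∈ R, (m j : ℤ)) ?_ h1 h2
        refine IsCoprime.prod_right fun j hj => ?_
        rw [Nat.isCoprime_iff_coprime]
        exact hcop (fun e => hiR (e ▸ hj))
    have := key Sᶜ (by
      rw [Finset.disjoint_left]; intro j hj hj2; simp at hj; exact hj (h hj2))
    simpa using this

/-- the finite set of frequencies -/
noncomputable def Uf (d D : ℕ) (m : ι → ℕ) (Q : ℕ) : Finset (Fin d → ℝ) :=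
  (Bset d (qS m Q Finset.univ)).filter fun v => (S0 m Q v).card ≤ D

/-- the kernel `κ` -/
noncomputable def kap (d D : ℕ) (m : ι → ℕ) (Q : ℕ) (z : Fin d → ℤ) : ℝ :=
  (if ∀ j, (Q:ℤ) ∣ z j then (Q:ℝ) ^ d else 0) *
    ∑ S ∈ Finset.univ.filter (fun S : Finset ι => S.card ≤ D),
      ∏ i ∈ S, ((if ∀ j, (m i : ℤ) ∣ z j then (m i : ℝ) ^ d else 0) - 1)

lemma qS_dvd_univ (S : Finset ι) : qS m Q S ∣ qS m Q Finset.univ :=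
  Nat.mul_dvd_mul_left _ (Finset.prod_dvd_prod_of_subset _ _ _ (Finset.subset_univ _))

lemma Bset_filter {d : ℕ} (hm : ∀ i, 0 < m i) (hQ : 0 < Q)
    (hcop : Pairwise fun i j => Nat.Coprime (m i) (m j)) (S : Finset ι) :
    Bset d (qS m Q S) = (Bset d (qS m Q Finset.univ)).filter fun v => S0 m Q v ⊆ S := by
  ext v
  rw [Finset.mem_filter, mem_Bset (qS_pos hm hQ _), mem_Bset (qS_pos hm hQ _)]
  constructor
  · rintro ⟨h1, h2⟩
    have h3 : IsI (qS m Q Finset.univ : ℤ) v := h2.of_dvd (by exact_mod_cast qS_dvd_univ S)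
    exact ⟨⟨h1, h3⟩, (IsI_iff hcop h3 S).1 h2⟩
  · rintro ⟨⟨h1, h2⟩, h3⟩
    exact ⟨h1, (IsI_iff hcop h2 S).2 h3⟩

lemma dvd_qS_iff (hcop : Pairwise fun i j => Nat.Coprime (m i) (m j))
    (hcQ : ∀ i, Nat.Coprime Q (m i)) (S : Finset ι) (z : ℤ) :
    ((qS m Q S : ℕ) : ℤ) ∣ z ↔ (Q:ℤ) ∣ z ∧ ∀ i ∈ S, (m i : ℤ) ∣ z := by
  unfold qS
  push_cast
  constructor
  · intro h
    exact ⟨(Dvd.intro _ rfl).trans h, fun i hi =>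
      ((Finset.dvd_prod_of_mem (fun i => (m i : ℤ)) hi).trans (Dvd.intro_left _ rfl)).trans h⟩
  · rintro ⟨h1, h2⟩
    refine IsCoprime.mul_dvd ?_ h1 ?_
    · exact IsCoprime.prod_right fun i _ => Nat.isCoprime_iff_coprime.2 (hcQ i)
    · refine Finset.prod_dvd_of_coprime ?_ h2
      intro i _ j _ hij
      exact Nat.isCoprime_iff_coprime.2 (hcop hij)

lemma qS_ind {d : ℕ} (hcop : Pairwise fun i j => Nat.Coprime (m i) (m j))
    (hcQ : ∀ i, Nat.Coprime Q (m i)) (S : Finset ι) (z : Fin d → ℤ) :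
    (if ∀ j, ((qS m Q S : ℕ) : ℤ) ∣ z j then ((qS m Q S : ℕ) : ℝ) ^ d else 0) =
      (if ∀ j, (Q:ℤ) ∣ z j then (Q:ℝ) ^ d else 0) *
        ∏ i ∈ S, (if ∀ j, (m i : ℤ) ∣ z j then (m i : ℝ) ^ d else 0) := by
  simp only [dvd_qS_iff hcop hcQ]
  by_cases h1 : ∀ j, (Q:ℤ) ∣ z j
  · by_cases h2 : ∀ i ∈ S, ∀ j, (m i : ℤ) ∣ z j
    · rw [if_pos (fun j => ⟨h1 j, fun i hi => h2 i hi j⟩), if_pos h1,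
        Finset.prod_congr rfl (fun i hi => if_pos (h2 i hi)), Finset.prod_pow]
      unfold qS; push_cast; rw [mul_pow]
    · rw [if_neg (fun h => h2 fun i hi j => (h j).2 i hi)]
      push Not at h2
      obtain ⟨i, hi, j, hj⟩ := h2
      rw [Finset.prod_eq_zero hi (if_neg (fun h => hj (h j))), mul_zero]
  · rw [if_neg (fun h => h1 fun j => (h j).1), if_neg h1, zero_mul]

/-- **The exponential sum identity.** -/
lemma sum_Uf {d D : ℕ} (hm : ∀ i, 0 < m i) (hQ : 0 < Q)
    (hcop : Pairwise fun i j => Nat.Coprime (m i) (m j)) (hcQ : ∀ i, Nat.Coprime Q (m i))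
    (z : Fin d → ℤ) :
    ∑ v ∈ Uf d D m Q, ee (∑ j, v j * z j) = (kap d D m Q z : ℂ) := by
  set F : (Fin d → ℝ) → ℂ := fun v => ee (∑ j, v j * z j) with hF
  set B := Bset d (qS m Q Finset.univ) with hB
  set c : ℝ := (if ∀ j, (Q:ℤ) ∣ z j then (Q:ℝ) ^ d else 0) with hc
  set w : ι → ℝ := fun i => (if ∀ j, (m i : ℤ) ∣ z j then (m i : ℝ) ^ d else 0) with hw
  set σ : Finset ι → ℂ := fun S => ∑ v ∈ B.filter (fun v => S0 m Q v = S), F v with hσ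
  have h1 : ∀ S : Finset ι, ∑ T ∈ S.powerset, σ T = ((c * ∏ i ∈ S, w i : ℝ) : ℂ) := by
    intro S
    have e1 : ∑ T ∈ S.powerset, σ T = ∑ v ∈ B.filter (fun v => S0 m Q v ⊆ S), F v := by
      rw [← Finset.sum_fiberwise_of_maps_to (s := B.filter (fun v => S0 m Q v ⊆ S))
        (t := S.powerset) (g := S0 m Q) (fun v hv => Finset.mem_powerset.2 (Finset.mem_filter.1 hv).2)]
      refine Finset.sum_congr rfl fun T hT => ?_
      rw [Finset.filter_filter]
      refine Finset.sum_congr ?_ fun _ _ => rfl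
      ext v; simp only [Finset.mem_filter]
      rw [Finset.mem_powerset] at hT
      constructor
      · rintro ⟨a, b⟩; exact ⟨a, b ▸ hT, b⟩
      · rintro ⟨a, _, b⟩; exact ⟨a, b⟩
    rw [e1, ← Bset_filter hm hQ hcop, sum_Bset (qS_pos hm hQ S), hc, hw, ← qS_ind hcop hcQ S z]
    split_ifs <;> simp
  have h2 : ∀ S : Finset ι, σ S = ((c * ∏ i ∈ S, (w i - 1) : ℝ) : ℂ) := by
    intro S
    induction S using Finset.strongInduction with
    | H S ih =>
      have a1 := h1 S
      have a2 : ∏ i ∈ S, w i = ∑ T ∈ S.powerset, ∏ i ∈ T, (w i - 1) := by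
        have := Finset.prod_add_one (f := fun i => w i - 1) (s := S)
        simp only [sub_add_cancel] at this
        exact this
      rw [a2, Finset.mul_sum] at a1
      push_cast at a1
      rw [← Finset.insert_erase (Finset.mem_powerset_self S),
        Finset.sum_insert (Finset.notMem_erase _ _), Finset.sum_insert (Finset.notMem_erase _ _)] at a1
      have a3 : ∑ T ∈ S.powerset.erase S, σ T =
          ∑ T ∈ S.powerset.erase S, (c:ℂ) * ∏ i ∈ T, ((w i:ℂ) - 1) := by
        refine Finset.sum_congr rfl fun T hT => ?_
        rw [Finset.mem_erase, Finset.mem_powerset] at hT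
        rw [ih T (hT.2.ssubset_of_ne hT.1)]; push_cast; rfl
      rw [a3] at a1
      push_cast
      exact add_right_cancel a1
  have h3 : ∑ v ∈ Uf d D m Q, F v = ∑ S ∈ Finset.univ.filter (fun S : Finset ι => S.card ≤ D), σ S := by
    unfold Uf
    rw [← Finset.sum_fiberwise_of_maps_to (t := Finset.univ.filter (fun S : Finset ι => S.card ≤ D))
      (g := S0 m Q) (fun v hv => by simpa using (Finset.mem_filter.1 hv).2)]
    refine Finset.sum_congr rfl fun T hT => ?_
    rw [Finset.filter_filter]
    refine Finset.sum_congr ?_ fun _ _ => rfl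
    ext v; simp only [Finset.mem_filter]
    rw [Finset.mem_filter] at hT
    constructor
    · rintro ⟨a, _, b⟩; exact ⟨a, b⟩
    · rintro ⟨a, b⟩; exact ⟨a, b ▸ hT.2, b⟩
  rw [h3, Finset.sum_congr rfl fun S _ => h2 S]
  unfold kap
  rw [Finset.mul_sum]; push_cast; rfl

end moduli
end IW

open scoped BigOperators
set_option linter.unusedSectionVars false
set_option linter.unusedVariables false
namespace IW

/-- the finite set of primes -/
noncomputable def PP (ρ : ℝ) (N : ℕ) : Finset ℕ :=
  (Finset.Icc 1 N).filter fun p => p.Prime ∧ NzeroIW ρ N < p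

/-- the moduli -/
noncomputable def mm (ρ : ℝ) (N : ℕ) (i : PP ρ N) : ℕ := (i : ℕ) ^ DIW ρ

lemma mem_PP {ρ : ℝ} {N p : ℕ} : p ∈ PP ρ N ↔ p ∈ primesIW ρ N := by
  unfold PP primesIW
  simp only [Finset.mem_filter, Finset.mem_Icc, Set.mem_ofPred_eq]
  constructor
  · rintro ⟨⟨_, h1⟩, h2, h3⟩; exact ⟨h2, h3, h1⟩
  · rintro ⟨h2, h3, h1⟩; exact ⟨⟨h2.one_lt.le, h1⟩, h2, h3⟩

lemma PP_prime {ρ : ℝ} {N : ℕ} (i : PP ρ N) : (i : ℕ).Prime := (mem_PP.1 i.2).1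

lemma mm_pos {ρ : ℝ} {N : ℕ} (i : PP ρ N) : 0 < mm ρ N i := Nat.pow_pos (PP_prime i).pos

lemma Q_pos (ρ : ℝ) (N : ℕ) : 0 < QzeroIW ρ N := Nat.pow_pos (Nat.factorial_pos _)

lemma mm_cop {ρ : ℝ} {N : ℕ} : Pairwise fun i j => Nat.Coprime (mm ρ N i) (mm ρ N j) := by
  intro i j hij
  unfold mm
  apply Nat.Coprime.pow
  rw [Nat.coprime_primes (PP_prime i) (PP_prime j)]
  exact fun h => hij (Subtype.ext h)

lemma Q_cop {ρ : ℝ} {N : ℕ} (i : PP ρ N) : Nat.Coprime (QzeroIW ρ N) (mm ρ N i) := by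
  unfold mm QzeroIW
  apply Nat.Coprime.pow
  rw [Nat.coprime_comm, (PP_prime i).coprime_iff_not_dvd, (PP_prime i).dvd_factorial, not_le]
  exact (mem_PP.1 i.2).2.1

lemma dvd_primepow {D : ℕ} (P : Finset ℕ) (hP : ∀ p ∈ P, p.Prime) (w : ℕ) (hw : w ∣ ∏ p ∈ P, p ^ D) :
    ∃ γ : ℕ → ℕ, (∀ p, γ p ≤ D) ∧ w = ∏ p ∈ P, p ^ γ p := by
  induction P using Finset.induction_on generalizing w with
  | empty => exact ⟨fun _ => 0, by simp, by simpa using hw⟩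
  | insert a P ha ih =>
    rw [Finset.prod_insert ha, Nat.dvd_mul] at hw
    obtain ⟨x, y, hx, hy, rfl⟩ := hw
    obtain ⟨γ, hγ, rfl⟩ := ih (fun p hp => hP p (Finset.mem_insert_of_mem hp)) y hy
    obtain ⟨k, hk, rfl⟩ := (Nat.dvd_prime_pow (hP a (Finset.mem_insert_self _ _))).1 hx
    refine ⟨fun p => if p = a then k else γ p, ?_, ?_⟩
    · intro p; dsimp only; split_ifs; exacts [hk, hγ p]
    · rw [Finset.prod_insert ha]; simp only [if_true]
      congr 1
      refine Finset.prod_congr rfl fun p hp => ?_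
      rw [if_neg (fun e => ha (by rw [← e]; exact hp))]

lemma mem_Uf_iff {ρ : ℝ} {d N : ℕ} (v : Fin d → ℝ) :
    v ∈ Uf d (DIW ρ) (mm ρ N) (QzeroIW ρ N) ↔
      ∃ S : Finset (PP ρ N), S.card ≤ DIW ρ ∧ v ∈ Bset d (qS (mm ρ N) (QzeroIW ρ N) S) := by
  unfold Uf
  rw [Finset.mem_filter]
  constructor
  · rintro ⟨h1, h2⟩
    refine ⟨_, h2, ?_⟩
    rw [Bset_filter mm_pos (Q_pos _ _) mm_cop, Finset.mem_filter]
    exact ⟨h1, Finset.Subset.refl _⟩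
  · rintro ⟨S, h1, h2⟩
    rw [Bset_filter mm_pos (Q_pos _ _) mm_cop, Finset.mem_filter] at h2
    exact ⟨h2.1, (Finset.card_le_card h2.2).trans h1⟩

lemma PN_of_dvd {ρ : ℝ} {N : ℕ} (S : Finset (PP ρ N)) (hS : S.card ≤ DIW ρ) (q : ℕ)
    (hq : q ∣ qS (mm ρ N) (QzeroIW ρ N) S) : q ∈ PNIW ρ N := by
  unfold qS at hq
  rw [Nat.dvd_mul] at hq
  obtain ⟨Q, w, hQ, hw, rfl⟩ := hq
  refine ⟨Q, w, hQ, ?_, rfl⟩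
  have e : ∏ i ∈ S, mm ρ N i = ∏ p ∈ S.image Subtype.val, p ^ DIW ρ := by
    rw [Finset.prod_image (fun a _ b _ h => Subtype.ext h)]; rfl
  rw [e] at hw
  obtain ⟨γ, hγ, rfl⟩ := dvd_primepow _ (by
    intro p hp
    obtain ⟨i, _, rfl⟩ := Finset.mem_image.1 hp
    exact PP_prime i) w hw
  set T := (S.image Subtype.val).filter (fun p => γ p ≠ 0) with hT
  have hTe : ∏ p ∈ S.image Subtype.val, p ^ γ p = ∏ p ∈ T, p ^ γ p := by
    rw [hT, Finset.prod_filter]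
    refine Finset.prod_congr rfl fun p _ => ?_
    by_cases h : γ p = 0 <;> simp [h]
  rw [hTe]
  have hTc : T.card ≤ DIW ρ :=
    ((Finset.card_filter_le _ _).trans Finset.card_image_le).trans hS
  by_cases h0 : T.card = 0
  · right; rw [Finset.card_eq_zero.1 h0]; simp
  · left
    refine ⟨T.card, by omega, hTc, fun l => T.equivFin.symm l, fun l => γ (T.equivFin.symm l), ?_, ?_, ?_, ?_⟩
    · intro l
      obtain ⟨i, _, hi⟩ := Finset.mem_image.1 (Finset.mem_filter.1 (T.equivFin.symm l).2).1
      have := mem_PP.1 i.2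
      rw [hi] at this
      exact this
    · exact Subtype.val_injective.comp T.equivFin.symm.injective
    · intro l
      have := (Finset.mem_filter.1 (T.equivFin.symm l).2).2
      exact ⟨Nat.one_le_iff_ne_zero.2 this, hγ _⟩
    · rw [← Finset.prod_coe_sort T (fun p => p ^ γ p)]
      exact (Equiv.prod_comp T.equivFin.symm (fun x : T => (x:ℕ) ^ γ x)).symm

lemma dvd_of_PN {ρ : ℝ} {N : ℕ} (q : ℕ) (hq : q ∈ PNIW ρ N) :
    ∃ S : Finset (PP ρ N), S.card ≤ DIW ρ ∧ q ∣ qS (mm ρ N) (QzeroIW ρ N) S := by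
  obtain ⟨Q, w, hQ, hw, rfl⟩ := hq
  rcases hw with ⟨k, hk1, hk2, p, γ, hp, hinj, hγ, rfl⟩ | rfl
  · refine ⟨Finset.univ.image (fun l => (⟨p l, mem_PP.2 (hp l)⟩ : PP ρ N)), ?_, ?_⟩
    · exact Finset.card_image_le.trans (by simpa using hk2)
    · unfold qS
      refine Nat.mul_dvd_mul hQ ?_
      rw [Finset.prod_image]
      · exact Finset.prod_dvd_prod_of_dvd _ _ fun l _ => pow_dvd_pow _ (hγ l).2
      · intro a _ b _ h
        exact hinj (congrArg Subtype.val h)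
  · exact ⟨∅, by simp, by simpa [qS] using hQ⟩

lemma PN_pos {ρ : ℝ} {N q : ℕ} (hq : q ∈ PNIW ρ N) : 0 < q := by
  obtain ⟨S, _, h⟩ := dvd_of_PN q hq
  exact Nat.pos_of_dvd_of_pos h (qS_pos mm_pos (Q_pos _ _) _)

lemma UN_eq {ρ : ℝ} {d N : ℕ} (v : EuclideanSpace ℝ (Fin d)) :
    v ∈ UNIW ρ d N ↔ v.ofLp ∈ Uf d (DIW ρ) (mm ρ N) (QzeroIW ρ N) := by
  rw [mem_Uf_iff]
  constructor
  · rintro ⟨q, hq, a, ha, hv⟩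
    obtain ⟨S, hS, hd⟩ := dvd_of_PN q hq
    refine ⟨S, hS, ?_⟩
    have hq0 := PN_pos hq
    have : v.ofLp ∈ Bset d q := by
      unfold Bset
      rw [Fintype.mem_piFinset]
      intro j
      rw [hv]
      exact Finset.mem_image.2 ⟨a j, Finset.mem_Icc.2 (ha.1 j), rfl⟩
    rw [mem_Bset hq0] at this
    rw [mem_Bset (qS_pos mm_pos (Q_pos _ _) _)]
    exact ⟨this.1, this.2.of_dvd (by exact_mod_cast hd)⟩
  · rintro ⟨S, hS, hv⟩
    have hq0 := qS_pos (mm_pos (ρ := ρ) (N := N)) (Q_pos ρ N) S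
    set q := qS (mm ρ N) (QzeroIW ρ N) S with hq
    unfold Bset at hv
    rw [Fintype.mem_piFinset] at hv
    simp only [Finset.mem_image, Finset.mem_Icc] at hv
    choose b hb hbv using hv
    set g := Nat.gcd q (Finset.univ.gcd b) with hg
    have hg0 : 0 < g := Nat.gcd_pos_of_pos_left _ hq0
    have hgq : g ∣ q := Nat.gcd_dvd_left _ _
    have hgb : ∀ j, g ∣ b j := fun j =>
      (Nat.gcd_dvd_right _ _).trans (Finset.gcd_dvd (Finset.mem_univ j))
    refine ⟨q / g, PN_of_dvd S hS _ (Nat.div_dvd_of_dvd hgq), fun j => b j / g, ⟨?_, ?_⟩, ?_⟩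
    · intro j
      constructor
      · exact Nat.div_pos (Nat.le_of_dvd (hb j).1 (hgb j)) hg0
      · exact Nat.div_le_div_right (hb j).2
    · by_contra hne
      set t := Nat.gcd (q / g) (Finset.univ.gcd fun j => b j / g) with ht
      have h1 : g * t ∣ q := by
        have : t ∣ q / g := Nat.gcd_dvd_left _ _
        have := Nat.mul_dvd_mul_left g this
        rwa [Nat.mul_div_cancel' hgq] at this
      have h2 : ∀ j, g * t ∣ b j := by
        intro j
        have : t ∣ b j / g := (Nat.gcd_dvd_right _ _).trans
          (Finset.gcd_dvd (f := fun j => b j / g) (Finset.mem_univ j))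
        have := Nat.mul_dvd_mul_left g this
        rwa [Nat.mul_div_cancel' (hgb j)] at this
      have h3 : g * t ∣ g := Nat.dvd_gcd h1 (Finset.dvd_gcd fun j _ => h2 j)
      have h4 := Nat.le_of_dvd hg0 h3
      have h5 : 0 < t := Nat.gcd_pos_of_pos_left _ (Nat.div_pos (Nat.le_of_dvd hq0 hgq) hg0)
      have : 2 ≤ t := by omega
      nlinarith
    · funext j
      rw [← hbv j]
      have hgr : (g:ℝ) ≠ 0 := by positivity
      rw [Nat.cast_div (hgb j) hgr, Nat.cast_div hgq hgr]
      field_simp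
end IW

open scoped BigOperators
set_option linter.unusedSectionVars false
set_option linter.unusedVariables false
namespace IW

lemma size_qS (ρ : ℝ) (hρ : 0 < ρ) (n : ℕ) : ∃ N₁ : ℕ, 1 ≤ N₁ ∧ ∀ N ≥ N₁, ∀ S : Finset (PP ρ N),
    S.card ≤ n → (qS (mm ρ N) (QzeroIW ρ N) S : ℝ) ≤ Real.exp ((N:ℝ) ^ (2 * ρ)) := by
  set D := DIW ρ with hD
  set K : ℝ := D * 4 + n * D / ρ with hK
  obtain ⟨N₁, hN₁⟩ := Filter.eventually_atTop.1
    (((tendsto_rpow_atTop hρ).comp tendsto_natCast_atTop_atTop).eventually_ge_atTop K)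
  refine ⟨max N₁ 1, le_max_right _ _, ?_⟩
  intro N hN S hS
  have hNK : K ≤ (N:ℝ) ^ ρ := hN₁ N ((le_max_left _ _).trans hN)
  have hN1 : 1 ≤ N := (le_max_right _ _).trans hN
  have hN1' : (1:ℝ) ≤ N := by exact_mod_cast hN1
  have hpos : (0:ℝ) < qS (mm ρ N) (QzeroIW ρ N) S := by
    exact_mod_cast qS_pos mm_pos (Q_pos ρ N) S
  rw [← Real.log_le_iff_le_exp hpos]
  -- bound for Q
  have hN0 : (NzeroIW ρ N : ℝ) ≤ 2 * (N:ℝ) ^ (ρ/2) := by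
    unfold NzeroIW
    have h1 : ((⌊(N:ℝ) ^ (ρ/2)⌋₊ : ℕ) : ℝ) ≤ (N:ℝ) ^ (ρ/2) := Nat.floor_le (by positivity)
    have h2 : 1 ≤ (N:ℝ) ^ (ρ/2) := Real.one_le_rpow hN1' (by positivity)
    push_cast; linarith
  have hN0pos : (0:ℝ) < NzeroIW ρ N := by unfold NzeroIW; positivity
  have hQ : Real.log (QzeroIW ρ N) ≤ D * (4 * (N:ℝ) ^ ρ) := by
    unfold QzeroIW
    push_cast
    rw [Real.log_pow]
    refine mul_le_mul_of_nonneg_left ?_ (by positivity)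
    have h1 : ((NzeroIW ρ N).factorial : ℝ) ≤ (NzeroIW ρ N : ℝ) ^ (NzeroIW ρ N) := by
      exact_mod_cast Nat.factorial_le_pow _
    have h2 := Real.log_le_log (by exact_mod_cast Nat.factorial_pos _) h1
    rw [Real.log_pow] at h2
    have h3 : Real.log (NzeroIW ρ N) ≤ NzeroIW ρ N := Real.log_le_self hN0pos.le
    have h4 : ((N:ℝ) ^ (ρ/2)) ^ 2 = (N:ℝ) ^ ρ := by
      rw [← Real.rpow_natCast, ← Real.rpow_mul (by positivity)]; congr 1; push_cast; ring
    nlinarith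
  have hP : Real.log (∏ i ∈ S, (mm ρ N i : ℝ)) ≤ n * (D * ((N:ℝ) ^ ρ / ρ)) := by
    rw [Real.log_prod (fun i _ => by have := mm_pos i; positivity)]
    have hb : ∀ i ∈ S, Real.log (mm ρ N i : ℝ) ≤ D * ((N:ℝ) ^ ρ / ρ) := by
      intro i _
      unfold mm
      push_cast
      rw [Real.log_pow]
      refine mul_le_mul_of_nonneg_left ?_ (by positivity)
      have hi := mem_PP.1 i.2
      have h1 : ((i:ℕ):ℝ) ≤ N := by exact_mod_cast hi.2.2
      have h0 : (0:ℝ) < (i:ℕ) := by exact_mod_cast hi.1.pos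
      exact (Real.log_le_log h0 h1).trans (Real.log_le_rpow_div (by positivity) hρ)
    refine (Finset.sum_le_card_nsmul _ _ _ hb).trans ?_
    rw [nsmul_eq_mul]
    refine mul_le_mul_of_nonneg_right (by exact_mod_cast hS) (by positivity)
  unfold qS
  push_cast
  rw [Real.log_mul (by have := Q_pos ρ N; positivity)
    (Finset.prod_ne_zero_iff.2 fun i _ => by have := mm_pos i; positivity)]
  have e : (N:ℝ) ^ (2 * ρ) = (N:ℝ) ^ ρ * (N:ℝ) ^ ρ := by
    rw [two_mul, Real.rpow_add (by positivity)]
  rw [e]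
  have h5 : K * (N:ℝ) ^ ρ ≤ (N:ℝ) ^ ρ * (N:ℝ) ^ ρ := mul_le_mul_of_nonneg_right hNK (by positivity)
  refine (add_le_add hQ hP).trans (le_trans (le_of_eq ?_) h5)
  rw [hK]; ring
end IW

open scoped BigOperators
set_option linter.unusedSectionVars false
set_option linter.unusedVariables false
namespace IW
open MeasureTheory
open scoped FourierTransform ContDiff

lemma ee_exp (t : ℝ) : Complex.exp (((2 * Real.pi * t : ℝ) : ℂ) * Complex.I) = ee t := by
  unfold ee; congr 1; push_cast; ring

lemma ee_exp_neg (t : ℝ) : Complex.exp (((-2 * Real.pi * t : ℝ) : ℂ) * Complex.I) = ee (-t) := by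
  unfold ee; congr 1; push_cast; ring

lemma continuous_ee : Continuous ee := by unfold ee; fun_prop

lemma star_ee (t : ℝ) : (starRingEnd ℂ) (ee t) = ee (-t) := by
  unfold ee; rw [← Complex.exp_conj]; congr 1; simp [Complex.conj_ofNat]

/-- 1D bump -/
noncomputable def b0 : ContDiffBump (0:ℝ) := ⟨1/8, 1/4, by norm_num, by norm_num⟩

lemma b0_neg (x : ℝ) : b0 (-x) = b0 x := b0.neg x

lemma b0_pos {x : ℝ} (h : |x| < 1/4) : 0 < b0 x := b0.pos_of_mem_ball (by simpa [b0] using h)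
lemma b0_zero {x : ℝ} (h : 1/4 ≤ |x|) : b0 x = 0 := b0.zero_of_le_dist (by simpa [b0] using h)
lemma b0_nonneg (x : ℝ) : 0 ≤ b0 x := b0.nonneg

noncomputable def bb (x : ℝ) : ℝ := ∫ t, b0 t * b0 (x - t)

lemma bb_eq_conv : bb = convolution (fun x => b0 x) (fun x => b0 x) (ContinuousLinearMap.mul ℝ ℝ) volume := by
  funext x; simp [bb, convolution]

lemma bb_smooth : ContDiff ℝ ∞ bb := by
  rw [bb_eq_conv]
  exact b0.hasCompactSupport.contDiff_convolution_left _ b0.contDiff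
    b0.continuous.locallyIntegrable

lemma bb_pos {x : ℝ} (h : |x| < 1/2) : 0 < bb x := by
  have hc : Continuous fun t => b0 t * b0 (x - t) := by
    have := b0.continuous; fun_prop
  refine Continuous.integral_pos_of_hasCompactSupport_nonneg_nonzero (x := x/2) hc ?_ ?_ ?_
  · exact b0.hasCompactSupport.mul_right
  · intro t; exact mul_nonneg (b0_nonneg _) (b0_nonneg _)
  · have h1 : |x/2| < 1/4 := by rw [abs_div, abs_two]; linarith
    have : x - x/2 = x/2 := by ring
    rw [this]; exact (mul_pos (b0_pos h1) (b0_pos h1)).ne'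

lemma bb_zero {x : ℝ} (h : 1/2 ≤ |x|) : bb x = 0 := by
  unfold bb
  refine integral_eq_zero_of_ae (Filter.Eventually.of_forall fun t => ?_)
  show b0 t * b0 (x - t) = 0
  by_cases h1 : 1/4 ≤ |t|
  · simp [b0_zero h1]
  · have : 1/4 ≤ |x - t| := by
      push Not at h1
      have := abs_sub_abs_le_abs_sub x t
      linarith
    simp [b0_zero this]

noncomputable def b0c (x : ℝ) : ℂ := (b0 x : ℂ)

lemma b0c_int : Integrable b0c := by
  apply Continuous.integrable_of_hasCompactSupport
  · unfold b0c; have := b0.continuous; fun_prop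
  · exact b0.hasCompactSupport.comp_left (g := fun x : ℝ => (x:ℂ)) (by simp)

lemma fb_real (s : ℝ) : (starRingEnd ℂ) (𝓕 b0c s) = 𝓕 b0c s := by
  rw [Real.fourier_eq', ← integral_conj, ← integral_neg_eq_self]
  congr 1; funext v
  simp only [b0c, smul_eq_mul, map_mul, Complex.conj_ofReal, b0_neg, inner_neg_left]
  congr 1
  rw [← Complex.exp_conj]; congr 1
  simp [Complex.conj_ofNat]

lemma bb_fourier (s : ℝ) : 𝓕 (fun x => (bb x : ℂ)) s = 𝓕 b0c s * 𝓕 b0c s := by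
  rw [← Real.fourier_mul_convolution_eq b0c_int b0c_int]
  refine congrFun (congrArg _ (funext fun x => ?_)) s
  simp only [bb, convolution, ContinuousLinearMap.mul_apply', b0c]
  rw [← integral_complex_ofReal]; push_cast; rfl

/-- normalised -/
noncomputable def BB (x : ℝ) : ℝ := bb x / bb 0

lemma bb0_pos : 0 < bb 0 := bb_pos (by simp)

noncomputable def kk (s : ℝ) : ℝ := (𝓕 b0c (-s)).re ^ 2 / bb 0

lemma kk_nonneg (s : ℝ) : 0 ≤ kk s := div_nonneg (sq_nonneg _) bb0_pos.le

lemma BB_smooth : ContDiff ℝ ∞ BB := by unfold BB; exact bb_smooth.div_const _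
lemma BB_zero {x : ℝ} (h : 1/2 ≤ |x|) : BB x = 0 := by simp [BB, bb_zero h]
lemma BB_pos {x : ℝ} (h : |x| < 1/2) : 0 < BB x := div_pos (bb_pos h) bb0_pos
lemma BB_one : BB 0 = 1 := div_self bb0_pos.ne'

lemma BB_compact : HasCompactSupport BB := by
  refine HasCompactSupport.intro (isCompact_closedBall (0:ℝ) (1/2)) fun x hx => BB_zero ?_
  simp at hx; linarith

lemma kk_eq (s : ℝ) : ∫ x, ee (x * s) * (BB x : ℂ) = (kk s : ℂ) := by
  have h1 : 𝓕 (fun x => (bb x : ℂ)) (-s) = ∫ x, ee (x * s) * (bb x:ℂ) := by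
    rw [Real.fourier_eq']
    congr 1; funext x
    rw [ee_exp_neg]; simp [mul_comm]
  have h2 : ∀ x, ee (x * s) * (BB x : ℂ) = (ee (x * s) * (bb x:ℂ)) * ((bb 0 : ℂ))⁻¹ := by
    intro x; unfold BB; push_cast; ring
  simp only [h2]
  rw [integral_mul_const, ← h1, bb_fourier]
  obtain ⟨r, hr⟩ := Complex.conj_eq_iff_real.1 (fb_real (-s))
  unfold kk
  rw [hr]
  push_cast; simp; ring

lemma scaled (τ : ℝ) (hτ : 0 < τ) (s : ℝ) :
    ∫ x, ee (x * s) * (BB (x/τ) : ℂ) = ((τ * kk (τ * s) : ℝ) : ℂ) := by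
  have := MeasureTheory.Measure.integral_comp_div (fun x => ee (x * (τ * s)) * (BB x : ℂ)) τ
  rw [kk_eq, abs_of_pos hτ] at this
  push_cast
  rw [Complex.real_smul] at this
  rw [← this]
  congr 1; funext x
  congr 2
  field_simp

lemma kk_poisson (τ : ℝ) (hτ : 0 < τ) (hτ1 : τ ≤ 1) (s : ℝ) :
    HasSum (fun m : ℤ => τ * kk (τ * (s + m))) 1 := by
  have hcs : HasCompactSupport (fun x : ℝ => (BB (x/τ) : ℂ)) := by
    refine HasCompactSupport.intro (isCompact_closedBall (0:ℝ) (τ/2)) fun x hx => ?_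
    rw [BB_zero]; · simp
    simp at hx
    rw [abs_div, abs_of_pos hτ, le_div_iff₀ hτ]; linarith
  have hsm : ContDiff ℝ ∞ (fun x : ℝ => (BB (x/τ) : ℂ)) := by
    have := BB_smooth
    exact Complex.ofRealCLM.contDiff.comp (this.comp (contDiff_id.div_const τ))
  let Bt : SchwartzMap ℝ ℂ := hcs.toSchwartzMap hsm
  have hBt : ∀ x, Bt x = (BB (x/τ) : ℂ) := fun x => rfl
  let g : SchwartzMap ℝ ℂ := 𝓕⁻ Bt
  have hg : ∀ s, g s = ((τ * kk (τ * s) : ℝ) : ℂ) := by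
    intro s
    have : g s = 𝓕⁻ (Bt : ℝ → ℂ) s := by rw [← SchwartzMap.fourierInv_coe]
    rw [this, Real.fourierInv_eq', ← scaled τ hτ]
    congr 1; funext x
    rw [ee_exp]; simp [hBt, mul_comm]
  have hFg : 𝓕 g = Bt := FourierInvPair.fourier_fourierInv_eq Bt
  have hP := SchwartzMap.tsum_eq_tsum_fourier g s
  rw [hFg] at hP
  rw [tsum_eq_single (f := fun n : ℤ => Bt n * (fourier n) (s : UnitAddCircle)) 0] at hP
  · simp only [hBt, hg] at hP
    simp [BB_one] at hP
    have hsum : Summable (fun m : ℤ => ((τ * kk (τ * (s + m)) : ℝ) : ℂ)) := by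
      by_contra hn
      have h0 := tsum_eq_zero_of_not_summable hn
      push_cast at h0
      rw [h0] at hP; exact zero_ne_one hP
    have := hsum.hasSum
    push_cast at this
    rw [hP] at this
    apply Complex.hasSum_ofReal.1
    push_cast; exact this
  · intro n hn
    rw [hBt, BB_zero]; · simp
    rw [abs_div, abs_of_pos hτ, le_div_iff₀ hτ]
    have : (1:ℝ) ≤ |(n:ℝ)| := by exact_mod_cast Int.one_le_abs hn
    linarith
end IW

open scoped BigOperators
set_option linter.unusedSectionVars false
set_option linter.unusedVariables false
namespace IW
open MeasureTheory
open scoped FourierTransform ContDiff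

abbrev EE (d : ℕ) := EuclideanSpace ℝ (Fin d)

/-- integer points -/
noncomputable def zE {d : ℕ} (x : Fin d → ℤ) : EE d := WithLp.toLp 2 fun i => (x i : ℝ)

@[simp] lemma zE_apply {d : ℕ} (x : Fin d → ℤ) (i : Fin d) : zE x i = (x i : ℝ) := rfl

lemma inner_EE {d : ℕ} (a b : EE d) : inner ℝ a b = ∑ j, a j * b j := by
  rw [PiLp.inner_apply]; exact Finset.sum_congr rfl fun i _ => by simp [mul_comm]

lemma fourier_EE {d : ℕ} (f : EE d → ℂ) (w : EE d) :
    𝓕 f w = ∫ v, ee (-(∑ j, v j * w j)) * f v := by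
  rw [Real.fourier_eq']; congr 1; funext v; rw [ee_exp_neg, inner_EE]; rfl

lemma fourierInv_EE {d : ℕ} (f : EE d → ℂ) (w : EE d) :
    𝓕⁻ f w = ∫ v, ee (∑ j, v j * w j) * f v := by
  rw [Real.fourierInv_eq']; congr 1; funext v; rw [ee_exp, inner_EE]; rfl

lemma integral_prod_EE {d : ℕ} (f : Fin d → ℝ → ℂ) :
    ∫ v : EE d, ∏ i, f i (v i) = ∏ i, ∫ x, f i x := by
  rw [← integral_fintype_prod_volume_eq_prod]
  exact (PiLp.volume_preserving_ofLp (Fin d)).integral_comp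
    (MeasurableEquiv.toLp 2 (Fin d → ℝ)).symm.measurableEmbedding (fun v => ∏ i, f i (v i))

section kernel
variable {d : ℕ} (e : Fin d → ℝ)

/-- Fourier side of the kernel -/
noncomputable def Kh (θ : EE d) : ℝ := ∏ i, BB (θ i / e i)
/-- physical side of the kernel -/
noncomputable def Kr (t : EE d) : ℝ := ∏ i, (e i * kk (e i * t i))

lemma Kr_nonneg (he : ∀ i, 0 < e i) (t : EE d) : 0 ≤ Kr e t :=
  Finset.prod_nonneg fun i _ => mul_nonneg (he i).le (kk_nonneg _)

lemma Kh_int (he : ∀ i, 0 < e i) (t : EE d) :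
    ∫ θ : EE d, ee (∑ j, θ j * t j) * (Kh e θ : ℂ) = (Kr e t : ℂ) := by
  have h : ∀ θ : EE d, ee (∑ j, θ j * t j) * (Kh e θ : ℂ) =
      ∏ i, (fun x : ℝ => ee (x * t i) * (BB (x / e i) : ℂ)) (θ i) := by
    intro θ; rw [ee_sum, Kh]; push_cast; rw [← Finset.prod_mul_distrib]
  simp only [h]
  rw [integral_prod_EE (fun i x => ee (x * t i) * (BB (x / e i) : ℂ))]
  rw [Kr]; push_cast
  refine Finset.prod_congr rfl fun i _ => ?_
  rw [scaled _ (he i)]; push_cast; rfl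

lemma Kh_smooth : ContDiff ℝ ∞ (Kh e) := by
  unfold Kh
  refine contDiff_prod fun i _ => ?_
  refine BB_smooth.comp ?_
  fun_prop

lemma Kh_zero (he : ∀ i, 0 < e i) {θ : EE d} {i : Fin d} (h : e i / 2 ≤ |θ i|) : Kh e θ = 0 := by
  refine Finset.prod_eq_zero (Finset.mem_univ i) (BB_zero ?_)
  rw [abs_div, abs_of_pos (he i), le_div_iff₀ (he i)]; linarith

lemma compact_box (r : Fin d → ℝ) : IsCompact {θ : EE d | ∀ i, |θ i| ≤ r i} := by
  have : {θ : EE d | ∀ i, |θ i| ≤ r i} = (EuclideanSpace.equiv (Fin d) ℝ).toHomeomorph ⁻¹'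
      (Set.pi Set.univ fun i => Set.Icc (-r i) (r i)) := by
    ext θ; simp only [Set.mem_ofPred_eq, abs_le, Set.mem_preimage, Set.mem_pi, Set.mem_univ, true_imp_iff, Set.mem_Icc]; rfl
  rw [this, Homeomorph.isCompact_preimage]
  exact isCompact_univ_pi fun i => isCompact_Icc

lemma Kh_compact (he : ∀ i, 0 < e i) : HasCompactSupport (Kh e) := by
  refine HasCompactSupport.intro (compact_box (fun i => e i / 2)) fun x hx => ?_
  simp only [Set.mem_ofPred_eq, not_forall, not_le] at hx
  obtain ⟨i, hi⟩ := hx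
  exact Kh_zero e he hi.le

lemma Kh_one (θ : EE d) (h : θ = 0) : Kh e θ = 1 := by subst h; simp [Kh, BB_one]

lemma Khc_compact (he : ∀ i, 0 < e i) : HasCompactSupport (fun θ => (Kh e θ : ℂ)) :=
  (Kh_compact e he).comp_left (g := fun x : ℝ => (x:ℂ)) (by simp)

lemma Khc_smooth : ContDiff ℝ ∞ (fun θ => (Kh e θ : ℂ)) :=
  Complex.ofRealCLM.contDiff.comp (Kh_smooth e)

/-- the kernel as a Schwartz function -/
noncomputable def KS (he : ∀ i, 0 < e i) : SchwartzMap (EE d) ℂ :=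
  𝓕⁻ ((Khc_compact e he).toSchwartzMap (Khc_smooth e))

lemma KS_apply (he : ∀ i, 0 < e i) (t : EE d) : KS e he t = (Kr e t : ℂ) := by
  have : KS e he t = 𝓕⁻ (((Khc_compact e he).toSchwartzMap (Khc_smooth e) : SchwartzMap (EE d) ℂ) : EE d → ℂ) t := by
    rw [← SchwartzMap.fourierInv_coe]; rfl
  rw [this, fourierInv_EE, ← Kh_int e he]
  rfl

lemma KS_fourier (he : ∀ i, 0 < e i) : 𝓕 (KS e he) = (Khc_compact e he).toSchwartzMap (Khc_smooth e) :=
  FourierInvPair.fourier_fourierInv_eq _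

lemma Kr_fourier (he : ∀ i, 0 < e i) (θ : EE d) : 𝓕 (fun t => (Kr e t : ℂ)) θ = (Kh e θ : ℂ) := by
  have h : (fun t => (Kr e t : ℂ)) = KS e he := funext fun t => (KS_apply e he t).symm
  rw [h, ← SchwartzMap.fourier_coe, KS_fourier]; rfl

lemma Kr_continuous (he : ∀ i, 0 < e i) : Continuous (Kr e) := by
  have h : Kr e = fun t => (KS e he t).re := funext fun t => by rw [KS_apply]; simp
  rw [h]; exact Complex.continuous_re.comp (KS e he).continuous

lemma Kr_integrable (he : ∀ i, 0 < e i) : Integrable (Kr e) := by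
  have h : Kr e = fun t => (KS e he t).re := funext fun t => by rw [KS_apply]; simp
  rw [h]; exact (KS e he).integrable.re

lemma Kr_integral (he : ∀ i, 0 < e i) : ∫ t, Kr e t = 1 := by
  have h := Kr_fourier e he 0
  rw [fourier_EE, Kh_one e _ rfl] at h
  simp [ee_zero, integral_complex_ofReal] at h
  exact_mod_cast h

end kernel

lemma hasSum_pi (d : ℕ) (f : Fin d → ℤ → ℝ) (a : Fin d → ℝ) (hf : ∀ i x, 0 ≤ f i x)
    (h : ∀ i, HasSum (f i) (a i)) : HasSum (fun x : Fin d → ℤ => ∏ i, f i (x i)) (∏ i, a i) := by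
  induction d with
  | zero =>
    simp only [Finset.univ_eq_empty, Finset.prod_empty]
    exact hasSum_unique _
  | succ d ih =>
    rw [← (Fin.consEquiv (fun _ => ℤ)).hasSum_iff, Fin.prod_univ_succ]
    have h2 := ih (fun i => f i.succ) (fun i => a i.succ) (fun i x => hf _ x) (fun i => h _)
    have h3 : Summable (fun x : ℤ × (Fin d → ℤ) => f 0 x.1 * ∏ i : Fin d, f i.succ (x.2 i)) :=
      Summable.mul_of_nonneg (f := f 0) (g := fun y : Fin d → ℤ => ∏ i : Fin d, f i.succ (y i))
        (h 0).summable h2.summable (fun x => hf 0 x)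
        (fun x => Finset.prod_nonneg fun i _ => hf i.succ (x i))
    have := HasSum.mul (h 0) h2 h3
    have h4 : ((fun x : Fin (d+1) → ℤ => ∏ i, f i (x i)) ∘ (Fin.consEquiv (fun _ => ℤ))) =
        fun x : ℤ × (Fin d → ℤ) => f 0 x.1 * ∏ i : Fin d, f i.succ (x.2 i) := by
      funext x; simp [Fin.consEquiv, Fin.prod_univ_succ]
    rw [h4]; exact this

lemma poisson1 (e : ℝ) (he : 0 < e) (q : ℕ) (hq : 0 < q) (hqe : q * e ≤ 1) (t : ℝ) (c : ℤ) :
    HasSum (fun x : ℤ => if (q:ℤ) ∣ x - c then q * (e * kk (e * (t + x))) else 0) 1 := by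
  have hq' : (0:ℝ) < q := by exact_mod_cast hq
  have hP := kk_poisson (q * e) (by positivity) hqe ((t + c) / q)
  have hinj : Function.Injective (fun m : ℤ => c + q * m) := by
    intro a b hab
    have : q ≠ 0 := hq.ne'
    simpa [this] using hab
  rw [← hinj.hasSum_iff]
  · convert hP using 1
    funext m
    simp only [Function.comp]
    rw [if_pos (by simp)]
    rw [mul_assoc]; congr 3; push_cast; field_simp; ring
  · intro x hx
    rw [if_neg]
    rintro ⟨m, hm⟩
    exact hx ⟨m, by simp only; linarith⟩

lemma poissond {d : ℕ} (e : Fin d → ℝ) (he : ∀ i, 0 < e i) (q : ℕ) (hq : 0 < q)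
    (hqe : ∀ i, q * e i ≤ 1) (t : EE d) (c : Fin d → ℤ) :
    HasSum (fun x : Fin d → ℤ => if ∀ j, (q:ℤ) ∣ x j - c j then (q:ℝ)^d * Kr e (t + zE x) else 0) 1 := by
  have h := hasSum_pi d
    (fun i x => if (q:ℤ) ∣ x - c i then q * (e i * kk (e i * (t i + x))) else 0) (fun _ => 1) ?_
    (fun i => poisson1 (e i) (he i) q hq (hqe i) (t i) (c i))
  · convert h using 1
    · funext x
      split_ifs with h1
      · rw [Finset.prod_congr rfl fun i _ => if_pos (h1 i), Finset.prod_mul_distrib]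
        simp [Kr]
      · push Not at h1
        obtain ⟨i, hi⟩ := h1
        exact (Finset.prod_eq_zero (Finset.mem_univ i) (if_neg hi)).symm
    · simp
  · intro i x
    split_ifs
    · have := (he i).le; have := kk_nonneg (e i * (t i + x)); positivity
    · rfl
end IW

open scoped BigOperators
set_option linter.unusedSectionVars false
set_option linter.unusedVariables false
namespace IW
open MeasureTheory

section residues
variable {ι : Type} [Fintype ι] [DecidableEq ι]

/-- residues modulo `m i` -/
abbrev ZZ (d : ℕ) (m : ι → ℕ) (i : ι) : Type := Fin d → ZMod (m i)

/-- reduction of an integer vector modulo `q` -/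
def red {d : ℕ} (q : ℕ) (x : Fin d → ℤ) : Fin d → ZMod q := fun j => (x j : ZMod q)

/-- all reductions -/
def XX {d : ℕ} (m : ι → ℕ) (x : Fin d → ℤ) : ∀ i, ZZ d m i := fun i => red (m i) x

lemma red_eq_iff {d : ℕ} (q : ℕ) (x y : Fin d → ℤ) :
    red q x = red q y ↔ ∀ j, (q:ℤ) ∣ x j - y j := by
  rw [funext_iff]
  refine forall_congr' fun j => ?_
  unfold red
  rw [eq_comm, ZMod.intCast_eq_intCast_iff_dvd_sub]

/-- the weight at the base modulus -/
noncomputable def dQ {d : ℕ} (Q : ℕ) (a b : Fin d → ZMod Q) : ℝ :=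
  open Classical in if a = b then (Q:ℝ)^d else 0

lemma dQ_nonneg {d : ℕ} (Q : ℕ) (a b : Fin d → ZMod Q) : 0 ≤ dQ Q a b := by
  unfold dQ; split_ifs <;> positivity

lemma dQ_le {d : ℕ} (Q : ℕ) (a b : Fin d → ZMod Q) : dQ Q a b ≤ (Q:ℝ)^d := by
  unfold dQ; split_ifs <;> [rfl; positivity]

lemma card_ZZ {d q : ℕ} [NeZero q] : Fintype.card (Fin d → ZMod q) = q ^ d := by
  simp [ZMod.card]

lemma expect_dQ_mul {d : ℕ} (Q : ℕ) [NeZero Q] (a : Fin d → ZMod Q) (g : (Fin d → ZMod Q) → ℝ) :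
    𝔼 z, dQ Q a z * g z = g a := by
  classical
  have hc : (Q:ℝ) ^ d ≠ 0 := pow_ne_zero _ (by exact_mod_cast NeZero.ne Q)
  rw [Fintype.expect_eq_sum_div_card, card_ZZ]
  simp [dQ, hc]

variable {d : ℕ} (m : ι → ℕ) (Q : ℕ) [∀ i, NeZero (m i)] [NeZero Q]

lemma dl_eq (i : ι) (a b : ZZ d m i) :
    dl (Z := ZZ d m) a b = (open Classical in if a = b then (m i : ℝ)^d else 0) := by
  unfold dl
  simp [ZMod.card]

lemma crt_exists (hcop : Pairwise fun i j => Nat.Coprime (m i) (m j))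
    (hcQ : ∀ i, Nat.Coprime Q (m i)) (h0 : Fin d → ZMod Q) (z : ∀ i, ZZ d m i) :
    ∃ c : Fin d → ℤ, red Q c = h0 ∧ ∀ i, red (m i) c = z i := by
  have h : ∀ j : Fin d, ∃ k : ℕ, (k : ZMod Q) = h0 j ∧ ∀ i, (k : ZMod (m i)) = z i j := by
    intro j
    obtain ⟨k, hk⟩ := Nat.chineseRemainderOfFinset (fun i => (z i j).val) m Finset.univ
      (fun i _ => NeZero.ne _) (fun i _ i' _ h => hcop h)
    have hc : Nat.Coprime Q (∏ i, m i) := Nat.Coprime.prod_right fun i _ => hcQ i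
    obtain ⟨l, hl1, hl2⟩ := Nat.chineseRemainder hc (h0 j).val k
    refine ⟨l, ?_, fun i => ?_⟩
    · have := (ZMod.natCast_eq_natCast_iff _ _ _).2 hl1
      rw [this, ZMod.natCast_zmod_val]
    · have h1 : l ≡ k [MOD m i] := hl2.of_dvd (Finset.dvd_prod_of_mem m (Finset.mem_univ i))
      have := (ZMod.natCast_eq_natCast_iff _ _ _).2 (h1.trans (hk i (Finset.mem_univ i)))
      rw [this, ZMod.natCast_zmod_val]
  choose k hk1 hk2 using h
  refine ⟨fun j => k j, ?_, fun i => ?_⟩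
  · funext j; simp [red, hk1]
  · funext j; simp [red, hk2]

/-- the basic weight -/
noncomputable def wt (e : Fin d → ℝ) (t : EE d) (h0 : Fin d → ZMod Q) (x : Fin d → ℤ) : ℝ :=
  dQ Q (red Q x) h0 * Kr e (t + zE x)

lemma wt_nonneg (e : Fin d → ℝ) (he : ∀ i, 0 < e i) (t : EE d) (h0 : Fin d → ZMod Q)
    (x : Fin d → ℤ) : 0 ≤ wt Q e t h0 x := mul_nonneg (dQ_nonneg _ _ _) (Kr_nonneg e he _)

lemma wt_Dl (hcop : Pairwise fun i j => Nat.Coprime (m i) (m j))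
    (hcQ : ∀ i, Nat.Coprime Q (m i)) (e : Fin d → ℝ) (he : ∀ i, 0 < e i)
    (S : Finset ι) (hS : ∀ i, (qS m Q S : ℝ) * e i ≤ 1) (t : EE d) (h0 : Fin d → ZMod Q)
    (z : ∀ i, ZZ d m i) :
    HasSum (fun x => wt Q e t h0 x * Dl S (XX m x) z) 1 := by
  obtain ⟨c, hc0, hc⟩ := crt_exists m Q hcop hcQ h0 z
  have hm : ∀ i, 0 < m i := fun i => Nat.pos_of_ne_zero (NeZero.ne _)
  have hQ : 0 < Q := Nat.pos_of_ne_zero (NeZero.ne _)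
  have hP := poissond e he (qS m Q S) (qS_pos hm hQ S) hS t c
  convert hP using 1
  funext x
  have h1 := qS_ind hcop hcQ S (fun j => x j - c j)
  have h2 : wt Q e t h0 x * Dl S (XX m x) z =
    ((if ∀ j, (Q:ℤ) ∣ x j - c j then (Q:ℝ) ^ d else 0) *
        ∏ i ∈ S, (if ∀ j, (m i : ℤ) ∣ x j - c j then (m i : ℝ) ^ d else 0)) * Kr e (t + zE x) := by
    unfold wt Dl
    have e1 : dQ Q (red Q x) h0 = if ∀ j, (Q:ℤ) ∣ x j - c j then (Q:ℝ) ^ d else 0 := by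
      unfold dQ; rw [← hc0]
      exact if_congr (red_eq_iff _ _ _) rfl rfl
    have e2 : ∀ i, dl (XX m x i) (z i) = if ∀ j, (m i:ℤ) ∣ x j - c j then (m i:ℝ) ^ d else 0 := by
      intro i
      rw [dl_eq, ← hc i]
      exact if_congr (red_eq_iff _ _ _) rfl rfl
    rw [e1, Finset.prod_congr rfl fun i _ => e2 i]; ring
  rw [h2, ← h1]
  split_ifs <;> simp

lemma dep_expand (S : Finset ι) (ψ : (∀ i, ZZ d m i) → ℝ) (hψ : Dep ψ S) (a : ∀ i, ZZ d m i) :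
    ψ a = ∑ z, un (∀ i, ZZ d m i) z * (ψ z * Dl S a z) := by
  have h : ∀ z, ψ z * Dl S a z = ψ a * Dl S a z := by
    intro z
    by_cases h0 : Dl S a z = 0
    · simp [h0]
    · congr 1
      apply hψ
      intro i hi
      have h1 : dl (a i) (z i) ≠ 0 := fun h => h0 (Finset.prod_eq_zero hi h)
      rw [dl_eq] at h1
      by_contra hne
      exact h1 (if_neg fun h => hne h.symm)
  simp only [h]
  rw [← expect_eq_un, ← Finset.mul_expect, expect_Dl, mul_one]

lemma wt_LowDeg (hcop : Pairwise fun i j => Nat.Coprime (m i) (m j))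
    (hcQ : ∀ i, Nat.Coprime Q (m i)) (e : Fin d → ℝ) (he : ∀ i, 0 < e i) (n : ℕ)
    (hS : ∀ S : Finset ι, S.card ≤ n → ∀ i, (qS m Q S : ℝ) * e i ≤ 1) (t : EE d)
    (h0 : Fin d → ZMod Q) (ψ : (∀ i, ZZ d m i) → ℝ) (hψ : ψ ∈ LowDeg (ZZ d m) n) :
    HasSum (fun x => wt Q e t h0 x * ψ (XX m x)) (𝔼 h, ψ h) := by
  unfold LowDeg at hψ
  induction hψ using Submodule.span_induction with
  | mem ψ hψ =>
    obtain ⟨S, hSn, hdep⟩ := hψ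
    have h1 : ∀ z : ∀ i, ZZ d m i, HasSum (fun x => un (∀ i, ZZ d m i) z * (ψ z *
        (wt Q e t h0 x * Dl S (XX m x) z))) (un (∀ i, ZZ d m i) z * (ψ z * 1)) := fun z =>
      ((wt_Dl m Q hcop hcQ e he S (hS S hSn) t h0 z).mul_left _).mul_left _
    have h2 := hasSum_sum (s := Finset.univ) fun z _ => h1 z
    rw [expect_eq_un]
    convert h2 using 1
    · funext x
      rw [dep_expand m S ψ hdep (XX m x), Finset.mul_sum]
      exact Finset.sum_congr rfl fun z _ => by ring
    · simp
  | zero => simp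
  | add a b _ _ ha hb =>
    have := ha.add hb
    simp only [Pi.add_apply, mul_add, Finset.expect_add_distrib]
    exact this
  | smul c a _ ha =>
    have := ha.mul_left c
    simp only [Pi.smul_apply, smul_eq_mul, ← Finset.mul_expect]
    have h4 : (fun x => wt Q e t h0 x * (c * a (XX m x))) = fun x => c * (wt Q e t h0 x * a (XX m x)) := by
      funext x; ring
    rw [h4]; exact this

lemma wt_Dom (hcop : Pairwise fun i j => Nat.Coprime (m i) (m j))
    (hcQ : ∀ i, Nat.Coprime Q (m i)) (e : Fin d → ℝ) (he : ∀ i, 0 < e i) (n : ℕ)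
    (hS : ∀ S : Finset ι, S.card ≤ n → ∀ i, (qS m Q S : ℝ) * e i ≤ 1) (t : EE d)
    (h0 : Fin d → ZMod Q) (F : Finset (Fin d → ℤ)) :
    Dom (Z := ZZ d m) n (fun x : F => wt Q e t h0 x) (fun x : F => XX m (x : Fin d → ℤ)) := by
  refine ⟨fun x => wt_nonneg Q e he t h0 x, fun ψ hψ hpos => ?_⟩
  have h := wt_LowDeg m Q hcop hcQ e he n hS t h0 ψ hψ
  have := sum_le_hasSum F (fun x _ => mul_nonneg (wt_nonneg Q e he t h0 x) (hpos _)) h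
  refine le_trans (le_of_eq ?_) this
  exact Finset.sum_coe_sort F (fun x => wt Q e t h0 x * ψ (XX m x))

/-- `κ_H` -/
noncomputable def kH (D : ℕ) (x : Fin d → ℤ) (n : (Fin d → ZMod Q) × (∀ i, ZZ d m i)) : ℝ :=
  dQ Q (red Q x) n.1 * ∑ S ∈ Finset.univ.filter (fun S : Finset ι => S.card ≤ D), Phi S (XX m x) n.2

lemma un_prod (A B : Type) [Fintype A] [Fintype B] (g : A × B → ℝ) :
    ∑ n, un (A × B) n * g n = ∑ a, un A a * ∑ b, un B b * g (a, b) := by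
  rw [Fintype.sum_prod_type]
  refine Finset.sum_congr rfl fun a _ => ?_
  rw [Finset.mul_sum]
  refine Finset.sum_congr rfl fun b _ => ?_
  simp [un]; ring

lemma kH_pair (D : ℕ) (x y : Fin d → ℤ) :
    ∑ n, un ((Fin d → ZMod Q) × (∀ i, ZZ d m i)) n * (kH m Q D x n * kH m Q D y n) =
      kap d D m Q (fun j => x j - y j) := by
  rw [un_prod]
  have h1 : ∀ a : Fin d → ZMod Q, ∑ b, un (∀ i, ZZ d m i) b * (kH m Q D x (a, b) * kH m Q D y (a, b)) =
      dQ Q (red Q x) a * (dQ Q (red Q y) a * 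
        ∑ S ∈ Finset.univ.filter (fun S : Finset ι => S.card ≤ D), Phi S (XX m x) (XX m y)) := by
    intro a
    rw [← expect_eq_un]
    have h2 : ∀ b, kH m Q D x (a, b) * kH m Q D y (a, b) = dQ Q (red Q x) a * (dQ Q (red Q y) a *
      ∑ S ∈ Finset.univ.filter (fun S : Finset ι => S.card ≤ D),
      ∑ T ∈ Finset.univ.filter (fun S : Finset ι => S.card ≤ D), Phi S (XX m x) b * Phi T b (XX m y)) := by
      intro b
      unfold kH
      simp only
      rw [← Finset.sum_mul_sum]
      simp only [Phi_comm _ b]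
      ring
    simp only [h2]
    rw [← Finset.mul_expect, ← Finset.mul_expect, Finset.expect_sum_comm]
    congr 2
    refine Finset.sum_congr rfl fun S hS => ?_
    rw [Finset.expect_sum_comm]
    simp only [expect_Phi_Phi]
    rw [Finset.sum_ite_eq]
    rw [if_pos hS]
  simp only [h1]
  rw [← expect_eq_un, expect_dQ_mul]
  unfold kap
  congr 1
  · unfold dQ
    refine if_congr ?_ rfl rfl
    rw [eq_comm]
    exact red_eq_iff _ _ _
  · refine Finset.sum_congr rfl fun S _ => ?_
    unfold Phi
    refine Finset.prod_congr rfl fun i _ => ?_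
    rw [dl_eq]
    congr 1
    exact if_congr (red_eq_iff _ _ _) rfl rfl

end residues
end IW

open scoped BigOperators
set_option linter.unusedSectionVars false
set_option linter.unusedVariables false
namespace IW
open MeasureTheory

section W
variable {ι : Type} [Fintype ι] [DecidableEq ι]
variable {d : ℕ} (m : ι → ℕ) (Q : ℕ) [∀ i, NeZero (m i)] [NeZero Q]

/-- index set of residues -/
abbrev HH (d : ℕ) (m : ι → ℕ) (Q : ℕ) : Type := (Fin d → ZMod Q) × (∀ i, ZZ d m i)

noncomputable def Wf (D : ℕ) (e : Fin d → ℝ) (F : Finset (Fin d → ℤ)) (f : (Fin d → ℤ) → ℂ)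
    (n : HH d m Q) (t : EE d) : ℂ := ∑ x ∈ F, f x * (kH m Q D x n : ℂ) * (Kr e (t + zE x) : ℂ)

lemma Wf_eq_Wop (D : ℕ) (e : Fin d → ℝ) (F : Finset (Fin d → ℤ)) (f : (Fin d → ℤ) → ℂ)
    (h0 : Fin d → ZMod Q) (h : ∀ i, ZZ d m i) (t : EE d) :
    Wf m Q D e F f (h0, h) t = Wop (Z := ZZ d m) D (fun x : F => wt Q e t h0 x)
      (fun x : F => XX m (x : Fin d → ℤ)) (fun x => f x) h := by
  unfold Wop Wf
  simp only [FS]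
  rw [← Finset.sum_filter]
  unfold cT
  rw [Finset.sum_comm, ← Finset.sum_coe_sort F]
  refine Finset.sum_congr rfl fun x _ => ?_
  unfold kH wt
  push_cast
  rw [← Finset.mul_sum]
  ring

lemma W_point (D : ℕ) (p : ℝ) (C : ℝ) (n : ℕ)
    (hL : ∀ (ι : Type) [Fintype ι] [DecidableEq ι] (Z : ι → Type) [∀ i, Fintype (Z i)]
      [∀ i, Nonempty (Z i)] (Ω : Type) [Fintype Ω] (μ : Ω → ℝ) (X : Ω → ∀ i, Z i),
      Dom n μ X → ∀ f : Ω → ℂ,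
      ∑ h, un (∀ i, Z i) h * ‖Wop D μ X f h‖ ^ p ≤ C * ∑ x, μ x * ‖f x‖ ^ p)
    (hcop : Pairwise fun i j => Nat.Coprime (m i) (m j))
    (hcQ : ∀ i, Nat.Coprime Q (m i)) (e : Fin d → ℝ) (he : ∀ i, 0 < e i)
    (hS : ∀ S : Finset ι, S.card ≤ n → ∀ i, (qS m Q S : ℝ) * e i ≤ 1)
    (F : Finset (Fin d → ℤ)) (f : (Fin d → ℤ) → ℂ) (t : EE d) :
    ∑ n, un (HH d m Q) n * ‖Wf m Q D e F f n t‖ ^ p ≤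
      C * ∑ x ∈ F, Kr e (t + zE x) * ‖f x‖ ^ p := by
  rw [un_prod]
  have h1 : ∀ h0 : Fin d → ZMod Q, ∑ b, un (∀ i, ZZ d m i) b * ‖Wf m Q D e F f (h0, b) t‖ ^ p ≤
      C * ∑ x ∈ F, wt Q e t h0 x * ‖f x‖ ^ p := by
    intro h0
    have := hL ι (ZZ d m) F _ _ (wt_Dom m Q hcop hcQ e he n hS t h0 F) (fun x => f x)
    simp only [Wf_eq_Wop]
    refine this.trans (le_of_eq ?_)
    rw [Finset.sum_coe_sort F (fun x => wt Q e t h0 x * ‖f x‖ ^ p)]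
  refine (Finset.sum_le_sum fun h0 _ => mul_le_mul_of_nonneg_left (h1 h0) (un_nonneg _ _)).trans
    (le_of_eq ?_)
  have h2 : ∀ x, ∑ h0, un (Fin d → ZMod Q) h0 * wt Q e t h0 x = Kr e (t + zE x) := by
    intro x
    rw [← expect_eq_un]
    exact expect_dQ_mul Q (red Q x) (fun _ => Kr e (t + zE x))
  simp only [← h2, Finset.mul_sum, Finset.sum_mul]
  rw [Finset.sum_comm]
  refine Finset.sum_congr rfl fun x _ => Finset.sum_congr rfl fun h0 _ => by ring

noncomputable def Mb (d : ℕ) (m : ι → ℕ) (Q : ℕ) (D : ℕ) : ℝ :=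
  (Q:ℝ)^d * ∑ S ∈ Finset.univ.filter (fun S : Finset ι => S.card ≤ D), ∏ i ∈ S, (m i : ℝ)^d

lemma Mb_nonneg (d : ℕ) (D : ℕ) : 0 ≤ Mb d m Q D := by unfold Mb; positivity

lemma kH_le (D : ℕ) (x : Fin d → ℤ) (n : HH d m Q) : |kH m Q D x n| ≤ Mb d m Q D := by
  unfold kH Mb
  rw [abs_mul, abs_of_nonneg (dQ_nonneg _ _ _)]
  refine mul_le_mul (dQ_le _ _ _) ?_ (abs_nonneg _) (by positivity)
  refine (Finset.abs_sum_le_sum_abs _ _).trans (Finset.sum_le_sum fun S _ => ?_)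
  unfold Phi
  rw [Finset.abs_prod]
  refine Finset.prod_le_prod (fun i _ => abs_nonneg _) fun i _ => ?_
  have h1 : (1:ℝ) ≤ (m i : ℝ)^d := one_le_pow₀ (by exact_mod_cast Nat.one_le_iff_ne_zero.2 (NeZero.ne (m i)))
  rw [dl_eq]
  split_ifs
  · rw [abs_of_nonneg (by linarith)]; linarith
  · simpa using h1

lemma sum_Kr_le (e : Fin d → ℝ) (he : ∀ i, 0 < e i) (he1 : ∀ i, e i ≤ 1) (t : EE d)
    (F : Finset (Fin d → ℤ)) : ∑ x ∈ F, Kr e (t + zE x) ≤ 1 := by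
  have h := poissond e he 1 one_pos (by simpa using he1) t 0
  simp at h
  exact sum_le_hasSum F (fun x _ => Kr_nonneg e he _) h

lemma W_triv (D : ℕ) (p : ℝ) (hp : 1 < p) (e : Fin d → ℝ) (he : ∀ i, 0 < e i) (he1 : ∀ i, e i ≤ 1)
    (F : Finset (Fin d → ℤ)) (f : (Fin d → ℤ) → ℂ) (t : EE d) :
    ∑ n, un (HH d m Q) n * ‖Wf m Q D e F f n t‖ ^ p ≤
      Mb d m Q D ^ p * ∑ x ∈ F, Kr e (t + zE x) * ‖f x‖ ^ p := by
  set R := ∑ x ∈ F, Kr e (t + zE x) * ‖f x‖ ^ p with hR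
  have hR0 : 0 ≤ R := Finset.sum_nonneg fun x _ => mul_nonneg (Kr_nonneg e he _) (by positivity)
  have hpq := Real.HolderConjugate.conjExponent hp
  have h1 : ∑ x ∈ F, Kr e (t + zE x) * ‖f x‖ ≤ R ^ (1/p) := by
    have := holder_w F (fun x => Kr e (t + zE x)) (fun x => ‖f x‖) (fun _ => 1)
      (fun x _ => Kr_nonneg e he _) (fun x _ => norm_nonneg _) (fun x _ => zero_le_one) hpq
    simp only [mul_one, Real.one_rpow] at this
    refine this.trans ?_
    have h3 : (∑ x ∈ F, Kr e (t + zE x)) ^ (1 / p.conjExponent) ≤ 1 :=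
      Real.rpow_le_one (Finset.sum_nonneg fun x _ => Kr_nonneg e he _) (sum_Kr_le e he he1 t F)
        (by have := hpq.symm.pos; positivity)
    exact mul_le_of_le_one_right (by positivity) h3
  have h2 : ∀ n, ‖Wf m Q D e F f n t‖ ^ p ≤ Mb d m Q D ^ p * R := by
    intro n
    have h4 : ‖Wf m Q D e F f n t‖ ≤ Mb d m Q D * R ^ (1/p) := by
      refine le_trans ?_ (mul_le_mul_of_nonneg_left h1 (Mb_nonneg m Q d D))
      rw [Finset.mul_sum]
      unfold Wf
      refine (norm_sum_le _ _).trans (Finset.sum_le_sum fun x _ => ?_)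
      rw [norm_mul, norm_mul, Complex.norm_real, Complex.norm_real, Real.norm_eq_abs,
        Real.norm_eq_abs, abs_of_nonneg (Kr_nonneg e he _)]
      have := kH_le m Q D x n
      have h5 := Kr_nonneg e he (t + zE x)
      calc ‖f x‖ * |kH m Q D x n| * Kr e (t + zE x) = |kH m Q D x n| * (Kr e (t + zE x) * ‖f x‖) := by ring
        _ ≤ _ := by gcongr
    calc ‖Wf m Q D e F f n t‖ ^ p ≤ (Mb d m Q D * R ^ (1/p)) ^ p :=
          Real.rpow_le_rpow (norm_nonneg _) h4 (by linarith)
      _ = _ := by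
          rw [Real.mul_rpow (Mb_nonneg m Q d D) (by positivity), ← Real.rpow_mul hR0,
            one_div_mul_cancel (by linarith), Real.rpow_one]
  refine (Finset.sum_le_sum fun n _ => mul_le_mul_of_nonneg_left (h2 n) (un_nonneg _ _)).trans
    (le_of_eq ?_)
  rw [← Finset.sum_mul]
  have : ∑ n, un (HH d m Q) n = 1 := by
    have := expect_eq_un (H := HH d m Q) (fun _ => 1)
    simp at this; exact this.symm
  rw [this, one_mul]

end W

instance {ρ : ℝ} {N : ℕ} (i : PP ρ N) : NeZero (mm ρ N i) := ⟨(mm_pos i).ne'⟩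
instance {ρ : ℝ} {N : ℕ} : NeZero (QzeroIW ρ N) := ⟨(Q_pos ρ N).ne'⟩

theorem W_bound (d : ℕ) (ρ : ℝ) (hρ : 0 < ρ) (p : ℝ) (hp : 1 < p) :
    ∃ C : ℝ, 0 ≤ C ∧ ∀ N : ℕ, 1 ≤ N → ∀ eN : Fin d → ℝ,
      (∀ i, 0 < eN i ∧ eN i ≤ Real.exp (-(N : ℝ) ^ (2 * ρ))) →
      ∀ (F : Finset (Fin d → ℤ)) (f : (Fin d → ℤ) → ℂ) (t : EE d),
      ∑ n, un (HH d (mm ρ N) (QzeroIW ρ N)) n * ‖Wf (mm ρ N) (QzeroIW ρ N) (DIW ρ) eN F f n t‖ ^ p ≤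
      C * ∑ x ∈ F, Kr eN (t + zE x) * ‖f x‖ ^ p := by
  obtain ⟨C, hC, n, hL⟩ := local_thm (DIW ρ) p hp
  obtain ⟨N₁, hN₁, hsize⟩ := size_qS ρ hρ n
  refine ⟨C + ∑ N ∈ Finset.range N₁, Mb d (mm ρ N) (QzeroIW ρ N) (DIW ρ) ^ p,
    add_nonneg hC (Finset.sum_nonneg fun N _ => Real.rpow_nonneg (Mb_nonneg _ _ _ _) _), ?_⟩
  intro N hN eN heN F f t
  have hR0 : 0 ≤ ∑ x ∈ F, Kr eN (t + zE x) * ‖f x‖ ^ p := Finset.sum_nonneg fun x _ =>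
    mul_nonneg (Kr_nonneg eN (fun i => (heN i).1) _) (by positivity)
  have hs0 : 0 ≤ ∑ N ∈ Finset.range N₁, Mb d (mm ρ N) (QzeroIW ρ N) (DIW ρ) ^ p :=
    Finset.sum_nonneg fun N _ => Real.rpow_nonneg (Mb_nonneg _ _ _ _) _
  by_cases h : N₁ ≤ N
  · refine (W_point (mm ρ N) (QzeroIW ρ N) (DIW ρ) p C n hL mm_cop Q_cop eN
      (fun i => (heN i).1) ?_ F f t).trans ?_
    · intro S hS i
      calc (qS (mm ρ N) (QzeroIW ρ N) S : ℝ) * eN i ≤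
          Real.exp ((N:ℝ)^(2*ρ)) * Real.exp (-(N : ℝ) ^ (2 * ρ)) :=
            mul_le_mul (hsize N h S hS) (heN i).2 (heN i).1.le (Real.exp_pos _).le
        _ = 1 := by rw [← Real.exp_add]; simp
    · gcongr; linarith
  · push Not at h
    refine (W_triv (mm ρ N) (QzeroIW ρ N) (DIW ρ) p hp eN (fun i => (heN i).1) (fun i => ?_) F f t).trans ?_
    · refine (heN i).2.trans ?_
      rw [Real.exp_le_one_iff]
      have : (0:ℝ) ≤ (N:ℝ)^(2*ρ) := by positivity
      linarith
    · gcongr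
      have := Finset.single_le_sum (f := fun N => Mb d (mm ρ N) (QzeroIW ρ N) (DIW ρ) ^ p)
        (fun N _ => Real.rpow_nonneg (Mb_nonneg _ _ _ _) _) (Finset.mem_range.2 h)
      linarith
end IW

open scoped BigOperators
set_option linter.unusedSectionVars false
set_option linter.unusedVariables false
namespace IW
open MeasureTheory
open scoped FourierTransform

section W
variable {ι : Type} [Fintype ι] [DecidableEq ι]
variable {d : ℕ} (m : ι → ℕ) (Q : ℕ) [∀ i, NeZero (m i)] [NeZero Q]

lemma Wf_continuous (D : ℕ) (e : Fin d → ℝ) (he : ∀ i, 0 < e i) (F : Finset (Fin d → ℤ)) (f : (Fin d → ℤ) → ℂ)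
    (n : HH d m Q) : Continuous (Wf m Q D e F f n) := by
  unfold Wf
  have := Kr_continuous e he
  fun_prop

lemma W_int (D : ℕ) (p : ℝ) (hp : 1 < p) (e : Fin d → ℝ) (he : ∀ i, 0 < e i) (C : ℝ) (hC : 0 ≤ C)
    (F : Finset (Fin d → ℤ)) (f : (Fin d → ℤ) → ℂ) 
    (h : ∀ t : EE d, ∑ n, un (HH d m Q) n * ‖Wf m Q D e F f n t‖ ^ p ≤
      C * ∑ x ∈ F, Kr e (t + zE x) * ‖f x‖ ^ p) :
    ∑ n, ENNReal.ofReal (un (HH d m Q) n) * ∫⁻ t, ‖Wf m Q D e F f n t‖ₑ ^ p ≤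
      ENNReal.ofReal (C * ∑ x ∈ F, ‖f x‖ ^ p) := by
  have hp0 : 0 ≤ p := by linarith
  have hmeas : ∀ n, Measurable fun t => ENNReal.ofReal (un (HH d m Q) n) * ‖Wf m Q D e F f n t‖ₑ ^ p := by
    intro n
    have := (Wf_continuous m Q D e he F f n).measurable
    fun_prop
  have h1 : ∑ n, ENNReal.ofReal (un (HH d m Q) n) * ∫⁻ t, ‖Wf m Q D e F f n t‖ₑ ^ p =
      ∫⁻ t, ENNReal.ofReal (∑ n, un (HH d m Q) n * ‖Wf m Q D e F f n t‖ ^ p) := by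
    have h2 : ∀ t, ENNReal.ofReal (∑ n, un (HH d m Q) n * ‖Wf m Q D e F f n t‖ ^ p) =
        ∑ n, ENNReal.ofReal (un (HH d m Q) n) * ‖Wf m Q D e F f n t‖ₑ ^ p := by
      intro t
      rw [ENNReal.ofReal_sum_of_nonneg fun n _ => mul_nonneg (un_nonneg _ _) (by positivity)]
      refine Finset.sum_congr rfl fun n _ => ?_
      rw [ENNReal.ofReal_mul (un_nonneg _ _), ← ENNReal.ofReal_rpow_of_nonneg (norm_nonneg _) hp0,
        ofReal_norm_eq_enorm]
    simp only [h2]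
    rw [lintegral_finsetSum _ fun n _ => hmeas n]
    refine Finset.sum_congr rfl fun n _ => ?_
    rw [lintegral_const_mul]
    have := (Wf_continuous m Q D e he F f n).measurable
    fun_prop
  rw [h1]
  refine (lintegral_mono fun t => ENNReal.ofReal_le_ofReal (h t)).trans (le_of_eq ?_)
  have hi : ∀ x : Fin d → ℤ, Integrable fun t => Kr e (t + zE x) := fun x =>
    (Kr_integrable e he).comp_add_right (zE x)
  rw [← ofReal_integral_eq_lintegral_ofReal]
  · congr 1
    rw [integral_const_mul, integral_finsetSum _ fun x _ => (hi x).mul_const _]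
    congr 1
    refine Finset.sum_congr rfl fun x _ => ?_
    rw [integral_mul_const, integral_add_right_eq_self (Kr e), Kr_integral e he, one_mul]
  · exact (integrable_finsetSum _ fun x _ => (hi x).mul_const _).const_mul _
  · exact Filter.Eventually.of_forall fun t => mul_nonneg hC (Finset.sum_nonneg fun x _ =>
      mul_nonneg (Kr_nonneg e he _) (by positivity))

/-- translates of the kernel -/
lemma Kt_fourier (e : Fin d → ℝ) (he : ∀ i, 0 < e i) (x : Fin d → ℤ) (θ : EE d) :
    𝓕 (fun t => (Kr e (t + zE x) : ℂ)) θ = ee (∑ j, θ j * x j) * (Kh e θ : ℂ) := by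
  rw [← Kr_fourier e he, fourier_EE, fourier_EE, ← integral_const_mul]
  rw [← integral_add_right_eq_self (fun v => ee (∑ j, θ j * (x j:ℝ)) * (ee (-∑ j, v j * θ j) * (Kr e v : ℂ))) (zE x)]
  congr 1; funext v
  rw [← mul_assoc, ← ee_add]
  congr 2
  simp only [PiLp.add_apply, zE_apply, add_mul, Finset.sum_add_distrib]
  have : ∑ j, θ j * (x j : ℝ) = ∑ j, (x j:ℝ) * θ j := Finset.sum_congr rfl fun j _ => mul_comm _ _
  rw [this]; ring

lemma Kt_integrable (e : Fin d → ℝ) (he : ∀ i, 0 < e i) (x : Fin d → ℤ) :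
    Integrable (fun t => (Kr e (t + zE x) : ℂ)) :=
  ((Kr_integrable e he).comp_add_right (zE x)).ofReal

lemma Kt_memLp (e : Fin d → ℝ) (he : ∀ i, 0 < e i) (x : Fin d → ℤ) (p : ENNReal) :
    MemLp (fun t => (Kr e (t + zE x) : ℂ)) p := by
  have h : (fun t => (Kr e t : ℂ)) = KS e he := funext fun t => (KS_apply e he t).symm
  have h1 : MemLp (fun t => (Kr e t : ℂ)) p := by rw [h]; exact (KS e he).memLp p
  exact h1.comp_measurePreserving (measurePreserving_add_right volume (zE x))

lemma Wf_memLp (D : ℕ) (e : Fin d → ℝ) (he : ∀ i, 0 < e i) (F : Finset (Fin d → ℤ)) (f : (Fin d → ℤ) → ℂ)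
    (n : HH d m Q) (p : ENNReal) : MemLp (Wf m Q D e F f n) p := by
  unfold Wf
  exact memLp_finsetSum _ fun x _ => (Kt_memLp e he x p).const_mul _

lemma Wf_integrable (D : ℕ) (e : Fin d → ℝ) (he : ∀ i, 0 < e i) (F : Finset (Fin d → ℤ)) (f : (Fin d → ℤ) → ℂ)
    (n : HH d m Q) : Integrable (Wf m Q D e F f n) := memLp_one_iff_integrable.1 (Wf_memLp m Q D e he F f n 1)

lemma Wf_fourier (D : ℕ) (e : Fin d → ℝ) (he : ∀ i, 0 < e i) (F : Finset (Fin d → ℤ)) (f : (Fin d → ℤ) → ℂ)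
    (n : HH d m Q) (θ : EE d) : 𝓕 (Wf m Q D e F f n) θ =
      (∑ x ∈ F, f x * (kH m Q D x n : ℂ) * ee (∑ j, θ j * x j)) * (Kh e θ : ℂ) := by
  rw [fourier_EE]
  unfold Wf
  simp only [Finset.mul_sum]
  rw [integral_finsetSum, Finset.sum_mul]
  · refine Finset.sum_congr rfl fun x _ => ?_
    rw [mul_assoc, ← Kt_fourier e he, fourier_EE, ← integral_const_mul]
    congr 1; funext v; ring
  · intro x _
    have h := (Kt_integrable e he x).const_mul (f x * (kH m Q D x n : ℂ))
    refine h.bdd_mul (c := 1) ?_ ?_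
    · have := continuous_ee
      refine Continuous.aestronglyMeasurable ?_
      fun_prop
    · exact Filter.Eventually.of_forall fun v => by rw [norm_ee]
end W
end IW

open scoped BigOperators
set_option linter.unusedSectionVars false
set_option linter.unusedVariables false
namespace IW
open MeasureTheory
open scoped FourierTransform

section pair
variable {d : ℕ}

lemma osc_integrable {u : EE d → ℂ} (hu : Integrable u) (b : EE d → ℝ) (hb : Continuous b) :
    Integrable fun t => ee (b t) * u t := by
  refine hu.bdd_mul (c := 1) ?_ ?_
  · exact (continuous_ee.comp hb).aestronglyMeasurable
  · exact Filter.Eventually.of_forall fun v => by rw [norm_ee]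

lemma osc_continuous {w : EE d → ℂ} (hw : Integrable w) (b : EE d → EE d → ℝ)
    (hb : Continuous fun z : EE d × EE d => b z.1 z.2) :
    Continuous fun θ => ∫ t, ee (b θ t) * w t := by
  refine continuous_of_dominated (bound := fun t => ‖w t‖) ?_ ?_ hw.norm ?_
  · intro θ
    exact (osc_integrable hw (b θ) (hb.comp (Continuous.prodMk_right θ))).aestronglyMeasurable
  · intro θ
    exact Filter.Eventually.of_forall fun t => by rw [norm_mul, norm_ee, one_mul]
  · refine Filter.Eventually.of_forall fun t => ?_
    exact (continuous_ee.comp (hb.comp (Continuous.prodMk_left t))).mul continuous_const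

lemma osc_norm_le {w : EE d → ℂ} (b : EE d → ℝ) : ‖∫ t, ee (b t) * w t‖ ≤ ∫ t, ‖w t‖ := by
  refine (norm_integral_le_integral_norm _).trans (le_of_eq ?_)
  congr 1; funext t; rw [norm_mul, norm_ee, one_mul]

lemma osc_swap {u w : EE d → ℂ} (hu : Integrable u) (hw : Integrable w) (b : EE d → EE d → ℝ)
    (hb : Continuous fun z : EE d × EE d => b z.1 z.2) :
    ∫ θ, u θ * ∫ t, ee (b θ t) * w t = ∫ t, (∫ θ, ee (b θ t) * u θ) * w t := by
  have h1 : ∀ θ, u θ * ∫ t, ee (b θ t) * w t = ∫ t, ee (b θ t) * (u θ * w t) := by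
    intro θ; rw [← integral_const_mul]; congr 1; funext t; ring
  have h2 : ∀ t, (∫ θ, ee (b θ t) * u θ) * w t = ∫ θ, ee (b θ t) * (u θ * w t) := by
    intro t; rw [← integral_mul_const]; congr 1; funext t; ring
  simp only [h1, h2]
  refine integral_integral_swap ?_
  refine (hu.mul_prod hw).bdd_mul (c := 1) ?_ ?_
  · exact (continuous_ee.comp hb).aestronglyMeasurable
  · exact Filter.Eventually.of_forall fun v => by rw [norm_ee]

lemma cont_dot : Continuous fun z : EE d × EE d => ∑ j, z.1 j * z.2 j := by fun_prop

lemma holder_int {a b : EE d → ℂ} (ha : Continuous a) (hb : AEMeasurable b) {p q : ℝ}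
    (hpq : p.HolderConjugate q) : ‖∫ t, a t * b t‖ₑ ≤
      (∫⁻ t, ‖a t‖ₑ ^ p) ^ (1/p) * (∫⁻ t, ‖b t‖ₑ ^ q) ^ (1/q) := by
  refine (enorm_integral_le_lintegral_enorm _).trans ?_
  simp only [enorm_mul]
  exact ENNReal.lintegral_mul_le_Lp_mul_Lq volume hpq ha.aemeasurable.enorm hb.enorm

lemma pair_v (Θ : EE d → ℂ) (hΘ : Measurable Θ) (B : ℝ) (hB : ∀ ξ, ‖Θ ξ‖ ≤ B)
    {φ γ : EE d → ℂ} (hφF : Integrable (𝓕 φ)) (hγ : Integrable γ) {p q : ℝ}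
    (hpq : p.HolderConjugate q) (A : ENNReal)
    (hA : (∫⁻ t, ‖𝓕⁻ (fun ξ => Θ ξ * 𝓕 φ ξ) t‖ₑ ^ p) ^ (1/p) ≤ A * (∫⁻ t, ‖φ t‖ₑ ^ p) ^ (1/p))
    (v : EE d) :
    ‖∫ θ, Θ θ * 𝓕 φ θ * 𝓕⁻ γ θ * ee (-(∑ j, v j * θ j))‖ₑ ≤
      A * (∫⁻ t, ‖φ t‖ₑ ^ p) ^ (1/p) * (∫⁻ t, ‖γ t‖ₑ ^ q) ^ (1/q) := by
  set U : EE d → ℂ := fun ξ => Θ ξ * 𝓕 φ ξ with hU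
  have hUi : Integrable U := hφF.bdd_mul (c := B) hΘ.aestronglyMeasurable
    (Filter.Eventually.of_forall hB)
  have hγv : Integrable fun t => γ (t + v) := hγ.comp_add_right v
  have h1 : ∀ θ, 𝓕⁻ γ θ * ee (-(∑ j, v j * θ j)) = ∫ t, ee (∑ j, t j * θ j) * γ (t + v) := by
    intro θ
    rw [fourierInv_EE, ← integral_add_right_eq_self _ v, ← integral_mul_const]
    congr 1; funext t
    rw [mul_right_comm, ← ee_add]
    congr 2
    simp only [PiLp.add_apply, add_mul, Finset.sum_add_distrib]; ring
  have h2 : ∫ θ, Θ θ * 𝓕 φ θ * 𝓕⁻ γ θ * ee (-(∑ j, v j * θ j)) =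
      ∫ t, 𝓕⁻ U t * γ (t + v) := by
    have := osc_swap hUi hγv (fun θ t => ∑ j, t j * θ j) (by fun_prop)
    simp only [mul_assoc, h1]
    simp only [fourierInv_EE]
    rw [show (fun θ => Θ θ * (𝓕 φ θ * ∫ t : EE d, ee (∑ j, t j * θ j) * γ (t + v))) =
      fun θ => U θ * ∫ t, ee (∑ j, t j * θ j) * γ (t + v) by funext θ; simp [hU, mul_assoc]]
    rw [this]
    congr 1; funext t; congr 3; funext θ; congr 2
    exact Finset.sum_congr rfl fun j _ => mul_comm _ _
  have hcont : Continuous (𝓕⁻ U) := by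
    have := osc_continuous hUi (fun t θ => ∑ j, θ j * t j) (by fun_prop)
    have h3 : 𝓕⁻ U = fun t => ∫ θ, ee (∑ j, θ j * t j) * U θ := funext fun t => fourierInv_EE _ _
    rw [h3]; exact this
  rw [h2]
  refine (holder_int hcont hγv.aestronglyMeasurable.aemeasurable hpq).trans ?_
  have h5 : ∫⁻ t, ‖γ (t + v)‖ₑ ^ q = ∫⁻ t, ‖γ t‖ₑ ^ q :=
    lintegral_add_right_eq_self (fun t => ‖γ t‖ₑ ^ q) v
  rw [h5]
  gcongr

lemma pair_r (Θ : EE d → ℂ) (hΘ : Measurable Θ) (B : ℝ) (hB : ∀ ξ, ‖Θ ξ‖ ≤ B)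
    {φ γ : EE d → ℂ} (hφF : Integrable (𝓕 φ)) (hγ : Integrable γ) {p q : ℝ}
    (hpq : p.HolderConjugate q) (A : ENNReal)
    (hA : (∫⁻ t, ‖𝓕⁻ (fun ξ => Θ ξ * 𝓕 φ ξ) t‖ₑ ^ p) ^ (1/p) ≤ A * (∫⁻ t, ‖φ t‖ₑ ^ p) ^ (1/p))
    (r : EE d → ℂ) (hr : Integrable r) (e : Fin d → ℝ) (ζ : EE d → ℂ)
    (hζ : ∀ θ, ζ θ = ∫ s, ee (-(∑ j, s j / e j * θ j)) * r s) :
    ‖∫ θ, Θ θ * ζ θ * 𝓕 φ θ * 𝓕⁻ γ θ‖ₑ ≤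
      (∫⁻ s, ‖r s‖ₑ) * (A * (∫⁻ t, ‖φ t‖ₑ ^ p) ^ (1/p) * (∫⁻ t, ‖γ t‖ₑ ^ q) ^ (1/q)) := by
  have hUi : Integrable fun θ => Θ θ * 𝓕 φ θ := hφF.bdd_mul (c := B) hΘ.aestronglyMeasurable
    (Filter.Eventually.of_forall hB)
  have hGi : Integrable fun θ => Θ θ * 𝓕 φ θ * 𝓕⁻ γ θ := by
    refine hUi.mul_bdd (c := ∫ t, ‖γ t‖) ?_ ?_
    · have := osc_continuous hγ (fun t θ => ∑ j, θ j * t j) (by fun_prop)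
      have h3 : 𝓕⁻ γ = fun t => ∫ θ, ee (∑ j, θ j * t j) * γ θ := funext fun t => fourierInv_EE _ _
      rw [h3]; exact this.aestronglyMeasurable
    · exact Filter.Eventually.of_forall fun θ => by rw [fourierInv_EE]; exact osc_norm_le _
  have h1 : ∫ θ, Θ θ * ζ θ * 𝓕 φ θ * 𝓕⁻ γ θ =
      ∫ s, (∫ θ, Θ θ * 𝓕 φ θ * 𝓕⁻ γ θ * ee (-(∑ j, s j / e j * θ j))) * r s := by
    have := osc_swap hGi hr (fun θ s => -(∑ j, s j / e j * θ j)) (by fun_prop)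
    simp only [← hζ] at this
    have h2 : ∫ θ, Θ θ * ζ θ * 𝓕 φ θ * 𝓕⁻ γ θ = ∫ θ, Θ θ * 𝓕 φ θ * 𝓕⁻ γ θ * ζ θ := by
      congr 1; funext θ; ring
    rw [h2, this]
    congr 1; funext s; congr 2; funext θ; ring
  rw [h1]
  refine (enorm_integral_le_lintegral_enorm _).trans ?_
  rw [mul_comm, ← lintegral_const_mul'' _ hr.aestronglyMeasurable.enorm]
  refine lintegral_mono fun s => ?_
  simp only [enorm_mul]
  gcongr
  exact pair_v Θ hΘ B hB hφF hγ hpq A hA (WithLp.toLp 2 fun j => s j / e j)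
end pair
end IW

open scoped BigOperators
set_option linter.unusedSectionVars false
set_option linter.unusedVariables false
namespace IW
open MeasureTheory
open scoped FourierTransform ContDiff

/-- coordinatewise division -/
noncomputable def sc {d : ℕ} (e : Fin d → ℝ) (θ : EE d) : EE d := WithLp.toLp 2 fun i => θ i / e i

lemma coord_le {d : ℕ} (x : EE d) (i : Fin d) : |x i| ≤ ‖x‖ := by
  have := PiLp.norm_apply_le x i
  simpa using this

lemma eta_r (d : ℕ) (hd : 1 ≤ d) (η : EE d → ℝ) (hη : ContDiff ℝ ∞ η)
    (hη0 : ∀ x : EE d, 1 / (8 * d) ≤ ‖x‖ → η x = 0) :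
    ∃ r : EE d → ℂ, Integrable r ∧ ∃ η₂ : EE d → ℂ,
      (∀ u, η₂ u = ∫ s, ee (-(∑ j, s j * u j)) * r s) ∧
      ∀ e : Fin d → ℝ, ∀ θ, (η (sc e θ) : ℂ) = η₂ (sc e θ) * (Kh e θ : ℂ) * (Kh e (-θ) : ℂ) := by
  have hd' : (1:ℝ) ≤ d := by exact_mod_cast hd
  have hsmall : 1 / (8 * (d:ℝ)) ≤ 1/8 := by
    rw [div_le_div_iff₀ (by positivity) (by norm_num)]; linarith
  set K : EE d → ℝ := fun u => Kh (fun _ => 1) u * Kh (fun _ => 1) (-u) with hK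
  have hKs : ContDiff ℝ ∞ K := (Kh_smooth _).mul ((Kh_smooth _).comp contDiff_neg)
  have hKpos : ∀ u : EE d, (∀ i, |u i| < 1/2) → 0 < K u := by
    intro u hu
    refine mul_pos (Finset.prod_pos fun i _ => BB_pos ?_) (Finset.prod_pos fun i _ => BB_pos ?_)
    · simpa using hu i
    · simpa using hu i
  set g : EE d → ℝ := fun u => η u / K u with hg
  have hgs : ContDiff ℝ ∞ g := by
    rw [contDiff_iff_contDiffAt]
    intro u
    by_cases hu : ‖u‖ < 1/2
    · exact hη.contDiffAt.div hKs.contDiffAt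
        (hKpos u fun i => (coord_le u i).trans_lt hu).ne'
    · have : g =ᶠ[nhds u] fun _ => 0 := by
        have ho : IsOpen {x : EE d | 1/8 < ‖x‖} := isOpen_lt continuous_const continuous_norm
        filter_upwards [ho.mem_nhds (show u ∈ {x : EE d | 1/8 < ‖x‖} by
          change (1:ℝ)/8 < ‖u‖; linarith)] with x hx
        change (1:ℝ)/8 < ‖x‖ at hx
        simp [hg, hη0 x (by linarith)]
      exact contDiffAt_const.congr_of_eventuallyEq this
  have hgc : HasCompactSupport g := by
    refine HasCompactSupport.intro (isCompact_closedBall (0:EE d) (1/8)) fun x hx => ?_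
    simp only [Metric.mem_closedBall, dist_zero_right, not_le] at hx
    simp [hg, hη0 x (by linarith)]
  have hgcs : ContDiff ℝ ∞ (fun u => (g u : ℂ)) := Complex.ofRealCLM.contDiff.comp hgs
  have hgcc : HasCompactSupport (fun u => (g u : ℂ)) :=
    hgc.comp_left (g := fun x : ℝ => (x:ℂ)) (by simp)
  let S : SchwartzMap (EE d) ℂ := hgcc.toSchwartzMap hgcs
  let R : SchwartzMap (EE d) ℂ := 𝓕⁻ S
  have hFR : 𝓕 R = S := FourierInvPair.fourier_fourierInv_eq _
  refine ⟨R, R.integrable, fun u => (g u : ℂ), ?_, ?_⟩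
  · intro u
    rw [← fourier_EE, ← SchwartzMap.fourier_coe, hFR]; rfl
  · intro e θ
    have h1 : K (sc e θ) = Kh e θ * Kh e (-θ) := by
      simp [hK, Kh, sc, neg_div]
    have h2 : η (sc e θ) = g (sc e θ) * K (sc e θ) := by
      by_cases h : 1 / (8 * (d:ℝ)) ≤ ‖sc e θ‖
      · simp [hg, hη0 _ h]
      · push Not at h
        simp only [hg]
        rw [div_mul_cancel₀]
        exact (hKpos _ fun i => (coord_le _ i).trans_lt (by linarith)).ne'
    rw [h2, h1]; push_cast; ring

end IW

open scoped BigOperators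
set_option linter.unusedSectionVars false
set_option linter.unusedVariables false
namespace IW
open MeasureTheory
open scoped FourierTransform ContDiff

/-- unit cube -/
def box (d : ℕ) : Set (EE d) := {ξ : EE d | ∀ i, ξ i ∈ Set.Ico (0 : ℝ) 1}

lemma box_meas (d : ℕ) : MeasurableSet (box d) := by
  have : box d = ⋂ i : Fin d, (fun ξ : EE d => ξ i) ⁻¹' Set.Ico (0:ℝ) 1 := by
    ext ξ; simp [box]
  rw [this]
  refine MeasurableSet.iInter fun i => ?_
  have hc : Continuous fun ξ : EE d => ξ i := by fun_prop
  exact hc.measurable measurableSet_Ico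

/-- integer translations -/
noncomputable def zEh (d : ℕ) : (Fin d → ℤ) →+ EE d where
  toFun := zE
  map_zero' := by ext i; simp
  map_add' x y := by ext i; simp

lemma unfold_int {d : ℕ} (G : EE d → ℂ) (hG : Integrable G) :
    ∫ ξ in box d, ∑' k : Fin d → ℤ, G (ξ - zE k) = ∫ ξ, G ξ := by
  let : AddAction (Fin d → ℤ) (EE d) := AddAction.compHom (EE d) (zEh d)
  have hv : ∀ (k : Fin d → ℤ) (x : EE d), k +ᵥ x = zE k + x := fun k x => rfl
  have hv' : ∀ (k : Fin d → ℤ) (x : EE d), -k +ᵥ x = x - zE k := by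
    intro k x; rw [hv]; ext i; simp; ring
  have : MeasurableConstVAdd (Fin d → ℤ) (EE d) := ⟨fun c => by
    change Measurable fun x : EE d => zE c + x
    exact measurable_const_add _⟩
  have : VAddInvariantMeasure (Fin d → ℤ) (EE d) volume := ⟨fun c s hs => by
    change volume ((fun x : EE d => zE c + x) ⁻¹' s) = volume s
    exact measure_preimage_add _ _ _⟩
  have hD : IsAddFundamentalDomain (Fin d → ℤ) (box d) (volume : Measure (EE d)) := by
    refine IsAddFundamentalDomain.mk' (box_meas d).nullMeasurableSet fun x => ?_
    refine ⟨fun i => -⌊x i⌋, ?_, ?_⟩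
    · change _ ∈ box d
      rw [hv]; intro i
      simp only [PiLp.add_apply, zE_apply, Set.mem_Ico]; push_cast
      have := Int.floor_le (x i); have := Int.lt_floor_add_one (x i)
      constructor <;> linarith
    · intro k hk
      rw [hv] at hk
      funext i
      have h := hk i
      simp only [PiLp.add_apply, zE_apply, Set.mem_Ico] at h
      have : ⌊x i⌋ = -k i := by
        rw [Int.floor_eq_iff]; push_cast; constructor <;> linarith
      rw [this]; ring
  have h1 := hD.integral_eq_tsum' G hG
  have h2 := hD.lintegral_eq_tsum' (fun x => ‖G x‖ₑ)
  simp only [hv'] at h1 h2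
  rw [h1]
  refine integral_tsum (fun k => ?_) ?_
  · exact (hG.comp_sub_right (zE k)).aestronglyMeasurable.restrict
  · rw [← h2]; exact hG.2.ne

lemma fin_supp {d : ℕ} (M : EE d → ℂ) (R : ℝ) (hM : ∀ θ i, R < |θ i| → M θ = 0) (w : EE d) :
    (Function.support fun k : Fin d → ℤ => M (w - zE k)).Finite := by
  refine (Set.Finite.pi' (t := fun i => Set.Icc ⌊w i - R⌋ ⌈w i + R⌉) fun i => Set.finite_Icc _ _).subset ?_
  intro k hk i
  by_contra hc
  refine hk (hM _ i ?_)
  simp only [PiLp.sub_apply, zE_apply]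
  by_contra h2
  push Not at h2
  rw [abs_le] at h2
  refine hc ⟨Int.floor_le_iff.2 ?_, Int.le_ceil_iff.2 ?_⟩ <;> linarith

lemma tsum_UN (ρ : ℝ) (d N : ℕ) (g : EE d → ℂ) :
    ∑' v : UNIW ρ d N, g v = ∑ v ∈ Uf d (DIW ρ) (mm ρ N) (QzeroIW ρ N), g (WithLp.toLp 2 v) := by
  classical
  have hs : UNIW ρ d N = ↑((Uf d (DIW ρ) (mm ρ N) (QzeroIW ρ N)).image (WithLp.toLp 2)) := by
    ext v
    rw [UN_eq]
    simp only [Finset.coe_image, Set.mem_image, Finset.mem_coe]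
    constructor
    · intro h; exact ⟨_, h, rfl⟩
    · rintro ⟨x, hx, rfl⟩; exact hx
  rw [hs, Finset.tsum_subtype' _ g, Finset.sum_image]
  intro a _ b _ h
  exact (WithLp.toLp_injective 2) h

lemma int_ee {d : ℕ} {M : EE d → ℂ} (hM : Integrable M) (z : Fin d → ℝ) (v : EE d) :
    Integrable (fun ξ : EE d => M (ξ - v) * ee (∑ j, ξ j * z j)) := by
  have := osc_integrable (hM.comp_sub_right v) (fun ξ : EE d => ∑ j, ξ j * z j) (by fun_prop)
  simpa only [mul_comm] using this

lemma disc_formula (ρ : ℝ) (d N : ℕ) (Θ : EE d → ℂ) (η : EE d → ℝ) (e : Fin d → ℝ) (R : ℝ)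
    (hM : Integrable fun θ => Θ θ * (η (sc e θ) : ℂ))
    (hR : ∀ (θ : EE d) i, R < |θ i| → Θ θ * (η (sc e θ) : ℂ) = 0)
    (F : Finset (Fin d → ℤ)) (f : (Fin d → ℤ) → ℂ) (hf : ∀ y ∉ F, f y = 0) (x : Fin d → ℤ) :
    discOpIW ρ d N Θ η e f x = ∑ y ∈ F, f y *
      (kap d (DIW ρ) (mm ρ N) (QzeroIW ρ N) (fun j => y j - x j) : ℂ) *
        ∫ θ : EE d, Θ θ * (η (sc e θ) : ℂ) * ee (∑ j, θ j * ((y j : ℝ) - x j)) := by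
  set M : EE d → ℂ := fun θ => Θ θ * (η (sc e θ) : ℂ) with hMdef
  set U := Uf d (DIW ρ) (mm ρ N) (QzeroIW ρ N) with hU
  set G : EE d → ℂ := fun ξ => ∑ v ∈ U, ∑ y ∈ F, f y *
    (M (ξ - WithLp.toLp 2 v) * ee (∑ j, ξ j * ((y j : ℝ) - x j))) with hG
  have hGi : Integrable G := by
    refine integrable_finsetSum _ fun v _ => integrable_finsetSum _ fun y _ => ?_
    exact (int_ee hM (fun j => (y j : ℝ) - x j) (WithLp.toLp 2 v)).const_mul _
  have h1 : discOpIW ρ d N Θ η e f x = ∫ ξ in box d, ∑' k : Fin d → ℤ, G (ξ - zE k) := by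
    rw [discOpIW]
    refine integral_congr_ae (Filter.Eventually.of_forall fun ξ => ?_)
    have hδ : deltaIW ρ d N Θ η e ξ = ∑ v ∈ U, ∑' k : Fin d → ℤ, M (ξ - WithLp.toLp 2 v - zE k) := by
      rw [deltaIW]
      exact tsum_UN ρ d N (fun v => ∑' k : Fin d → ℤ, M (ξ - v - zE k))
    have hy : (∑' y : Fin d → ℤ, f y *
        Complex.exp (2 * Real.pi * Complex.I * (∑ i, ξ i * (y i : ℝ)))) =
        ∑ y ∈ F, f y * ee (∑ i, ξ i * (y i : ℝ)) := by
      rw [tsum_eq_sum (s := F) (fun y hy => by rw [hf y hy, zero_mul])]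
      refine Finset.sum_congr rfl fun y _ => ?_
      rw [ee]
    have hx : Complex.exp (-(2 * Real.pi * Complex.I) * (∑ i, ξ i * (x i : ℝ))) =
        ee (-(∑ i, ξ i * (x i : ℝ))) := by
      rw [ee]; push_cast; ring_nf
    beta_reduce
    rw [hδ, hy]
    have hee : ∀ y : Fin d → ℤ, ∀ k : Fin d → ℤ,
        ee (∑ j, (ξ - zE k) j * ((y j : ℝ) - x j)) =
          ee (∑ i, ξ i * (y i : ℝ)) * ee (-(∑ i, ξ i * (x i : ℝ))) := by
      intro y k
      have : ∑ j, (ξ - zE k) j * ((y j : ℝ) - x j) =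
          ((∑ i, ξ i * (y i : ℝ)) + (-(∑ i, ξ i * (x i : ℝ)))) + ((∑ j, -(k j * (y j - x j)) : ℤ) : ℝ) := by
        push_cast
        rw [← Finset.sum_neg_distrib, ← Finset.sum_add_distrib, ← Finset.sum_add_distrib]
        refine Finset.sum_congr rfl fun j _ => ?_
        simp only [PiLp.sub_apply, zE_apply]; ring
      rw [this, ee_add, ee_int, ee_add, mul_one]
    have hGk : ∀ k : Fin d → ℤ, G (ξ - zE k) = ∑ v ∈ U, M (ξ - WithLp.toLp 2 v - zE k) *
        ((∑ y ∈ F, f y * ee (∑ i, ξ i * (y i : ℝ))) * ee (-(∑ i, ξ i * (x i : ℝ)))) := by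
      intro k
      simp only [hG]
      refine Finset.sum_congr rfl fun v _ => ?_
      rw [Finset.sum_mul, Finset.mul_sum]
      refine Finset.sum_congr rfl fun y _ => ?_
      rw [hee, sub_right_comm]; ring
    simp only [hGk]
    have hs : ∀ v ∈ U, Summable fun k : Fin d → ℤ => M (ξ - WithLp.toLp 2 v - zE k) *
        ((∑ y ∈ F, f y * ee (∑ i, ξ i * (y i : ℝ))) * ee (-(∑ i, ξ i * (x i : ℝ)))) := by
      intro v _
      exact (summable_of_hasFiniteSupport (fin_supp M R hR _)).mul_right _
    rw [Summable.tsum_finsetSum hs]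
    simp only [tsum_mul_right]
    rw [← Finset.sum_mul, ← mul_assoc]
    exact congrArg _ hx
  rw [h1, unfold_int G hGi]
  simp only [hG]
  rw [integral_finsetSum _ fun v _ => integrable_finsetSum _ fun y _ =>
    (int_ee hM (fun j => (y j : ℝ) - x j) (WithLp.toLp 2 v)).const_mul _]
  have h2 : ∀ v ∈ U, ∫ ξ, ∑ y ∈ F, f y *
    (M (ξ - WithLp.toLp 2 v) * ee (∑ j, ξ j * ((y j : ℝ) - x j))) =
      ∑ y ∈ F, f y * (ee (∑ j, v j * ((y j : ℝ) - x j)) *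
        ∫ θ : EE d, M θ * ee (∑ j, θ j * ((y j : ℝ) - x j))) := by
    intro v _
    rw [integral_finsetSum _ fun y _ =>
      (int_ee hM (fun j => (y j : ℝ) - x j) (WithLp.toLp 2 v)).const_mul _]
    refine Finset.sum_congr rfl fun y _ => ?_
    rw [integral_const_mul]
    congr 1
    rw [← integral_const_mul, ← integral_sub_right_eq_self (fun a : EE d =>
      ee (∑ j, v j * ((y j : ℝ) - x j)) * (M a * ee (∑ j, a j * ((y j : ℝ) - x j))))
      (WithLp.toLp 2 v : EE d)]
    congr 1; funext ξ
    have : ∑ j, ξ j * ((y j : ℝ) - x j) = (∑ j, v j * ((y j : ℝ) - x j)) +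
        ∑ j, (ξ - WithLp.toLp 2 v) j * ((y j : ℝ) - x j) := by
      rw [← Finset.sum_add_distrib]
      refine Finset.sum_congr rfl fun j _ => ?_
      simp only [PiLp.sub_apply]; ring
    rw [this, ee_add]; ring
  rw [Finset.sum_congr rfl h2, Finset.sum_comm]
  refine Finset.sum_congr rfl fun y _ => ?_
  rw [← Finset.mul_sum, ← Finset.sum_mul, mul_assoc]
  congr 2
  have := sum_Uf (d := d) (D := DIW ρ) (m := mm ρ N) (Q := QzeroIW ρ N) mm_pos (Q_pos ρ N) mm_cop Q_cop (fun j => y j - x j)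
  rw [← this]
  refine Finset.sum_congr rfl fun v _ => ?_
  congr 1
  push_cast
  rfl

end IW

open scoped BigOperators
set_option linter.unusedSectionVars false
set_option linter.unusedVariables false
namespace IW
open MeasureTheory
open scoped FourierTransform ContDiff

lemma holder_E {ι : Type} (s : Finset ι) (w a b : ι → ENNReal) {p q : ℝ} (hpq : p.HolderConjugate q) :
    ∑ n ∈ s, w n * (a n ^ (1/p) * b n ^ (1/q)) ≤
      (∑ n ∈ s, w n * a n) ^ (1/p) * (∑ n ∈ s, w n * b n) ^ (1/q) := by
  have hp := hpq.pos
  have hq := hpq.symm.pos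
  have h := ENNReal.inner_le_Lp_mul_Lq s (fun n => (w n * a n) ^ (1/p)) (fun n => (w n * b n) ^ (1/q)) hpq
  refine le_trans (le_of_eq ?_) (h.trans (le_of_eq ?_))
  · refine Finset.sum_congr rfl fun n _ => ?_
    have hw : w n = w n ^ (1/p) * w n ^ (1/q) := by
      rw [← ENNReal.rpow_add_of_nonneg _ _ (by positivity) (by positivity)]
      have : 1/p + 1/q = 1 := by simpa using hpq.inv_add_inv_eq_one
      rw [this, ENNReal.rpow_one]
    rw [ENNReal.mul_rpow_of_nonneg _ _ (by positivity), ENNReal.mul_rpow_of_nonneg _ _ (by positivity)]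
    conv_lhs => rw [hw]
    ring
  · have e1 : ∀ x : ENNReal, (x ^ (1/p)) ^ p = x := fun x => by
      rw [← ENNReal.rpow_mul, one_div_mul_cancel hp.ne', ENNReal.rpow_one]
    have e2 : ∀ x : ENNReal, (x ^ (1/q)) ^ q = x := fun x => by
      rw [← ENNReal.rpow_mul, one_div_mul_cancel hq.ne', ENNReal.rpow_one]
    simp only [e1, e2]

section fin
variable {d : ℕ}

lemma Wf_fourier_int {ι : Type} [Fintype ι] [DecidableEq ι] (m : ι → ℕ) (Q : ℕ) [∀ i, NeZero (m i)] [NeZero Q]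
    (D : ℕ) (e : Fin d → ℝ) (he : ∀ i, 0 < e i) (F : Finset (Fin d → ℤ)) (f : (Fin d → ℤ) → ℂ)
    (n : HH d m Q) : Integrable (𝓕 (Wf m Q D e F f n)) := by
  have h : 𝓕 (Wf m Q D e F f n) = fun θ : EE d =>
      (∑ x ∈ F, f x * (kH m Q D x n : ℂ) * ee (∑ j, θ j * x j)) * (Kh e θ : ℂ) :=
    funext fun θ => Wf_fourier m Q D e he F f n θ
  rw [h]
  refine Continuous.integrable_of_hasCompactSupport ?_ (Khc_compact e he).mul_left
  refine Continuous.mul ?_ (Khc_smooth e).continuous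
  refine continuous_finsetSum _ fun x _ => continuous_const.mul ?_
  exact continuous_ee.comp (by fun_prop)

lemma pairing (ρ : ℝ) (N : ℕ) (Θ : EE d → ℂ) (η : EE d → ℝ) (e : Fin d → ℝ) (he : ∀ i, 0 < e i) (R : ℝ)
    (hM : Integrable fun θ => Θ θ * (η (sc e θ) : ℂ))
    (hR : ∀ (θ : EE d) i, R < |θ i| → Θ θ * (η (sc e θ) : ℂ) = 0)
    (η₂ : EE d → ℂ)
    (hη₂ : ∀ θ, (η (sc e θ) : ℂ) = η₂ (sc e θ) * (Kh e θ : ℂ) * (Kh e (-θ) : ℂ))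
    (F : Finset (Fin d → ℤ)) (f : (Fin d → ℤ) → ℂ) (hf : ∀ y ∉ F, f y = 0)
    (G : Finset (Fin d → ℤ)) (g : (Fin d → ℤ) → ℂ) :
    ∑ x ∈ G, discOpIW ρ d N Θ η e f x * g x =
      ∑ n, (un (HH d (mm ρ N) (QzeroIW ρ N)) n : ℂ) *
        ∫ θ, Θ θ * η₂ (sc e θ) * 𝓕 (Wf (mm ρ N) (QzeroIW ρ N) (DIW ρ) e F f n) θ *
          𝓕⁻ (Wf (mm ρ N) (QzeroIW ρ N) (DIW ρ) e G g n) θ := by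
  set m := mm ρ N
  set Q := QzeroIW ρ N
  set D := DIW ρ
  set J : (Fin d → ℤ) → (Fin d → ℤ) → ℂ := fun x y =>
    ∫ θ : EE d, Θ θ * (η (sc e θ) : ℂ) * ee (∑ j, θ j * ((y j : ℝ) - x j)) with hJ
  have hinteg : ∀ x y : Fin d → ℤ, Integrable fun θ : EE d =>
      Θ θ * (η (sc e θ) : ℂ) * ee (∑ j, θ j * ((y j : ℝ) - x j)) := by
    intro x y
    have := int_ee hM (fun j => (y j : ℝ) - x j) 0
    simpa only [sub_zero] using this
  have h1 : ∀ n, ∫ θ, Θ θ * η₂ (sc e θ) * 𝓕 (Wf m Q D e F f n) θ * 𝓕⁻ (Wf m Q D e G g n) θ =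
      ∑ x ∈ G, ∑ y ∈ F, (f y * g x) * ((kH m Q D y n : ℂ) * (kH m Q D x n : ℂ)) * J x y := by
    intro n
    have h2 : ∀ θ : EE d, Θ θ * η₂ (sc e θ) * 𝓕 (Wf m Q D e F f n) θ * 𝓕⁻ (Wf m Q D e G g n) θ =
        ∑ x ∈ G, ∑ y ∈ F, (f y * g x) * ((kH m Q D y n : ℂ) * (kH m Q D x n : ℂ)) *
          (Θ θ * (η (sc e θ) : ℂ) * ee (∑ j, θ j * ((y j : ℝ) - x j))) := by
      intro θ
      rw [Real.fourierInv_eq_fourier_neg, Wf_fourier m Q D e he, Wf_fourier m Q D e he, hη₂]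
      have h3 : Θ θ * η₂ (sc e θ) * ((∑ x ∈ F, f x * (kH m Q D x n : ℂ) * ee (∑ j, θ j * x j)) * (Kh e θ : ℂ)) *
          ((∑ x ∈ G, g x * (kH m Q D x n : ℂ) * ee (∑ j, (-θ) j * x j)) * (Kh e (-θ) : ℂ)) =
          (∑ x ∈ G, g x * (kH m Q D x n : ℂ) * ee (∑ j, (-θ) j * x j)) *
          (∑ x ∈ F, f x * (kH m Q D x n : ℂ) * ee (∑ j, θ j * x j)) *
          (Θ θ * (η₂ (sc e θ) * (Kh e θ : ℂ) * (Kh e (-θ) : ℂ))) := by ring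
      rw [h3, Finset.sum_mul_sum, Finset.sum_mul]
      refine Finset.sum_congr rfl fun x _ => ?_
      rw [Finset.sum_mul]
      refine Finset.sum_congr rfl fun y _ => ?_
      have h4 : ∑ j, θ j * ((y j : ℝ) - x j) = (∑ j, (-θ) j * (x j : ℝ)) + ∑ j, θ j * (y j : ℝ) := by
        rw [← Finset.sum_add_distrib]
        refine Finset.sum_congr rfl fun j _ => ?_
        simp only [PiLp.neg_apply]; ring
      rw [h4, ee_add]; ring
    simp only [h2]
    rw [integral_finsetSum _ fun x _ => integrable_finsetSum _ fun y _ => (hinteg x y).const_mul _]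
    refine Finset.sum_congr rfl fun x _ => ?_
    rw [integral_finsetSum _ fun y _ => (hinteg x y).const_mul _]
    refine Finset.sum_congr rfl fun y _ => ?_
    rw [integral_const_mul]
  refine Eq.trans ?_ (Finset.sum_congr rfl fun n _ =>
    congrArg (fun z => (un (HH d (mm ρ N) (QzeroIW ρ N)) n : ℂ) * z) (h1 n)).symm
  simp only [Finset.mul_sum]
  rw [Finset.sum_comm]
  refine Finset.sum_congr rfl fun x _ => ?_
  rw [disc_formula ρ d N Θ η e R hM hR F f hf x, Finset.sum_mul, Finset.sum_comm]
  refine Finset.sum_congr rfl fun y _ => ?_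
  have hk := kH_pair m Q D y x
  have hk' : (kap d D m Q (fun j => y j - x j) : ℂ) =
      ∑ n, (un (HH d m Q) n : ℂ) * ((kH m Q D y n : ℂ) * (kH m Q D x n : ℂ)) := by
    rw [← hk]; push_cast; rfl
  change f y * (kap d D m Q (fun j => y j - x j) : ℂ) * J x y * g x = _
  rw [hk', Finset.mul_sum, Finset.sum_mul, Finset.sum_mul]
  refine Finset.sum_congr rfl fun n _ => ?_
  ring

lemma pairing_bound (ρ : ℝ) (N : ℕ) (Θ : EE d → ℂ) (hΘ : Measurable Θ) (B : ℝ) (hB : ∀ ξ, ‖Θ ξ‖ ≤ B)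
    (η : EE d → ℝ) (e : Fin d → ℝ) (he : ∀ i, 0 < e i) (R : ℝ)
    (hM : Integrable fun θ => Θ θ * (η (sc e θ) : ℂ))
    (hR : ∀ (θ : EE d) i, R < |θ i| → Θ θ * (η (sc e θ) : ℂ) = 0)
    (η₂ : EE d → ℂ)
    (hη₂ : ∀ θ, (η (sc e θ) : ℂ) = η₂ (sc e θ) * (Kh e θ : ℂ) * (Kh e (-θ) : ℂ))
    (r : EE d → ℂ) (hr : Integrable r) (hηr : ∀ u, η₂ u = ∫ s, ee (-(∑ j, s j * u j)) * r s)
    {p q : ℝ} (hpq : p.HolderConjugate q) (A : ENNReal)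
    (hA : ∀ φ : EE d → ℂ, (∀ q : ENNReal, MemLp φ q) →
      (∫⁻ t, ‖𝓕⁻ (fun ξ => Θ ξ * 𝓕 φ ξ) t‖ₑ ^ p) ^ (1/p) ≤ A * (∫⁻ t, ‖φ t‖ₑ ^ p) ^ (1/p))
    (Cp Cq : ℝ) (hCp : 0 ≤ Cp) (hCq : 0 ≤ Cq)
    (hWp : ∀ (F : Finset (Fin d → ℤ)) (f : (Fin d → ℤ) → ℂ) (t : EE d),
      ∑ n, un (HH d (mm ρ N) (QzeroIW ρ N)) n * ‖Wf (mm ρ N) (QzeroIW ρ N) (DIW ρ) e F f n t‖ ^ p ≤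
      Cp * ∑ x ∈ F, Kr e (t + zE x) * ‖f x‖ ^ p)
    (hWq : ∀ (F : Finset (Fin d → ℤ)) (f : (Fin d → ℤ) → ℂ) (t : EE d),
      ∑ n, un (HH d (mm ρ N) (QzeroIW ρ N)) n * ‖Wf (mm ρ N) (QzeroIW ρ N) (DIW ρ) e F f n t‖ ^ q ≤
      Cq * ∑ x ∈ F, Kr e (t + zE x) * ‖f x‖ ^ q)
    (F : Finset (Fin d → ℤ)) (f : (Fin d → ℤ) → ℂ) (hf : ∀ y ∉ F, f y = 0)
    (G : Finset (Fin d → ℤ)) (g : (Fin d → ℤ) → ℂ) :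
    ‖∑ x ∈ G, discOpIW ρ d N Θ η e f x * g x‖ₑ ≤ (∫⁻ s, ‖r s‖ₑ) * A *
      (ENNReal.ofReal (Cp * ∑ x ∈ F, ‖f x‖ ^ p) ^ (1/p) *
        ENNReal.ofReal (Cq * ∑ x ∈ G, ‖g x‖ ^ q) ^ (1/q)) := by
  have hp := hpq.pos
  have hq := hpq.symm.pos
  rw [pairing ρ N Θ η e he R hM hR η₂ hη₂ F f hf G g]
  set m := mm ρ N
  set Q := QzeroIW ρ N
  set D := DIW ρ
  have hζ : ∀ θ : EE d, η₂ (sc e θ) = ∫ s, ee (-(∑ j, s j / e j * θ j)) * r s := by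
    intro θ
    rw [hηr]
    congr 1; funext s
    congr 3
    refine Finset.sum_congr rfl fun j _ => ?_
    simp only [sc]; ring
  have h1 : ∀ n, ‖∫ θ, Θ θ * η₂ (sc e θ) * 𝓕 (Wf m Q D e F f n) θ * 𝓕⁻ (Wf m Q D e G g n) θ‖ₑ ≤
      (∫⁻ s, ‖r s‖ₑ) * (A * (∫⁻ t, ‖Wf m Q D e F f n t‖ₑ ^ p) ^ (1/p) *
        (∫⁻ t, ‖Wf m Q D e G g n t‖ₑ ^ q) ^ (1/q)) := fun n =>
    pair_r Θ hΘ B hB (Wf_fourier_int m Q D e he F f n) (Wf_integrable m Q D e he G g n) hpq A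
      (hA _ fun q => Wf_memLp m Q D e he F f n q) r hr e (fun θ => η₂ (sc e θ)) hζ
  calc ‖∑ n, (un (HH d m Q) n : ℂ) *
        ∫ θ, Θ θ * η₂ (sc e θ) * 𝓕 (Wf m Q D e F f n) θ * 𝓕⁻ (Wf m Q D e G g n) θ‖ₑ
      ≤ ∑ n, ‖(un (HH d m Q) n : ℂ) *
        ∫ θ, Θ θ * η₂ (sc e θ) * 𝓕 (Wf m Q D e F f n) θ * 𝓕⁻ (Wf m Q D e G g n) θ‖ₑ := enorm_sum_le _ _
    _ ≤ ∑ n, ENNReal.ofReal (un (HH d m Q) n) * ((∫⁻ s, ‖r s‖ₑ) * (A * (∫⁻ t, ‖Wf m Q D e F f n t‖ₑ ^ p) ^ (1/p) *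
        (∫⁻ t, ‖Wf m Q D e G g n t‖ₑ ^ q) ^ (1/q))) := by
        refine Finset.sum_le_sum fun n _ => ?_
        rw [enorm_mul]
        refine mul_le_mul' (le_of_eq ?_) (h1 n)
        rw [← ofReal_norm, Complex.norm_real, Real.norm_of_nonneg (un_nonneg _ _)]
    _ = (∫⁻ s, ‖r s‖ₑ) * A * ∑ n, ENNReal.ofReal (un (HH d m Q) n) *
          ((∫⁻ t, ‖Wf m Q D e F f n t‖ₑ ^ p) ^ (1/p) * (∫⁻ t, ‖Wf m Q D e G g n t‖ₑ ^ q) ^ (1/q)) := by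
        rw [Finset.mul_sum]
        refine Finset.sum_congr rfl fun n _ => ?_
        ring
    _ ≤ _ := by
        refine mul_le_mul' le_rfl ((holder_E _ _ _ _ hpq).trans (mul_le_mul' ?_ ?_))
        · exact ENNReal.rpow_le_rpow (W_int m Q D p hpq.lt e he Cp hCp F f (hWp F f)) (by positivity)
        · exact ENNReal.rpow_le_rpow (W_int m Q D q hpq.symm.lt e he Cq hCq G g (hWq G g)) (by positivity)

end fin
end IW

open scoped BigOperators
set_option linter.unusedSectionVars false
set_option linter.unusedVariables false
namespace IW
open MeasureTheory
open scoped FourierTransform ContDiff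

lemma mult_supp {d : ℕ} (hd : 1 ≤ d) (Θ : EE d → ℂ) (η : EE d → ℝ)
    (hη0 : ∀ x : EE d, 1 / (8 * d) ≤ ‖x‖ → η x = 0) (e : Fin d → ℝ) (he : ∀ i, 0 < e i)
    (θ : EE d) (i : Fin d) (h : e i < |θ i|) : η (sc e θ) = 0 := by
  refine hη0 _ (le_trans ?_ (coord_le _ i))
  have hd' : (1:ℝ) ≤ d := by exact_mod_cast hd
  have h1 : 1 / (8 * (d:ℝ)) ≤ 1 := by
    rw [div_le_one (by positivity)]; linarith
  refine h1.trans ?_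
  simp only [sc]
  rw [abs_div, abs_of_pos (he i), le_div_iff₀ (he i)]; linarith

lemma mult_int {d : ℕ} (hd : 1 ≤ d) (Θ : EE d → ℂ) (hΘ : Measurable Θ) (B : ℝ) (hB : ∀ ξ, ‖Θ ξ‖ ≤ B)
    (η : EE d → ℝ) (hη : ContDiff ℝ ∞ η)
    (hη0 : ∀ x : EE d, 1 / (8 * d) ≤ ‖x‖ → η x = 0) (e : Fin d → ℝ) (he : ∀ i, 0 < e i) :
    Integrable fun θ => Θ θ * (η (sc e θ) : ℂ) := by
  have hsc : Continuous (sc e) := by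
    unfold sc
    refine (PiLp.continuous_toLp 2 _).comp ?_
    fun_prop
  have hi : Integrable fun θ => (η (sc e θ) : ℂ) := by
    refine Continuous.integrable_of_hasCompactSupport ?_ ?_
    · exact Complex.continuous_ofReal.comp (hη.continuous.comp hsc)
    · refine HasCompactSupport.intro (compact_box e) fun x hx => ?_
      simp only [Set.mem_ofPred_eq, not_forall, not_le] at hx
      obtain ⟨i, hi⟩ := hx
      rw [mult_supp hd Θ η hη0 e he x i hi]; simp
  exact hi.bdd_mul (c := B) hΘ.aestronglyMeasurable (Filter.Eventually.of_forall hB)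

lemma nn_rpow (z : ℂ) {p : ℝ} (hp : 0 ≤ p) : ((‖z‖₊ : ENNReal)) ^ p = ENNReal.ofReal (‖z‖ ^ p) := by
  rw [← ENNReal.ofReal_rpow_of_nonneg (norm_nonneg _) hp, ofReal_norm]; rfl

theorem main (d : ℕ) (hd : 1 ≤ d) (η : EE d → ℝ) (hη : ContDiff ℝ ∞ η)
    (hη0 : ∀ x : EE d, 1 / (8 * d) ≤ ‖x‖ → η x = 0)
    (ρ : ℝ) (hρ : 0 < ρ) (p : ENNReal) (hp1 : 1 < p) (hp2 : p ≠ ⊤) :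
    ∃ C : ℝ, 0 < C ∧
      ∀ Θ : EE d → ℂ, Measurable Θ → (∃ B : ℝ, ∀ ξ, ‖Θ ξ‖ ≤ B) →
      ∀ A : ENNReal,  A ≠ ⊤ →
        (∀ f : EE d → ℂ, MemLp f 2 → MemLp f p →
            eLpNorm (𝓕⁻ (fun ξ => Θ ξ * 𝓕 f ξ)) p volume ≤ A * eLpNorm f p volume) →
      ∀ N : ℕ, 1 ≤ N →
      ∀ eN : Fin d → ℝ, (∀ i, 0 < eN i ∧ eN i ≤ Real.exp (-(N : ℝ) ^ (2 * ρ))) →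
      ∀ f : (Fin d → ℤ) → ℂ, (Function.support f).Finite →
        (∑' x : Fin d → ℤ,
            (‖discOpIW ρ d N Θ η eN f x‖₊ : ENNReal) ^ p.toReal) ^ (1 / p.toReal)
          ≤ ENNReal.ofReal C * A *
            (∑' x : Fin d → ℤ, (‖f x‖₊ : ENNReal) ^ p.toReal) ^ (1 / p.toReal) := by
  classical
  set P := p.toReal with hP
  have hP1 : 1 < P := by
    have := (ENNReal.toReal_lt_toReal ENNReal.one_ne_top hp2).2 hp1
    simpa using this
  have hp0 : p ≠ 0 := (zero_lt_one.trans hp1).ne'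
  set q := P.conjExponent with hq
  have hpq : P.HolderConjugate q := Real.HolderConjugate.conjExponent hP1
  have hP0 : 0 < P := hpq.pos
  have hq0 : 0 < q := hpq.symm.pos
  obtain ⟨r, hr, η₂, hη₂r, hη₂⟩ := eta_r d hd η hη hη0
  obtain ⟨Cp, hCp, hWp⟩ := W_bound d ρ hρ P hP1
  obtain ⟨Cq, hCq, hWq⟩ := W_bound d ρ hρ q hpq.symm.lt
  have hR0 : (∫⁻ s, ‖r s‖ₑ) ≠ ⊤ := hr.2.ne
  set Rr := (∫⁻ s, ‖r s‖ₑ).toReal with hRr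
  have hRr0 : 0 ≤ Rr := ENNReal.toReal_nonneg
  set K := Rr * Cp ^ (1/P) * Cq ^ (1/q) with hK
  have hK0 : 0 ≤ K := by positivity
  refine ⟨K + 1, by positivity, ?_⟩
  rintro Θ hΘ ⟨B, hB⟩ A hAtop hA N hN e he f hfin
  have he0 : ∀ i, 0 < e i := fun i => (he i).1
  set F := hfin.toFinset with hF
  have hfF : ∀ y ∉ F, f y = 0 := by
    intro y hy; simpa [hF] using hy
  have hM := mult_int hd Θ hΘ B hB η hη hη0 e he0
  have hR : ∀ (θ : EE d) i, (∑ i, e i) < |θ i| → Θ θ * (η (sc e θ) : ℂ) = 0 := by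
    intro θ i h
    have : e i ≤ ∑ i, e i := Finset.single_le_sum (f := e) (fun i _ => (he0 i).le) (Finset.mem_univ i)
    rw [mult_supp hd Θ η hη0 e he0 θ i (by linarith)]; simp
  have hA' : ∀ φ : EE d → ℂ, (∀ q : ENNReal, MemLp φ q) →
      (∫⁻ t, ‖𝓕⁻ (fun ξ => Θ ξ * 𝓕 φ ξ) t‖ₑ ^ P) ^ (1/P) ≤ A * (∫⁻ t, ‖φ t‖ₑ ^ P) ^ (1/P) := by
    intro φ hφ
    have := hA φ (hφ 2) (hφ p)
    rwa [eLpNorm_eq_lintegral_rpow_enorm_toReal hp0 hp2,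
      eLpNorm_eq_lintegral_rpow_enorm_toReal hp0 hp2] at this
  set S := ∑ x ∈ F, ‖f x‖ ^ P with hS
  have hS0 : 0 ≤ S := Finset.sum_nonneg fun x _ => by positivity
  set a := A.toReal with ha
  have ha0 : 0 ≤ a := ENNReal.toReal_nonneg
  have haA : ENNReal.ofReal a = A := ENNReal.ofReal_toReal hAtop
  have hRA : ENNReal.ofReal Rr = ∫⁻ s, ‖r s‖ₑ := ENNReal.ofReal_toReal hR0
  set M := K * a * S ^ (1/P) with hMd
  have hM0 : 0 ≤ M := by positivity
  have key : ∀ G : Finset (Fin d → ℤ), ∑ x ∈ G, ‖discOpIW ρ d N Θ η e f x‖ ^ P ≤ M ^ P := by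
    intro G
    have := duality G (fun _ => 1) (fun _ _ => zero_le_one) (fun x => discOpIW ρ d N Θ η e f x) hpq hM0 ?_
    · simpa using this
    · intro g _
      have hb := pairing_bound ρ N Θ hΘ B hB η e he0 _ hM hR η₂ (hη₂ e) r hr hη₂r hpq A hA' Cp Cq hCp hCq
        (hWp N hN e he) (hWq N hN e he) F f hfF G g
      simp only [Complex.ofReal_one, one_mul]
      set T := ∑ x ∈ G, ‖g x‖ ^ q with hT
      have hT0 : 0 ≤ T := Finset.sum_nonneg fun x _ => by positivity
      rw [← hRA, ← haA, ENNReal.ofReal_rpow_of_nonneg (by positivity) (by positivity),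
        ENNReal.ofReal_rpow_of_nonneg (by positivity) (by positivity), ← ENNReal.ofReal_mul (by positivity),
        ← ENNReal.ofReal_mul (by positivity), ← ENNReal.ofReal_mul (by positivity), ← ofReal_norm,
        ENNReal.ofReal_le_ofReal_iff (by positivity)] at hb
      refine hb.trans (le_of_eq ?_)
      rw [Real.mul_rpow hCp hS0, Real.mul_rpow hCq hT0, hMd, hK]; ring
  have hL : (∑' x : Fin d → ℤ, (‖discOpIW ρ d N Θ η e f x‖₊ : ENNReal) ^ P) ≤ ENNReal.ofReal (M ^ P) := by
    rw [ENNReal.tsum_eq_iSup_sum]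
    refine iSup_le fun G => ?_
    simp only [nn_rpow _ hP0.le]
    rw [← ENNReal.ofReal_sum_of_nonneg fun x _ => by positivity]
    exact ENNReal.ofReal_le_ofReal (key G)
  have hRt : (∑' x : Fin d → ℤ, (‖f x‖₊ : ENNReal) ^ P) = ENNReal.ofReal S := by
    rw [tsum_eq_sum (s := F) fun x hx => by rw [hfF x hx]; simp [hP0]]
    simp only [nn_rpow _ hP0.le]
    rw [← ENNReal.ofReal_sum_of_nonneg fun x _ => by positivity]
  rw [hRt]
  calc _ ≤ (ENNReal.ofReal (M ^ P)) ^ (1/P) := ENNReal.rpow_le_rpow hL (by positivity)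
    _ = ENNReal.ofReal M := by
        rw [ENNReal.ofReal_rpow_of_nonneg (by positivity) (by positivity), ← Real.rpow_mul hM0,
          mul_one_div_cancel hP0.ne', Real.rpow_one]
    _ = ENNReal.ofReal K * A * ENNReal.ofReal S ^ (1/P) := by
        rw [← haA, ENNReal.ofReal_rpow_of_nonneg hS0 (by positivity), ← ENNReal.ofReal_mul hK0,
          ← ENNReal.ofReal_mul (by positivity)]
    _ ≤ _ := by
        gcongr
        linarith

end IW


/-- **Ionescu–Wainger type multiplier theorem with logarithmic loss (Theorem 6.1).** -/
theorem statement15 (d : ℕ) (η : EuclideanSpace ℝ (Fin d) → ℝ)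
    (hηsm : ContDiff ℝ (⊤ : ℕ∞) η) (hη01 : ∀ x, 0 ≤ η x ∧ η x ≤ 1)
    (hη1 : ∀ x : EuclideanSpace ℝ (Fin d), ‖x‖ ≤ 1 / (16 * d) → η x = 1)
    (hη0 : ∀ x : EuclideanSpace ℝ (Fin d), 1 / (8 * d) ≤ ‖x‖ → η x = 0)
    (ρ : ℝ) (hρ : 0 < ρ) (p : ℝ≥0∞) (hp1 : 1 < p) (hp2 : p ≠ ∞) :
    ∃ C : ℝ, 0 < C ∧
      ∀ Θ : EuclideanSpace ℝ (Fin d) → ℂ, Measurable Θ → (∃ B : ℝ, ∀ ξ, ‖Θ ξ‖ ≤ B) →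
      ∀ A : ℝ≥0∞ → ℝ,
        (∀ q : ℝ≥0∞, 1 < q → q ≠ ∞ →
          ∀ f : EuclideanSpace ℝ (Fin d) → ℂ, MemLp f 2 → MemLp f q →
            eLpNorm (FourierTransformInv.fourierInv
                (fun ξ => Θ ξ * FourierTransform.fourier f ξ)) q volume
              ≤ ENNReal.ofReal (A q) * eLpNorm f q volume) →
      ∀ N : ℕ, 1 ≤ N →
      ∀ eN : Fin d → ℝ, (∀ i, 0 < eN i ∧ eN i ≤ Real.exp (-(N : ℝ) ^ (2 * ρ))) →
      ∀ f : (Fin d → ℤ) → ℂ, (Function.support f).Finite →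
        (∑' x : Fin d → ℤ,
            (‖discOpIW ρ d N Θ η eN f x‖₊ : ℝ≥0∞) ^ p.toReal) ^ (1 / p.toReal)
          ≤ ENNReal.ofReal (C * A p * Real.log ((N : ℝ) + 2)) *
            (∑' x : Fin d → ℤ, (‖f x‖₊ : ℝ≥0∞) ^ p.toReal) ^ (1 / p.toReal) := by
  have hd : 1 ≤ d := by
    by_contra h
    have h0 : d = 0 := by omega
    subst h0
    have h1 := hη1 0 (by simp)
    have h2 := hη0 0 (by simp)
    linarith
  obtain ⟨C, hC, hmain⟩ := IW.main d hd η hηsm hη0 ρ hρ p hp1 hp2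
  refine ⟨C, hC, ?_⟩
  intro Θ hΘ hB A hA N hN eN he f hf
  refine (hmain Θ hΘ hB (ENNReal.ofReal (A p)) ENNReal.ofReal_ne_top (hA p hp1 hp2) N hN eN he f hf).trans ?_
  refine mul_le_mul' ?_ le_rfl
  have hN' : (1:ℝ) ≤ N := by exact_mod_cast hN
  have hlog : 1 ≤ Real.log ((N : ℝ) + 2) := by
    rw [Real.le_log_iff_exp_le (by linarith)]
    have := Real.exp_one_lt_d9
    linarith
  have h3 : C * A p * Real.log ((N : ℝ) + 2) = (C * Real.log ((N : ℝ) + 2)) * A p := by ring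
  rw [h3, ENNReal.ofReal_mul (by positivity)]
  refine mul_le_mul' (ENNReal.ofReal_le_ofReal ?_) le_rfl
  nlinarith

end
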